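/- There is an absolute constant c₁ > 0 with the following property. Let K be an isotropic convex body in ℝ^n (n ≥ 2) and set r_n = vol_n(B₂ⁿ)^{−1/n}. Then for every t > 0, max{ N(K, t·r_n·B₂ⁿ), N(B₂ⁿ, t·r_n·K°) } ≤ exp( c₁²·(log n)⁴·n / t² ), where N(A,B) denotes the covering number of A by translates of B. -/

import Mathlib

open MeasureTheory Metric Set
open scoped ENNReal RealInnerProductSpace Pointwise

noncomputable section

/-- The polar body of `K`. -/
def polarBody {n : ℕ} (K : Set (EuclideanSpace ℝ (Fin n))) : Set (EuclideanSpace ℝ (Fin n)) :=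
  {x | ∀ y ∈ K, ⟪x, y⟫ ≤ 1}

/-- `K` is isotropic: volume one, barycenter at the origin, and the quadratic form
`ξ ↦ ∫_K ⟨x, ξ⟩² dx` is constant (`= L_K²`) on the unit sphere. -/
def IsIsotropic {n : ℕ} (K : Set (EuclideanSpace ℝ (Fin n))) : Prop :=
  volume K = 1 ∧ (∫ x in K, x) = (0 : EuclideanSpace ℝ (Fin n)) ∧
    ∃ L : ℝ, 0 < L ∧ ∀ ξ : EuclideanSpace ℝ (Fin n), ‖ξ‖ = 1 →
      (∫ x in K, (⟪x, ξ⟫) ^ 2) = L ^ 2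

/-- The covering number `N(A, B)`: the least number of translates of `B` needed to cover `A`. -/
def covN {n : ℕ} (A B : Set (EuclideanSpace ℝ (Fin n))) : ℕ∞ :=
  sInf ((fun s : Finset (EuclideanSpace ℝ (Fin n)) => (s.card : ℕ∞)) ''
    {s | A ⊆ ⋃ x ∈ s, (fun b => x + b) '' B})

/-- `r_n = vol_n(B₂ⁿ)^{−1/n}`. -/
def rn (n : ℕ) : ℝ :=
  (volume (closedBall (0 : EuclideanSpace ℝ (Fin n)) 1)).toReal ^ (-(1:ℝ) / n)

section
open Real (exp exp_add log norm_eq_abs norm_of_nonneg exp_pos exp_le_exp sq_sqrt sqrt_pos add_one_le_exp sqrt_nonneg one_le_exp exp_neg abs_exp sqrt_sq)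
open Finset (sum_congr mul_sum sum_add_distrib sum_le_sum sum_mul sum_sub_distrib sum_nonneg sum_comm)
open ENNReal (ofReal ofReal_mul toReal_ofReal ofReal_le_ofReal)
open Filter (Eventually)
section
namespace SL
abbrev E (n : ℕ) := EuclideanSpace ℝ (Fin n)
variable {n : ℕ}
def gd (x : E n) : ℝ := ((2 * Real.pi) ^ ((n : ℝ) / 2))⁻¹ * exp (-‖x‖ ^ 2 / 2)
def gam (n : ℕ) : Measure (E n) := volume.withDensity (fun x => ofReal (gd x))
lemma gd_pos (x : E n) : 0 < gd x := by unfold gd; positivity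
lemma gd_cont : Continuous (gd : E n → ℝ) := by unfold gd; fun_prop
lemma gd_int : Integrable (gd : E n → ℝ) := by
  by_contra h
  have h1 := GaussianFourier.integral_rexp_neg_mul_sq_norm (V := E n) (b := 1/2) (by norm_num)
  have h2 : ¬ Integrable (fun v : E n => exp (-(1/2) * ‖v‖^2)) := by
    intro h3; apply h; unfold gd
    refine (h3.const_mul (((2 * Real.pi) ^ ((n : ℝ) / 2))⁻¹)).congr (Eventually.of_forall fun x => ?_)
    have : -(1/2) * ‖x‖^2 = -‖x‖^2/2 := by ring
    simp only [this]
  rw [integral_undef h2] at h1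
  have : (0:ℝ) < (Real.pi / (1/2)) ^ (Module.finrank ℝ (E n) / 2 : ℝ) := by positivity
  linarith
lemma integral_gd : ∫ x : E n, gd x = 1 := by
  have h1 := GaussianFourier.integral_rexp_neg_mul_sq_norm (V := E n) (b := 1/2) (by norm_num)
  unfold gd
  rw [integral_const_mul]
  have : ∀ x : E n, -‖x‖^2/2 = -(1/2) * ‖x‖^2 := fun x => by ring
  simp_rw [this]
  rw [h1]
  simp only [finrank_euclideanSpace, Fintype.card_fin]
  rw [show Real.pi / (1/2) = 2 * Real.pi by ring]
  exact inv_mul_cancel₀ (by positivity)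
instance : IsProbabilityMeasure (gam n) := by
  constructor
  rw [gam, withDensity_apply _ MeasurableSet.univ, Measure.restrict_univ,
    ← ofReal_integral_eq_lintegral_ofReal gd_int (Eventually.of_forall fun x => (gd_pos x).le),
    integral_gd, ENNReal.ofReal_one]
lemma integral_gam (f : E n → ℝ) : ∫ x, f x ∂(gam n) = ∫ x, f x * gd x := by
  rw [gam, integral_withDensity_eq_integral_toReal_smul]
  · refine integral_congr_ae (Eventually.of_forall fun x => ?_)
    show _ = _
    simp only [smul_eq_mul, toReal_ofReal (gd_pos x).le]; ring
  · exact gd_cont.measurable.ennreal_ofReal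
  · exact Eventually.of_forall fun x => ENNReal.ofReal_lt_top
lemma integrable_gam {f : E n → ℝ} : Integrable f (gam n) ↔ Integrable (fun x => f x * gd x) := by
  rw [gam, integrable_withDensity_iff]
  · refine integrable_congr (Eventually.of_forall fun x => ?_)
    show _ = _
    simp only [toReal_ofReal (gd_pos x).le]
  · exact gd_cont.measurable.ennreal_ofReal
  · exact Eventually.of_forall fun x => ENNReal.ofReal_lt_top
lemma integrable_exp_gam (c : ℝ) : Integrable (fun x : E n => exp (c * ‖x‖)) (gam n) := by
  rw [integrable_gam]
  have h0 : Integrable (fun v : E n => exp (-(1/4) * ‖v‖^2)) := by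
    have := (GaussianFourier.integrable_cexp_neg_mul_sq_norm_add (V := E n) (b := (1/4:ℝ))
      (by norm_num) 0 0).re
    refine this.congr (Eventually.of_forall fun x => ?_)
    show _ = _
    simp only [zero_mul, add_zero]
    have : (-((1/4:ℝ):ℂ) * (‖x‖:ℂ)^2) = ((-(1/4) * ‖x‖^2 : ℝ) : ℂ) := by push_cast; ring
    rw [this, ← Complex.ofReal_exp]; rfl
  refine Integrable.mono' (h0.const_mul (((2 * Real.pi) ^ ((n : ℝ) / 2))⁻¹ * exp (c^2)))
    (by have := (gd_cont (n := n)); fun_prop) (Eventually.of_forall fun x => ?_)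
  rw [norm_of_nonneg (by have := gd_pos x; positivity)]
  unfold gd
  have : exp (c * ‖x‖) * exp (-‖x‖^2/2) ≤ exp (c^2) * exp (-(1/4) * ‖x‖^2) := by
    rw [← exp_add, ← exp_add, exp_le_exp]
    nlinarith [sq_nonneg (‖x‖ / 2 - c)]
  calc _ = ((2 * Real.pi) ^ ((n : ℝ) / 2))⁻¹ * (exp (c * ‖x‖) * exp (-‖x‖^2/2)) := by ring
    _ ≤ ((2 * Real.pi) ^ ((n : ℝ) / 2))⁻¹ * (exp (c^2) * exp (-(1/4) * ‖x‖^2)) := by gcongr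
    _ = _ := by ring
lemma integrable_of_exp {f : E n → ℝ} (hf : Continuous f) {C c : ℝ} (h : ∀ x, |f x| ≤ C * exp (c * ‖x‖)) :
    Integrable f (gam n) :=
  Integrable.mono' ((integrable_exp_gam c).const_mul C) hf.aestronglyMeasurable
    (Eventually.of_forall fun x => by simpa using h x)
def eb (k : Fin n) : E n := EuclideanSpace.single k (1:ℝ)
lemma inner_eb (x : E n) (k : Fin n) : ⟪x, eb k⟫ = x k := by
  simp [eb, EuclideanSpace.inner_single_right]
lemma norm_eb (k : Fin n) : ‖(eb k : E n)‖ = 1 := by simp [eb]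
lemma abs_coord_le (x : E n) (k : Fin n) : |x k| ≤ ‖x‖ := by
  simpa using PiLp.norm_apply_le x k
lemma gd_line (x : E n) (k : Fin n) : HasLineDerivAt ℝ gd (-(x k) * gd x) x (eb k) := by
  have h : HasFDerivAt (fun y : E n => ‖y‖^2) (2 • (innerSL ℝ x)) x := (hasStrictFDerivAt_norm_sq x).hasFDerivAt
  have h2 := (((h.neg.mul_const (1/2 : ℝ)).exp).const_mul (((2 * Real.pi) ^ ((n : ℝ) / 2))⁻¹)).hasLineDerivAt (eb k)
  unfold HasLineDerivAt at *
  convert h2 using 1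
  · ext y; simp [gd, div_eq_mul_inv]
  · have : (innerSL ℝ x) (eb k) = x k := inner_eb x k
    simp only [ContinuousLinearMap.smul_apply, ContinuousLinearMap.neg_apply, this, gd, Pi.neg_apply, smul_eq_mul, nsmul_eq_mul]
    push_cast
    rw [show -‖x‖^2 * (1/2) = -‖x‖^2/2 by ring]; ring
lemma stein {f f' : E n → ℝ} (k : Fin n) (hf : Continuous f) (hf' : Continuous f') {C c : ℝ}
    (h : ∀ x, |f x| ≤ C * exp (c * ‖x‖)) (h' : ∀ x, |f' x| ≤ C * exp (c * ‖x‖))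
    (hd : ∀ x, HasLineDerivAt ℝ f (f' x) x (eb k)) :
    ∫ x, x k * f x ∂(gam n) = ∫ x, f' x ∂(gam n) := by
  rw [integral_gam, integral_gam]
  have i1 : Integrable f (gam n) := integrable_of_exp hf h
  have i2 : Integrable f' (gam n) := integrable_of_exp hf' h'
  have i3 : Integrable (fun x : E n => x k * f x) (gam n) := by
    refine integrable_of_exp (C := C) (c := c + 1) (by fun_prop) fun x => ?_
    rw [abs_mul]
    calc |x k| * |f x| ≤ exp ‖x‖ * (C * exp (c * ‖x‖)) := by
          gcongr
          · exact (abs_coord_le x k).trans ((by linarith [add_one_le_exp ‖x‖]))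
          · exact h x
      _ = _ := by rw [add_mul, one_mul, exp_add]; ring
  have := integral_bilinear_hasLineDerivAt_right_eq_neg_left_of_integrable (μ := (volume : Measure (E n)))
    (f := f) (f' := f') (g := gd) (g' := fun x => -(x k) * gd x) (v := eb k) (B := ContinuousLinearMap.mul ℝ ℝ)
    (by simpa using integrable_gam.1 i2)
    (by
      have := (integrable_gam.1 i3).neg
      refine this.congr (Eventually.of_forall fun x => ?_)
      simp; ring)
    (by simpa using integrable_gam.1 i1) (fun x _ => hd x) (fun x _ => gd_line x k)
  simp only [ContinuousLinearMap.mul_apply'] at this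
  rw [← neg_inj, ← this, ← integral_neg]
  congr 1; ext x; ring
lemma gd_shift (x y : E n) : gd (x - y) = gd x * exp (⟪x, y⟫ - ‖y‖^2/2) := by
  unfold gd
  rw [mul_assoc, ← exp_add, @norm_sub_sq_real]
  congr 2; ring
lemma gam_shift (f : E n → ℝ) (y : E n) :
    ∫ x, f (x + y) ∂(gam n) = ∫ x, f x * exp (⟪x, y⟫ - ‖y‖^2/2) ∂(gam n) := by
  rw [integral_gam, integral_gam]
  rw [← integral_sub_right_eq_self (fun x => f (x + y) * gd x) y]
  congr 1; ext x
  rw [gd_shift]; simp; ring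
lemma gam_neg (f : E n → ℝ) : ∫ x, f (-x) ∂(gam n) = ∫ x, f x ∂(gam n) := by
  rw [integral_gam, integral_gam, ← integral_neg_eq_self]
  congr 1; ext x; simp [gd]
end SL
end
section
namespace SL
variable {n : ℕ}
class CSupp (m : Measure (E n)) : Prop where
  prob : IsProbabilityMeasure m
  bdd : ∃ R : ℝ, 0 ≤ R ∧ ∀ᵐ x ∂m, ‖x‖ ≤ R
instance (m : Measure (E n)) [h : CSupp m] : IsProbabilityMeasure m := h.prob
lemma CSupp.bound (m : Measure (E n)) [h : CSupp m] {f : E n → ℝ} (hf : Continuous f) :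
    ∃ C, 0 ≤ C ∧ ∀ᵐ x ∂m, |f x| ≤ C := by
  obtain ⟨R, hR, hx⟩ := h.bdd
  obtain ⟨C, hC⟩ := (isCompact_closedBall (0 : E n) R).exists_bound_of_continuousOn hf.continuousOn
  refine ⟨max C 0, le_max_right _ _, hx.mono fun x hx => (hC x (by simpa using hx)).trans (le_max_left _ _)⟩
lemma int_m (m : Measure (E n)) [CSupp m] {f : E n → ℝ} (hf : Continuous f) : Integrable f m := by
  obtain ⟨C, _, h⟩ := CSupp.bound m hf
  exact Integrable.of_bound hf.aestronglyMeasurable C h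
def wt (t : ℝ) (θ x : E n) : ℝ := exp (⟪θ, x⟫ - t * ‖x‖^2/2)
lemma wt_pos (t : ℝ) (θ x : E n) : 0 < wt t θ x := exp_pos _
lemma wt_cont (t : ℝ) (θ : E n) : Continuous (wt t θ) := by unfold wt; fun_prop
def In (m : Measure (E n)) (f : E n → ℝ) (t : ℝ) (θ : E n) : ℝ := ∫ x, f x * wt t θ x ∂m
def Zt (m : Measure (E n)) : ℝ → E n → ℝ := In m (fun _ => 1)
def Mn (m : Measure (E n)) (f : E n → ℝ) (t : ℝ) (θ : E n) : ℝ := In m f t θ / Zt m t θ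
def av (m : Measure (E n)) (k : Fin n) : ℝ → E n → ℝ := Mn m (fun x => x k)
variable (m : Measure (E n)) [CSupp m]
lemma int_wt {f : E n → ℝ} (hf : Continuous f) (t : ℝ) (θ : E n) : Integrable (fun x => f x * wt t θ x) m :=
  int_m m (hf.mul (wt_cont t θ))
lemma Zt_pos (t : ℝ) (θ : E n) : 0 < Zt m t θ := by
  unfold Zt In
  simp only [one_mul]
  have : Integrable (wt t θ) m := int_m m (wt_cont t θ)
  rw [integral_pos_iff_support_of_nonneg (fun x => (wt_pos t θ x).le) this]
  have : Function.support (wt t θ) = univ := by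
    ext x; simp [(wt_pos t θ x).ne']
  rw [this]; simp
def DL (a : ℝ) (d : Fin n → ℝ) : ℝ × E n →L[ℝ] ℝ :=
  a • ContinuousLinearMap.fst ℝ ℝ (E n) +
    ∑ k, d k • ((EuclideanSpace.proj k : E n →L[ℝ] ℝ).comp (ContinuousLinearMap.snd ℝ ℝ (E n)))
lemma DL_apply (a : ℝ) (d : Fin n → ℝ) (s : ℝ) (y : E n) : DL a d (s, y) = a * s + ∑ k, d k * y k := by
  simp [DL]
lemma wt_fderiv (x : E n) (p : ℝ × E n) :
    HasFDerivAt (fun p : ℝ × E n => wt p.1 p.2 x) (wt p.1 p.2 x • DL (-‖x‖^2/2) (fun k => x k)) p := by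
  have h1 : HasFDerivAt (fun p : ℝ × E n => ⟪p.2, x⟫ - p.1 * ‖x‖^2/2) (DL (-‖x‖^2/2) (fun k => x k)) p := by
    have : (fun p : ℝ × E n => ⟪p.2, x⟫ - p.1 * ‖x‖^2/2) = DL (-‖x‖^2/2) (fun k => x k) := by
      ext ⟨s, y⟩
      rw [DL_apply, PiLp.inner_apply]; simp; ring_nf
    rw [this]; exact ContinuousLinearMap.hasFDerivAt _
  exact h1.exp
lemma DL_norm (a : ℝ) (d : Fin n → ℝ) : ‖DL a d‖ ≤ |a| + ∑ k, |d k| := by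
  refine ContinuousLinearMap.opNorm_le_bound _ (by positivity) fun ⟨s, y⟩ => ?_
  rw [DL_apply, norm_eq_abs]
  have hs : |s| ≤ ‖(s, y)‖ := norm_fst_le (s, y)
  have hy : ∀ k, |y k| ≤ ‖(s, y)‖ := fun k => (abs_coord_le y k).trans (norm_snd_le (s, y))
  calc |a * s + ∑ k, d k * y k| ≤ |a * s| + |∑ k, d k * y k| := abs_add_le _ _
    _ ≤ |a| * |s| + ∑ k, |d k| * |y k| := by
        rw [abs_mul]; gcongr
        refine (Finset.abs_sum_le_sum_abs _ _).trans (by simp [abs_mul])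
    _ ≤ |a| * ‖(s, y)‖ + ∑ k, |d k| * ‖(s, y)‖ := by
        gcongr with k; exact hy k
    _ = _ := by rw [add_mul, sum_mul]
lemma wt_le {R : ℝ} (_hR : 0 ≤ R) {t : ℝ} {θ x : E n} (hx : ‖x‖ ≤ R) : wt t θ x ≤ exp (R * ‖θ‖ + R^2 * |t|) := by
  unfold wt
  rw [exp_le_exp]
  have h1 := real_inner_le_norm θ x
  have h2 : ‖θ‖ * ‖x‖ ≤ R * ‖θ‖ := by rw [mul_comm]; gcongr
  have h3 : -(t * ‖x‖^2/2) ≤ R^2 * |t| := by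
    have : ‖x‖^2 ≤ R^2 := by gcongr
    have h4 := neg_abs_le t
    nlinarith [abs_nonneg t, sq_nonneg ‖x‖, sq_nonneg R]
  linarith
lemma In_fderiv {f : E n → ℝ} (hf : Continuous f) (p : ℝ × E n) :
    HasFDerivAt (fun p : ℝ × E n => In m f p.1 p.2)
      (DL (-(In m (fun x => ‖x‖^2 * f x) p.1 p.2)/2) (fun k => In m (fun x => x k * f x) p.1 p.2)) p := by
  obtain ⟨R, hR, hx⟩ := CSupp.bdd (m := m)
  obtain ⟨C, hC0, hC⟩ := CSupp.bound m hf
  have key := hasFDerivAt_integral_of_dominated_of_fderiv_le (μ := m) (𝕜 := ℝ) (s := ball p 1) (x₀ := p)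
    (F := fun p x => f x * wt p.1 p.2 x)
    (F' := fun p x => (f x * wt p.1 p.2 x) • DL (-‖x‖^2/2) (fun k => x k))
    (bound := fun _ => C * exp (R * (‖p‖+1) + R^2 * (‖p‖+1)) * (R^2 + ∑ k : Fin n, R))
    (ball_mem_nhds p one_pos)
    (Eventually.of_forall fun q => (int_wt m hf q.1 q.2).aestronglyMeasurable)
    (int_wt m hf p.1 p.2)
    (by
      have : Continuous (fun x : E n => (f x * wt p.1 p.2 x) • DL (-‖x‖^2/2) (fun k => x k)) := by
        have := wt_cont p.1 p.2
        unfold DL; fun_prop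
      exact this.aestronglyMeasurable)
    (by
      filter_upwards [hx, hC] with x hx hC q hq
      rw [norm_smul, norm_mul, norm_of_nonneg (wt_pos _ _ _).le]
      have hq : ‖q‖ ≤ ‖p‖ + 1 := by
        have : ‖q - p‖ < 1 := by simpa [dist_eq_norm] using hq
        have := norm_le_norm_add_norm_sub' q p; linarith
      have hq1 : |q.1| ≤ ‖p‖ + 1 := (norm_fst_le q).trans hq
      have hq2 : ‖q.2‖ ≤ ‖p‖ + 1 := (norm_snd_le q).trans hq
      gcongr
      · exact (wt_pos _ _ _).le
      · exact hC
      · refine (wt_le hR hx).trans ?_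
        gcongr
      · refine (DL_norm _ _).trans ?_
        have : |-‖x‖^2/2| ≤ R^2 := by
          rw [neg_div, abs_neg, abs_of_nonneg (by positivity)]
          have : ‖x‖^2 ≤ R^2 := by gcongr
          nlinarith [sq_nonneg ‖x‖]
        gcongr with k
        exact (abs_coord_le x k).trans hx)
    (integrable_const _)
    (by
      filter_upwards with x q hq
      have := (wt_fderiv x q).const_mul (f x)
      rwa [smul_smul] at this)
  refine key.congr_fderiv ?_
  symm
  refine ContinuousLinearMap.ext fun ⟨s, y⟩ => ?_
  have hi : Integrable (fun x : E n => (f x * wt p.1 p.2 x) • DL (-‖x‖^2/2) (fun k => x k)) m := by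
    have hc : Continuous (fun x : E n => (f x * wt p.1 p.2 x) • DL (-‖x‖^2/2) (fun k => x k)) := by
        have := wt_cont p.1 p.2
        unfold DL; fun_prop
    obtain ⟨C, hC⟩ := (isCompact_closedBall (0 : E n) R).exists_bound_of_continuousOn hc.continuousOn
    exact Integrable.of_bound hc.aestronglyMeasurable C (hx.mono fun x hx => hC x (by simpa using hx))
  rw [ContinuousLinearMap.integral_apply hi, DL_apply]
  have hcoord : ∀ k : Fin n, Continuous (fun x : E n => x k) := fun k => by fun_prop
  have e : ∀ x : E n, ((f x * wt p.1 p.2 x) • DL (-‖x‖^2/2) (fun k => x k)) (s, y)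
      = (‖x‖^2 * f x * wt p.1 p.2 x) * (-s/2) + ∑ k, (x k * f x * wt p.1 p.2 x) * y k := by
    intro x
    show (f x * wt p.1 p.2 x) * (DL (-‖x‖^2/2) (fun k => x k)) (s, y) = _
    rw [DL_apply, mul_add, mul_sum]
    congr 1
    · ring
    · exact sum_congr rfl fun k _ => by ring
  simp_rw [e]
  rw [integral_add, integral_mul_const, integral_finsetSum]
  · simp_rw [integral_mul_const]
    simp only [In]; ring
  · intro k _; exact (int_wt m ((hcoord k).mul hf) p.1 p.2).mul_const _
  · exact (int_wt m (by fun_prop) p.1 p.2).mul_const _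
  · exact integrable_finset_sum _ fun k _ => (int_wt m ((hcoord k).mul hf) p.1 p.2).mul_const _
def EB (F : ℝ → E n → ℝ) : Prop :=
  Continuous (Function.uncurry F) ∧ ∀ T : ℝ, ∃ C : ℝ, 0 ≤ C ∧ ∀ t θ, |t| ≤ T → |F t θ| ≤ C * exp (C * ‖θ‖)
lemma EB.cont {F : ℝ → E n → ℝ} (h : EB F) (t : ℝ) : Continuous (F t) :=
  h.1.comp (by fun_prop : Continuous fun θ : E n => (t, θ))
lemma EB.mul {F G : ℝ → E n → ℝ} (hF : EB F) (hG : EB G) : EB (fun t θ => F t θ * G t θ) := by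
  refine ⟨hF.1.mul hG.1, fun T => ?_⟩
  obtain ⟨C, hC, h1⟩ := hF.2 T
  obtain ⟨D, hD, h2⟩ := hG.2 T
  refine ⟨C * D + C + D, by positivity, fun t θ ht => ?_⟩
  rw [abs_mul]
  calc |F t θ| * |G t θ| ≤ (C * exp (C * ‖θ‖)) * (D * exp (D * ‖θ‖)) := by
        gcongr; exacts [h1 t θ ht, h2 t θ ht]
    _ = (C * D) * exp ((C + D) * ‖θ‖) := by rw [add_mul, exp_add]; ring
    _ ≤ _ := by
        gcongr
        · linarith
        · nlinarith
lemma EB.add {F G : ℝ → E n → ℝ} (hF : EB F) (hG : EB G) : EB (fun t θ => F t θ + G t θ) := by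
  refine ⟨hF.1.add hG.1, fun T => ?_⟩
  obtain ⟨C, hC, h1⟩ := hF.2 T
  obtain ⟨D, hD, h2⟩ := hG.2 T
  refine ⟨C + D, by positivity, fun t θ ht => ?_⟩
  calc |F t θ + G t θ| ≤ |F t θ| + |G t θ| := abs_add_le _ _
    _ ≤ C * exp (C * ‖θ‖) + D * exp (D * ‖θ‖) := add_le_add (h1 t θ ht) (h2 t θ ht)
    _ ≤ C * exp ((C + D) * ‖θ‖) + D * exp ((C + D) * ‖θ‖) := by
        gcongr <;> linarith
    _ = _ := by ring
lemma EB.of_bdd {F : ℝ → E n → ℝ} (hF : Continuous (Function.uncurry F)) (C : ℝ) (h : ∀ t θ, |F t θ| ≤ C) : EB F := by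
  refine ⟨hF, fun T => ⟨C, (abs_nonneg _).trans (h 0 0), fun t θ _ => (h t θ).trans ?_⟩⟩
  have hC := (abs_nonneg _).trans (h 0 0)
  have : 1 ≤ exp (C * ‖θ‖) := one_le_exp (by positivity)
  nlinarith
lemma EB.const (c : ℝ) : EB (fun (_ : ℝ) (_ : E n) => c) := EB.of_bdd continuous_const |c| fun _ _ => le_rfl
lemma EB.cmul {F : ℝ → E n → ℝ} (hF : EB F) (c : ℝ) : EB (fun t θ => c * F t θ) := (EB.const c).mul hF
lemma EB.sub {F G : ℝ → E n → ℝ} (hF : EB F) (hG : EB G) : EB (fun t θ => F t θ - G t θ) := by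
  simpa [sub_eq_add_neg] using hF.add (hG.cmul (-1))
lemma EB.sum {ι : Type*} (s : Finset ι) {F : ι → ℝ → E n → ℝ} (h : ∀ i, EB (F i)) :
    EB (fun t θ => ∑ i ∈ s, F i t θ) := by
  classical
  induction s using Finset.induction_on with
  | empty => simpa using EB.const 0
  | insert a s ha ih => simpa [Finset.sum_insert ha] using (h a).add ih
lemma EB.abs {F : ℝ → E n → ℝ} (hF : EB F) : EB (fun t θ => |F t θ|) :=
  ⟨hF.1.abs, fun T => by simpa using hF.2 T⟩
lemma EB.In {f : E n → ℝ} (hf : Continuous f) : EB (In m f) := by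
  refine ⟨continuous_iff_continuousAt.2 fun p => (In_fderiv m hf p).continuousAt, fun T => ?_⟩
  obtain ⟨R, hR, hx⟩ := CSupp.bdd (m := m)
  obtain ⟨C, hC0, hC⟩ := CSupp.bound m hf
  refine ⟨C * exp (R^2 * T) + R, by positivity, fun t θ ht => ?_⟩
  have : |SL.In m f t θ| ≤ C * exp (R * ‖θ‖ + R^2 * T) := by
    have := norm_integral_le_of_norm_le_const (μ := m) (f := fun x => f x * wt t θ x) (C := C * exp (R * ‖θ‖ + R^2 * T)) (by
      filter_upwards [hx, hC] with x hx hC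
      rw [norm_mul, norm_of_nonneg (wt_pos _ _ _).le]
      gcongr
      · exact (wt_pos _ _ _).le
      · exact hC
      · refine (wt_le hR hx).trans ?_
        gcongr)
    simpa [SL.In] using this
  refine this.trans ?_
  rw [exp_add]
  calc _ = C * exp (R^2 * T) * exp (R * ‖θ‖) := by ring
    _ ≤ _ := by
      gcongr
      · linarith
      · have : 0 ≤ C * exp (R^2*T) := by positivity
        linarith
lemma Mn_le {f : E n → ℝ} (hf : Continuous f) {C : ℝ} (h : ∀ᵐ x ∂m, |f x| ≤ C) (t : ℝ) (θ : E n) : |Mn m f t θ| ≤ C := by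
  unfold Mn
  rw [abs_div, abs_of_pos (Zt_pos m t θ), div_le_iff₀ (Zt_pos m t θ)]
  unfold Zt In
  rw [← integral_const_mul]
  refine (norm_integral_le_integral_norm (fun x => f x * wt t θ x)).trans ?_
  refine integral_mono_ae (int_wt m hf t θ).norm ((int_wt m continuous_const t θ).const_mul C) ?_
  filter_upwards [h] with x hx
  rw [norm_mul, norm_of_nonneg (wt_pos _ _ _).le, one_mul]
  exact mul_le_mul_of_nonneg_right hx (wt_pos _ _ _).le
lemma EB.Mn {f : E n → ℝ} (hf : Continuous f) : EB (Mn m f) := by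
  obtain ⟨C, hC0, hC⟩ := CSupp.bound m hf
  exact EB.of_bdd ((EB.In m hf).1.div (EB.In m continuous_const).1 fun p => (Zt_pos m p.1 p.2).ne') C (Mn_le m hf hC)
end SL
end
section
namespace SL
variable {n : ℕ}
structure Reg (H Ht : ℝ → E n → ℝ) (d D2 : Fin n → ℝ → E n → ℝ) : Prop where
  eH : EB H
  eHt : EB Ht
  ed : ∀ k, EB (d k)
  eD2 : ∀ k, EB (D2 k)
  hF : ∀ t, 0 < t → ∀ θ, HasFDerivAt (fun p : ℝ × E n => H p.1 p.2) (DL (Ht t θ) (fun k => d k t θ)) (t, θ)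
  h2 : ∀ k t, 0 < t → ∀ θ, HasLineDerivAt ℝ (d k t) (D2 k t θ) θ (eb k)
lemma DL_add (a b : ℝ) (d e : Fin n → ℝ) : DL a d + DL b e = DL (a+b) (fun k => d k + e k) := by
  refine ContinuousLinearMap.ext fun ⟨s, y⟩ => ?_
  show DL a d (s,y) + DL b e (s,y) = _
  rw [DL_apply, DL_apply, DL_apply]
  simp only [add_mul, sum_add_distrib]; ring
lemma DL_smul (c a : ℝ) (d : Fin n → ℝ) : c • DL a d = DL (c*a) (fun k => c * d k) := by
  refine ContinuousLinearMap.ext fun ⟨s, y⟩ => ?_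
  show c * DL a d (s,y)  = _
  rw [DL_apply, DL_apply, mul_add, mul_sum]
  simp only [mul_assoc]
lemma line_of {F : ℝ → E n → ℝ} {a t : ℝ} {θ : E n} {d : Fin n → ℝ}
    (h : HasFDerivAt (fun p : ℝ × E n => F p.1 p.2) (DL a d) (t, θ)) (k : Fin n) :
    HasLineDerivAt ℝ (F t) (d k) θ (eb k) := by
  have h1 : HasDerivAt (fun s : ℝ => (t, θ + s • eb k)) ((0 : ℝ), eb k) 0 := by
    refine (hasDerivAt_const _ _).prodMk ?_
    simpa using ((hasDerivAt_id (0:ℝ)).smul_const (eb k)).const_add θ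
  have h2 : HasFDerivAt (fun p : ℝ × E n => F p.1 p.2) (DL a d) (t, θ + (0:ℝ) • eb k) := by simpa using h
  have := h2.comp_hasDerivAt (0:ℝ) h1
  rw [DL_apply] at this
  have e : a * 0 + ∑ j, d j * (eb k : E n) j = d k := by
    simp [eb]
  rw [e] at this
  exact this
lemma Reg.line {H Ht : ℝ → E n → ℝ} {d D2} (h : Reg H Ht d D2) (k t) (ht : 0 < t) (θ) :
    HasLineDerivAt ℝ (H t) (d k t θ) θ (eb k) := line_of (h.hF t ht θ) k
lemma hasLine_mul {f g : E n → ℝ} {f' g' : ℝ} {x v : E n} (hf : HasLineDerivAt ℝ f f' x v) (hg : HasLineDerivAt ℝ g g' x v) :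
    HasLineDerivAt ℝ (fun y => f y * g y) (f' * g x + f x * g') x v := by
  have := HasDerivAt.mul hf hg
  simp only [zero_smul, add_zero] at this
  exact this
lemma hasLine_add {f g : E n → ℝ} {f' g' : ℝ} {x v : E n} (hf : HasLineDerivAt ℝ f f' x v) (hg : HasLineDerivAt ℝ g g' x v) :
    HasLineDerivAt ℝ (fun y => f y + g y) (f' + g') x v := HasDerivAt.add hf hg
lemma Reg.mul {H Ht d D2} {G Gt : ℝ → E n → ℝ} {e E2} (h : Reg H Ht d D2) (g : Reg G Gt e E2) :
    Reg (fun t θ => H t θ * G t θ) (fun t θ => Ht t θ * G t θ + H t θ * Gt t θ)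
      (fun k t θ => d k t θ * G t θ + H t θ * e k t θ)
      (fun k t θ => D2 k t θ * G t θ + H t θ * E2 k t θ + 2 * (d k t θ * e k t θ)) where
  eH := h.eH.mul g.eH
  eHt := (h.eHt.mul g.eH).add (h.eH.mul g.eHt)
  ed k := ((h.ed k).mul g.eH).add (h.eH.mul (g.ed k))
  eD2 k := (((h.eD2 k).mul g.eH).add (h.eH.mul (g.eD2 k))).add (((h.ed k).mul (g.ed k)).cmul 2)
  hF t ht θ := by
    refine ((h.hF t ht θ).mul (g.hF t ht θ)).congr_fderiv ?_
    rw [DL_smul, DL_smul, DL_add]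
    congr 1
    · ring
    · ext k; ring
  h2 k t ht θ := by
    have := hasLine_add (hasLine_mul (h.h2 k t ht θ) (g.line k t ht θ)) (hasLine_mul (h.line k t ht θ) (g.h2 k t ht θ))
    convert this using 1; ring
lemma Reg.add {H Ht d D2} {G Gt : ℝ → E n → ℝ} {e E2} (h : Reg H Ht d D2) (g : Reg G Gt e E2) :
    Reg (fun t θ => H t θ + G t θ) (fun t θ => Ht t θ + Gt t θ)
      (fun k t θ => d k t θ + e k t θ) (fun k t θ => D2 k t θ + E2 k t θ) where
  eH := h.eH.add g.eH
  eHt := h.eHt.add g.eHt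
  ed k := (h.ed k).add (g.ed k)
  eD2 k := (h.eD2 k).add (g.eD2 k)
  hF t ht θ := ((h.hF t ht θ).add (g.hF t ht θ)).congr_fderiv (by rw [DL_add])
  h2 k t ht θ := hasLine_add (h.h2 k t ht θ) (g.h2 k t ht θ)
lemma Reg.const (c : ℝ) : Reg (fun _ (_ : E n) => c) (fun _ _ => 0) (fun _ _ _ => 0) (fun _ _ _ => 0) where
  eH := EB.const c
  eHt := EB.const 0
  ed _ := EB.const 0
  eD2 _ := EB.const 0
  hF t ht θ := (hasFDerivAt_const c _).congr_fderiv (by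
    refine ContinuousLinearMap.ext fun ⟨s, y⟩ => ?_
    rw [DL_apply]; simp)
  h2 k t ht θ := by
    unfold HasLineDerivAt
    exact hasDerivAt_const _ _
lemma Reg.comp {H Ht d D2} (h : Reg H Ht (d : Fin n → ℝ → E n → ℝ) D2) {φ φ' φ'' : ℝ → ℝ}
    (e0 : EB fun t θ => φ (H t θ)) (e1 : EB fun t θ => φ' (H t θ)) (e2 : EB fun t θ => φ'' (H t θ))
    (h1 : ∀ t, 0 < t → ∀ θ, HasDerivAt φ (φ' (H t θ)) (H t θ)) (h2 : ∀ t, 0 < t → ∀ θ, HasDerivAt φ' (φ'' (H t θ)) (H t θ)) :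
    Reg (fun t θ => φ (H t θ)) (fun t θ => φ' (H t θ) * Ht t θ) (fun k t θ => φ' (H t θ) * d k t θ)
      (fun k t θ => φ' (H t θ) * D2 k t θ + φ'' (H t θ) * (d k t θ * d k t θ)) where
  eH := e0
  eHt := e1.mul h.eHt
  ed k := e1.mul (h.ed k)
  eD2 k := (e1.mul (h.eD2 k)).add (e2.mul ((h.ed k).mul (h.ed k)))
  hF t ht θ := ((h1 t ht θ).comp_hasFDerivAt (t, θ) (h.hF t ht θ)).congr_fderiv (DL_smul _ _ _)
  h2 k t ht θ := by
    have a : HasLineDerivAt ℝ (fun y => φ' (H t y)) (φ'' (H t θ) * d k t θ) θ (eb k) := by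
      have hl := h.line k t ht θ
      unfold HasLineDerivAt at hl ⊢
      have h3 : HasDerivAt φ' (φ'' (H t θ)) (H t (θ + (0:ℝ) • eb k)) := by simpa using h2 t ht θ
      exact HasDerivAt.comp (0:ℝ) h3 hl
    convert hasLine_mul a (h.h2 k t ht θ) using 1
    ring
lemma sqrt_bd {t T : ℝ} (ht : |t| ≤ T) : √t ≤ T + 1 := by
  have h0 : 0 ≤ T := (abs_nonneg t).trans ht
  rw [Real.sqrt_le_left (by linarith)]
  nlinarith [le_abs_self t]
lemma EB.sq_bound {H : ℝ → E n → ℝ} (h : EB H) (T : ℝ) : ∃ C, 0 ≤ C ∧ ∀ t, |t| ≤ T → ∀ g : E n, |H t (√t • g)| ≤ C * exp (C * ‖g‖) := by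
  obtain ⟨C, hC, h1⟩ := h.2 T
  refine ⟨C + C * (|T|+1), by positivity, fun t ht g => (h1 t _ ht).trans ?_⟩
  have : ‖√t • g‖ ≤ (|T| + 1) * ‖g‖ := by
    rw [norm_smul, norm_of_nonneg (sqrt_nonneg t)]
    gcongr
    exact sqrt_bd (ht.trans (le_abs_self T))
  refine mul_le_mul ?_ (exp_le_exp.2 ?_) (exp_pos _).le (by positivity)
  · nlinarith [abs_nonneg T]
  · calc C * ‖√t • g‖ ≤ C * ((|T|+1) * ‖g‖) := by gcongr
      _ ≤ _ := by nlinarith [mul_nonneg hC (norm_nonneg g)]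
lemma EB.integrable {H : ℝ → E n → ℝ} (h : EB H) (t : ℝ) : Integrable (fun g => H t (√t • g)) (gam n) := by
  obtain ⟨C, hC, h1⟩ := h.sq_bound |t|
  have := h.cont t
  exact integrable_of_exp (by fun_prop) (h1 t le_rfl)
lemma EB.cont_int {H : ℝ → E n → ℝ} (h : EB H) : Continuous (fun t => ∫ g, H t (√t • g) ∂(gam n)) := by
  rw [continuous_iff_continuousAt]
  intro t0
  obtain ⟨C, hC, h1⟩ := h.sq_bound (|t0| + 1)
  refine continuousAt_of_dominated (bound := fun g => C * exp (C * ‖g‖))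
    (Eventually.of_forall fun t => (h.integrable t).aestronglyMeasurable) ?_ ((integrable_exp_gam C).const_mul C) ?_
  · filter_upwards [ball_mem_nhds t0 one_pos] with t ht
    refine Eventually.of_forall fun g => h1 t ?_ g
    rw [mem_ball, Real.dist_eq] at ht
    have := abs_sub_abs_le_abs_sub t t0
    linarith
  · refine Eventually.of_forall fun g => ?_
    have : Continuous (fun t : ℝ => H t (√t • g)) :=
      h.1.comp (by fun_prop : Continuous fun t : ℝ => (t, √t • g))
    exact this.continuousAt
lemma Reg.heat {H Ht d D2} (h : Reg H Ht (d : Fin n → ℝ → E n → ℝ) D2) {t : ℝ} (ht : 0 < t) :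
    HasDerivAt (fun t => ∫ g, H t (√t • g) ∂(gam n))
      (∫ g, (fun t θ => Ht t θ + 1/2 * ∑ k, D2 k t θ) t (√t • g) ∂(gam n)) t := by
  obtain ⟨C, hC, hb⟩ := (h.eHt.abs.add (EB.sum Finset.univ fun k => (h.ed k).abs)).sq_bound (2*t)
  have hder : ∀ s, 0 < s → ∀ g : E n, HasDerivAt (fun s => H s (√s • g))
      (Ht s (√s • g) + ∑ k, d k s (√s • g) * (1/(2*√s) * g k)) s := by
    intro s hs g
    have h1 : HasDerivAt (fun s : ℝ => (s, √s • g)) ((1:ℝ), (1/(2*√s)) • g) s :=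
      (hasDerivAt_id s).prodMk ((Real.hasDerivAt_sqrt hs.ne').smul_const g)
    have := (h.hF s hs (√s • g)).comp_hasDerivAt s h1
    rw [DL_apply] at this
    simp only [mul_one] at this
    exact this
  have hi : ∀ k, Integrable (fun g : E n => d k t (√t • g) * (1/(2*√t) * g k)) (gam n) := by
    intro k
    obtain ⟨C, hC, h1⟩ := (h.ed k).sq_bound t
    have := (h.ed k).cont t
    refine integrable_of_exp (C := C * (1/(2*√t))) (c := C+1) (by fun_prop) fun g => ?_
    rw [abs_mul, abs_mul, abs_of_nonneg (by positivity : (0:ℝ) ≤ 1/(2*√t)), add_mul, exp_add, one_mul]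
    have a1 := h1 t (abs_of_pos ht).le g
    have a2 : |g k| ≤ exp ‖g‖ := (abs_coord_le g k).trans (by linarith [add_one_le_exp ‖g‖])
    calc |d k t (√t • g)| * (1 / (2 * √t) * |g k|) ≤ (C * exp (C * ‖g‖)) * (1 / (2 * √t) * exp ‖g‖) := by
          gcongr
      _ = _ := by ring
  have key := (hasDerivAt_integral_of_dominated_loc_of_deriv_le (μ := gam n) (𝕜 := ℝ) (x₀ := t) (s := Ioo (t/2) (2*t))
    (F := fun s g => H s (√s • g)) (F' := fun s g => Ht s (√s • g) + ∑ k, d k s (√s • g) * (1/(2*√s) * g k))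
    (bound := fun g => (C * (1 + 1/√(t/2))) * exp ((C + 1) * ‖g‖))
    (Ioo_mem_nhds (by linarith) (by linarith))
    (Eventually.of_forall fun s => (h.eH.integrable s).aestronglyMeasurable) (h.eH.integrable t)
    (((h.eHt.integrable t).add (integrable_finsetSum _ fun k _ => hi k)).aestronglyMeasurable)
    (by
      refine Eventually.of_forall fun g s hs => ?_
      have hs0 : 0 < s := by linarith [hs.1]
      have b1 := hb s (by rw [abs_of_pos hs0]; exact hs.2.le) g
      have b2 : |Ht s (√s • g)| + ∑ k, |d k s (√s • g)| ≤ C * exp (C * ‖g‖) := (le_abs_self _).trans b1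
      have hsum0 : 0 ≤ ∑ k, |d k s (√s • g)| := by positivity
      have hq : 1/(2*√s) ≤ 1/√(t/2) := by
        have : √(t/2) ≤ √s := Real.sqrt_le_sqrt hs.1.le
        have h3 : 0 < √(t/2) := sqrt_pos.2 (by linarith)
        apply one_div_le_one_div_of_le h3; linarith
      have a2 : ‖g‖ ≤ exp ‖g‖ := (by linarith [add_one_le_exp ‖g‖])
      have a3 : 1 ≤ exp ‖g‖ := one_le_exp (norm_nonneg g)
      have hp : 0 ≤ 1/√(t/2) := by positivity
      calc ‖Ht s (√s • g) + ∑ k, d k s (√s • g) * (1/(2*√s) * g k)‖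
          ≤ |Ht s (√s • g)| + ∑ k, |d k s (√s • g)| * (1/√(t/2) * exp ‖g‖) := by
            refine (norm_add_le _ _).trans (add_le_add le_rfl ?_)
            refine (norm_sum_le _ _).trans (sum_le_sum fun k _ => ?_)
            rw [norm_mul, norm_mul, norm_of_nonneg (by positivity : (0:ℝ) ≤ 1/(2*√s))]
            gcongr
            · exact le_rfl
            · exact (abs_coord_le g k).trans a2
        _ = |Ht s (√s • g)| + (∑ k, |d k s (√s • g)|) * (1/√(t/2) * exp ‖g‖) := by rw [sum_mul]
        _ ≤ (|Ht s (√s • g)| + ∑ k, |d k s (√s • g)|) * ((1 + 1/√(t/2)) * exp ‖g‖) := by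
            have : 1 ≤ (1 + 1/√(t/2)) * exp ‖g‖ := by nlinarith
            have h5 : 1/√(t/2) * exp ‖g‖ ≤ (1 + 1/√(t/2)) * exp ‖g‖ := by nlinarith
            nlinarith [abs_nonneg (Ht s (√s • g))]
        _ ≤ (C * exp (C * ‖g‖)) * ((1 + 1/√(t/2)) * exp ‖g‖) := by gcongr
        _ = _ := by rw [add_mul C, exp_add, one_mul]; ring)
    ((integrable_exp_gam _).const_mul _)
    (Eventually.of_forall fun g s hs => hder s (by linarith [hs.1]) g)).2
  refine key.congr_deriv ?_
  symm
  rw [integral_add (h.eHt.integrable t) (integrable_finsetSum _ fun k _ => hi k)]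
  simp only
  rw [integral_add (h.eHt.integrable t) (((EB.sum Finset.univ h.eD2).cmul (1/2)).integrable t), integral_const_mul,
    integral_finsetSum _ fun k _ => (h.eD2 k).integrable t, integral_finsetSum _ fun k _ => hi k, mul_sum]
  congr 1
  refine sum_congr rfl fun k _ => ?_
  obtain ⟨C1, hC1, hb1⟩ := (h.ed k).sq_bound t
  obtain ⟨C2, hC2, hb2⟩ := (h.eD2 k).sq_bound t
  have c1 := (h.ed k).cont t
  have c2 := (h.eD2 k).cont t
  have st := stein (n := n) k (f := fun g => d k t (√t • g)) (f' := fun g => √t * D2 k t (√t • g)) (by fun_prop) (by fun_prop)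
    (C := C1 + √t * C2) (c := C1 + C2)
    (fun g => (hb1 t (abs_of_pos ht).le g).trans (by
      gcongr
      · have : 0 ≤ √t * C2 := by positivity
        linarith
      · linarith))
    (fun g => by
      rw [abs_mul, abs_of_nonneg (sqrt_nonneg t)]
      calc √t * |D2 k t (√t • g)| ≤ √t * (C2 * exp (C2 * ‖g‖)) := by gcongr; exact hb2 t (abs_of_pos ht).le g
        _ ≤ (C1 + √t * C2) * exp ((C1 + C2) * ‖g‖) := by
          rw [← mul_assoc]; gcongr <;> linarith)
    (fun g => by
      have := h.h2 k t ht (√t • g)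
      unfold HasLineDerivAt at this ⊢
      have h3 : HasDerivAt (fun s : ℝ => √t * s) (√t) 0 := by simpa using (hasDerivAt_id (0:ℝ)).const_mul √t
      have h4 : HasDerivAt (fun s : ℝ => d k t (√t • g + s • eb k)) (D2 k t (√t • g)) (√t * 0) := by simpa using this
      have := HasDerivAt.comp (0:ℝ) h4 h3
      rw [mul_comm] at this
      refine this.congr_of_eventuallyEq (Eventually.of_forall fun s => ?_)
      simp [smul_add, smul_smul])
  rw [integral_const_mul] at st
  have e : ∀ g : E n, d k t (√t • g) * (1/(2*√t) * g k) = 1/(2*√t) * (g k * d k t (√t • g)) := fun g => by ring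
  simp_rw [e]
  rw [integral_const_mul, st]
  have : √t ≠ 0 := (sqrt_pos.2 ht).ne'
  field_simp
end SL
end
section
namespace SL
variable {n : ℕ}
set_option linter.unusedSectionVars false
lemma Reg.In (m : Measure (E n)) [CSupp m] {f : E n → ℝ} (hf : Continuous f) :
    Reg (In m f) (fun t θ => -(In m (fun x => ‖x‖^2 * f x) t θ)/2) (fun k => In m (fun x => x k * f x))
      (fun k => In m (fun x => x k * (x k * f x))) where
  eH := EB.In m hf
  eHt := by
    have := (EB.In m (f := fun x => ‖x‖^2 * f x) (by fun_prop)).cmul (-1/2)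
    refine cast ?_ this
    congr 1; ext t θ; ring
  ed k := EB.In m (by fun_prop)
  eD2 k := EB.In m (by fun_prop)
  hF t _ θ := In_fderiv m hf (t, θ)
  h2 k t _ θ := line_of (F := SL.In m (fun x => x k * f x)) (In_fderiv m (f := fun x => x k * f x) (by fun_prop) (t, θ)) k
lemma In_heat (m : Measure (E n)) [CSupp m] {f : E n → ℝ} (hf : Continuous f) (t θ) :
    ∑ k, In m (fun x => x k * (x k * f x)) t θ = In m (fun x => ‖x‖^2 * f x) t θ := by
  unfold In
  rw [← integral_finsetSum]
  · congr 1; ext x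
    simp only [EuclideanSpace.norm_sq_eq, sum_mul]
    refine sum_congr rfl fun k _ => ?_
    rw [norm_eq_abs, sq_abs]; ring
  · intro k _; exact int_wt m (by fun_prop) t θ
lemma EB.invZ (m : Measure (E n)) [CSupp m] : EB (fun t θ => (Zt m t θ)⁻¹) := by
  refine ⟨(EB.In m continuous_const).1.inv₀ fun p => (Zt_pos m p.1 p.2).ne', fun T => ?_⟩
  obtain ⟨R, hR, hx⟩ := CSupp.bdd (m := m)
  refine ⟨exp (R^2 * T) + R, by positivity, fun t θ ht => ?_⟩
  rw [abs_of_pos (inv_pos.2 (Zt_pos m t θ))]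
  have h1 : exp (-(R * ‖θ‖ + R^2*T)) ≤ Zt m t θ := by
    have : ∫ x, exp (-(R * ‖θ‖ + R^2*T)) ∂m ≤ Zt m t θ := by
      refine integral_mono_ae (integrable_const _) (int_wt m continuous_const t θ) ?_
      filter_upwards [hx] with x hx
      rw [one_mul]; unfold wt; rw [exp_le_exp]
      have h1 := abs_le.1 (abs_real_inner_le_norm θ x)
      have h2 : ‖θ‖ * ‖x‖ ≤ R * ‖θ‖ := by rw [mul_comm]; gcongr
      have h3 : t * ‖x‖^2/2 ≤ R^2 * T := by
        have : ‖x‖^2 ≤ R^2 := by gcongr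
        have h4 := le_abs_self t
        have h0 := abs_nonneg t
        nlinarith [sq_nonneg ‖x‖, sq_nonneg R]
      linarith [h1.1]
    simpa using this
  calc (Zt m t θ)⁻¹ ≤ (exp (-(R * ‖θ‖ + R^2*T)))⁻¹ := inv_anti₀ (exp_pos _) h1
    _ = exp (R^2*T) * exp (R * ‖θ‖) := by rw [← exp_neg, ← exp_add]; ring_nf
    _ ≤ _ := by
      gcongr
      · linarith
      · have : 0 ≤ exp (R^2*T) := by positivity
        linarith
def Gen (m : Measure (E n)) (F l : ℝ → E n → ℝ) (d : Fin n → ℝ → E n → ℝ) : Prop :=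
  ∃ Ft D2, Reg F Ft d D2 ∧ ∀ t θ, l t θ = Ft t θ + 1/2 * ∑ k, D2 k t θ + ∑ k, av m k t θ * d k t θ
section
variable {m : Measure (E n)} [CSupp m]
lemma Gen.congr {F F' l l'} {d d' : Fin n → ℝ → E n → ℝ} (h : Gen m F l d) (e1 : ∀ t θ, F t θ = F' t θ)
    (e2 : ∀ t θ, l t θ = l' t θ) (e3 : ∀ k t θ, d k t θ = d' k t θ) : Gen m F' l' d' := by
  obtain rfl : F = F' := by ext; apply e1
  obtain rfl : l = l' := by ext; apply e2
  obtain rfl : d = d' := by ext; apply e3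
  exact h
lemma Gen.eb {F l} {d : Fin n → ℝ → E n → ℝ} (h : Gen m F l d) : EB F := by
  obtain ⟨_, _, h, _⟩ := h; exact h.eH
lemma Gen.ed {F l} {d : Fin n → ℝ → E n → ℝ} (h : Gen m F l d) (k) : EB (d k) := by
  obtain ⟨_, _, h, _⟩ := h; exact h.ed k
lemma Gen.el {F l} {d : Fin n → ℝ → E n → ℝ} (h : Gen m F l d) : EB l := by
  obtain ⟨Ft, D2, h, e⟩ := h
  obtain rfl : l = fun t θ => Ft t θ + 1/2 * ∑ k, D2 k t θ + ∑ k, av m k t θ * d k t θ := by ext; apply e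
  exact (h.eHt.add ((EB.sum _ h.eD2).cmul _)).add (EB.sum _ fun k => (EB.Mn m (by fun_prop)).mul (h.ed k))
lemma Gen.const (c : ℝ) : Gen m (fun _ _ => c) (fun _ _ => 0) (fun _ _ _ => 0) :=
  ⟨_, _, Reg.const c, by simp⟩
lemma Gen.add {F l G l'} {d e : Fin n → ℝ → E n → ℝ} (h : Gen m F l d) (g : Gen m G l' e) :
    Gen m (fun t θ => F t θ + G t θ) (fun t θ => l t θ + l' t θ) (fun k t θ => d k t θ + e k t θ) := by
  obtain ⟨Ft, D2, h, h'⟩ := h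
  obtain ⟨Gt, E2, g, g'⟩ := g
  refine ⟨_, _, h.add g, fun t θ => ?_⟩
  simp only [h', g', sum_add_distrib, mul_add]; ring
lemma Gen.mul {F l G l'} {d e : Fin n → ℝ → E n → ℝ} (h : Gen m F l d) (g : Gen m G l' e) :
    Gen m (fun t θ => F t θ * G t θ) (fun t θ => l t θ * G t θ + F t θ * l' t θ + ∑ k, d k t θ * e k t θ)
      (fun k t θ => d k t θ * G t θ + F t θ * e k t θ) := by
  obtain ⟨Ft, D2, h, h'⟩ := h
  obtain ⟨Gt, E2, g, g'⟩ := g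
  refine ⟨_, _, h.mul g, fun t θ => ?_⟩
  simp only [h', g', sum_add_distrib, mul_add, add_mul, mul_sum, sum_mul]
  have : ∀ k, 1/2 * (2 * (d k t θ * e k t θ)) = d k t θ * e k t θ := fun k => by ring
  simp only [this]
  have e1 : ∀ k, 1/2 * (F t θ * E2 k t θ) = F t θ * (1/2 * E2 k t θ) := fun k => by ring
  have e2 : ∀ k, av m k t θ * (F t θ * e k t θ) = F t θ * (av m k t θ * e k t θ) := fun k => by ring
  simp only [e1, e2, mul_assoc]
  ring
lemma Gen.cmul {F l} {d : Fin n → ℝ → E n → ℝ} (h : Gen m F l d) (c : ℝ) :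
    Gen m (fun t θ => c * F t θ) (fun t θ => c * l t θ) (fun k t θ => c * d k t θ) :=
  ((Gen.const c).mul h).congr (fun _ _ => rfl) (by simp) (by simp)
lemma Gen.sub {F l G l'} {d e : Fin n → ℝ → E n → ℝ} (h : Gen m F l d) (g : Gen m G l' e) :
    Gen m (fun t θ => F t θ - G t θ) (fun t θ => l t θ - l' t θ) (fun k t θ => d k t θ - e k t θ) :=
  (h.add (g.cmul (-1))).congr (fun _ _ => by ring) (fun _ _ => by ring) (fun _ _ _ => by ring)
lemma Gen.sum {ι : Type*} (s : Finset ι) {F l : ι → ℝ → E n → ℝ} {d : ι → Fin n → ℝ → E n → ℝ} (h : ∀ i, Gen m (F i) (l i) (d i)) :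
    Gen m (fun t θ => ∑ i ∈ s, F i t θ) (fun t θ => ∑ i ∈ s, l i t θ) (fun k t θ => ∑ i ∈ s, d i k t θ) := by
  classical
  induction s using Finset.induction_on with
  | empty => simpa using Gen.const 0
  | insert a s ha ih => simpa [Finset.sum_insert ha] using (h a).add ih
lemma Gen.comp {F l} {d : Fin n → ℝ → E n → ℝ} (h : Gen m F l d) {φ φ' φ'' : ℝ → ℝ}
    (e0 : EB fun t θ => φ (F t θ)) (e1 : EB fun t θ => φ' (F t θ)) (e2 : EB fun t θ => φ'' (F t θ))
    (h1 : ∀ t, 0 < t → ∀ θ, HasDerivAt φ (φ' (F t θ)) (F t θ)) (h2 : ∀ t, 0 < t → ∀ θ, HasDerivAt φ' (φ'' (F t θ)) (F t θ)) :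
    Gen m (fun t θ => φ (F t θ)) (fun t θ => φ' (F t θ) * l t θ + 1/2 * φ'' (F t θ) * ∑ k, d k t θ ^ 2)
      (fun k t θ => φ' (F t θ) * d k t θ) := by
  obtain ⟨Ft, D2, h, h'⟩ := h
  refine ⟨_, _, h.comp e0 e1 e2 h1 h2, fun t θ => ?_⟩
  simp only [h', sum_add_distrib, mul_add, mul_sum]
  have e2 : ∀ k, av m k t θ * (φ' (F t θ) * d k t θ) = φ' (F t θ) * (av m k t θ * d k t θ) := fun k => by ring
  have e3 : ∀ k, 1/2 * (φ' (F t θ) * D2 k t θ) = φ' (F t θ) * (1/2 * D2 k t θ) := fun k => by ring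
  simp only [e2, e3, sq, mul_assoc]
  ring
variable (m)
lemma Gen.Mn {f : E n → ℝ} (hf : Continuous f) :
    Gen m (Mn m f) (fun _ _ => 0) (fun k t θ => Mn m (fun x => x k * f x) t θ - av m k t θ * Mn m f t θ) := by
  have hZ := (Reg.In m (f := fun _ => 1) continuous_const).comp (φ := fun z => z⁻¹) (φ' := fun z => -(z^2)⁻¹) (φ'' := fun z => 2 * (z⁻¹)^3)
    (EB.invZ m)
    (by
      have := ((EB.invZ m).mul (EB.invZ m)).cmul (-1)
      refine cast ?_ this
      congr 1; ext t θ; simp only [Zt]; rw [← mul_inv, ← sq]; ring)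
    (by
      have := (((EB.invZ m).mul (EB.invZ m)).mul (EB.invZ m)).cmul (2)
      refine cast ?_ this
      congr 1; ext t θ; simp only [Zt]; ring)
    (fun t _ θ => hasDerivAt_inv (Zt_pos m t θ).ne')
    (fun t _ θ => by
      have h0 := (Zt_pos m t θ).ne'
      have := ((hasDerivAt_pow 2 (Zt m t θ)).inv (pow_ne_zero 2 h0)).neg
      refine this.congr_deriv ?_
      simp only [Zt] at h0 ⊢
      field_simp
      norm_num [mul_comm])
  have hR := (Reg.In m hf).mul hZ
  refine Gen.congr (F := fun t θ => In m f t θ * (Zt m t θ)⁻¹) ⟨_, _, hR, fun t θ => rfl⟩ (fun t θ => ?_) (fun t θ => ?_) (fun k t θ => ?_)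
  · simp only [SL.Mn, div_eq_mul_inv]
  · have h0 := (Zt_pos m t θ).ne'
    have q1 := In_heat m hf t θ
    have q2 := In_heat m (f := fun _ => 1) continuous_const t θ
    simp only [av, SL.Mn, Zt] at h0 ⊢
    set Z := SL.In m (fun _ => 1) t θ
    simp only [mul_one] at q2 ⊢
    have e : ∑ k, SL.In m (fun x => x k) t θ / Z * (SL.In m (fun x => x k * f x) t θ * Z⁻¹ + SL.In m f t θ * (-(Z^2)⁻¹ * SL.In m (fun x => x k) t θ))
      = Z⁻¹^2 * ∑ k, SL.In m (fun x => x k) t θ * SL.In m (fun x => x k * f x) t θ - SL.In m f t θ * Z⁻¹^3 * ∑ k, SL.In m (fun x => x k) t θ ^2 := by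
      rw [mul_sum, mul_sum, ← sum_sub_distrib]
      refine sum_congr rfl fun k _ => ?_
      field_simp; try ring
    rw [e]
    simp only [sum_add_distrib, ← sum_mul, ← mul_sum, q1, q2]
    have e2 : ∑ k, SL.In m (fun x => x k * f x) t θ * (-(Z^2)⁻¹ * SL.In m (fun x => x k) t θ)
       = -Z⁻¹^2 * ∑ k, SL.In m (fun x => x k) t θ * SL.In m (fun x => x k * f x) t θ := by
      rw [mul_sum]; refine sum_congr rfl fun k _ => ?_
      rw [inv_pow]; ring
    rw [e2]
    simp only [← sq]
    field_simp
    ring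
  · have h0 := (Zt_pos m t θ).ne'
    simp only [av, SL.Mn, Zt] at h0 ⊢
    simp only [mul_one]
    field_simp
    ring
def EE (F : ℝ → E n → ℝ) (t : ℝ) : ℝ := ∫ g, F t (√t • g) * Zt m t (√t • g) ∂(gam n)
lemma EB.Z : EB (Zt m) := EB.In m continuous_const
lemma EE_int {F : ℝ → E n → ℝ} (h : EB F) (t : ℝ) : Integrable (fun g => F t (√t • g) * Zt m t (√t • g)) (gam n) :=
  (h.mul (EB.Z m)).integrable t
lemma EE_cont {F : ℝ → E n → ℝ} (h : EB F) : Continuous (EE m F) := (h.mul (EB.Z m)).cont_int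
variable {m} in
lemma Gen.deriv {F l} {d : Fin n → ℝ → E n → ℝ} (h : Gen m F l d) {t : ℝ} (ht : 0 < t) :
    HasDerivAt (EE m F) (EE m l t) t := by
  obtain ⟨Ft, D2, h, e⟩ := h
  refine ((h.mul (Reg.In m (f := fun _ => 1) continuous_const)).heat ht).congr_deriv ?_
  unfold EE
  congr 1; ext g
  have q2 := In_heat m (f := fun _ => 1) continuous_const t (√t • g)
  have h0 := (Zt_pos m t (√t • g)).ne'
  simp only [e, av, SL.Mn, Zt] at h0 ⊢
  simp only [sum_add_distrib, ← sum_mul, ← mul_sum, q2]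
  simp only [mul_one]
  have e2 : ∑ k, In m (fun x => x k) t (√t • g) / In m (fun _ => 1) t (√t • g) * d k t (√t • g)
     = (In m (fun _ => 1) t (√t • g))⁻¹ * ∑ k, d k t (√t • g) * In m (fun x => x k) t (√t • g) := by
      rw [mul_sum]; refine sum_congr rfl fun k _ => ?_
      ring
  rw [e2]
  field_simp
  ring
lemma EE_zero (F : ℝ → E n → ℝ) [IsProbabilityMeasure (gam n)] : EE m F 0 = F 0 0 := by
  unfold EE
  simp [Zt, In, wt]
lemma mono_of {f f' : ℝ → ℝ} {a b : ℝ} (hab : a ≤ b) (hc : ContinuousOn f (Icc a b)) (h : ∀ t ∈ Ioo a b, HasDerivAt f (f' t) t)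
    (h0 : ∀ t ∈ Ioo a b, 0 ≤ f' t) : f a ≤ f b := by
  refine monotoneOn_of_deriv_nonneg (convex_Icc a b) hc ?_ ?_ ⟨le_rfl, hab⟩ ⟨hab, le_rfl⟩ hab
  · rw [interior_Icc]; exact fun t ht => (h t ht).differentiableAt.differentiableWithinAt
  · rw [interior_Icc]; exact fun t ht => by rw [(h t ht).deriv]; exact h0 t ht
lemma anti_of {f f' : ℝ → ℝ} {a b : ℝ} (hab : a ≤ b) (hc : ContinuousOn f (Icc a b)) (h : ∀ t ∈ Ioo a b, HasDerivAt f (f' t) t)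
    (h0 : ∀ t ∈ Ioo a b, f' t ≤ 0) : f b ≤ f a := by
  have := mono_of hab hc.neg (fun t ht => (h t ht).neg) fun t ht => neg_nonneg.2 (h0 t ht)
  simpa using this
lemma EE_mart {F : ℝ → E n → ℝ} {d : Fin n → ℝ → E n → ℝ} (h : Gen m F (fun _ _ => 0) d) {t : ℝ} (ht : 0 ≤ t) : EE m F t = F 0 0 := by
  rw [← EE_zero m F]
  have h1 : ∀ s ∈ Ioo 0 t, HasDerivAt (EE m F) 0 s := fun s hs => by simpa [EE] using h.deriv hs.1
  have hc := (EE_cont m h.eb).continuousOn (s := Icc 0 t)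
  exact le_antisymm (anti_of ht hc h1 fun _ _ => le_rfl) (mono_of ht hc h1 fun _ _ => le_rfl)
lemma EE_Mn {f : E n → ℝ} (hf : Continuous f) {t : ℝ} (ht : 0 ≤ t) : EE m (Mn m f) t = ∫ x, f x ∂m := by
  rw [EE_mart m (Gen.Mn m hf) ht]
  simp [SL.Mn, Zt, In, wt]
lemma EE_const (c : ℝ) {t : ℝ} (ht : 0 ≤ t) : EE m (fun _ _ => c) t = c := EE_mart m (Gen.const c) ht
lemma EE_mono {F G : ℝ → E n → ℝ} (hF : EB F) (hG : EB G) {t : ℝ} (h : ∀ θ, F t θ ≤ G t θ) : EE m F t ≤ EE m G t :=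
  integral_mono (EE_int m hF t) (EE_int m hG t) fun _ => mul_le_mul_of_nonneg_right (h _) (Zt_pos m _ _).le
lemma EE_nonneg {F : ℝ → E n → ℝ} {t : ℝ} (h : ∀ θ, 0 ≤ F t θ) : 0 ≤ EE m F t :=
  integral_nonneg fun _ => mul_nonneg (h _) (Zt_pos m _ _).le
lemma EE_add {F G : ℝ → E n → ℝ} (hF : EB F) (hG : EB G) (t : ℝ) : EE m (fun t θ => F t θ + G t θ) t = EE m F t + EE m G t := by
  unfold EE; rw [← integral_add (EE_int m hF t) (EE_int m hG t)]; simp only [add_mul]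
lemma EE_sub {F G : ℝ → E n → ℝ} (hF : EB F) (hG : EB G) (t : ℝ) : EE m (fun t θ => F t θ - G t θ) t = EE m F t - EE m G t := by
  unfold EE; rw [← integral_sub (EE_int m hF t) (EE_int m hG t)]; simp only [sub_mul]
lemma EE_cmul (F : ℝ → E n → ℝ) (c t : ℝ) : EE m (fun t θ => c * F t θ) t = c * EE m F t := by
  unfold EE; rw [← integral_const_mul]; simp only [mul_assoc]
lemma EE_sum {ι : Type*} (s : Finset ι) {F : ι → ℝ → E n → ℝ} (h : ∀ i, EB (F i)) (t : ℝ) :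
    EE m (fun t θ => ∑ i ∈ s, F i t θ) t = ∑ i ∈ s, EE m (F i) t := by
  unfold EE; rw [← integral_finsetSum _ fun i _ => EE_int m (h i) t]; simp only [sum_mul]
lemma wt_shift {t : ℝ} (ht : 0 ≤ t) (g x : E n) : wt t (√t • g) x = exp (⟪g, √t • x⟫ - ‖√t • x‖^2/2) := by
  unfold wt
  rw [inner_smul_left, inner_smul_right, norm_smul, mul_pow, norm_of_nonneg (sqrt_nonneg t), sq_sqrt ht]
  simp
lemma bayes {φ ψ : E n → ℝ} (hφ : Continuous φ) (hψ : Continuous ψ) {C : ℝ} (hb : ∀ x, |ψ x| ≤ C * exp (C * ‖x‖)) {t : ℝ} (ht : 0 ≤ t) :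
    ∫ g, ψ (√t • g) * In m φ t (√t • g) ∂(gam n) = ∫ x, φ x * ∫ g, ψ (t • x + √t • g) ∂(gam n) ∂m := by
  have h1 : ∀ x, ∫ g, ψ (t • x + √t • g) ∂(gam n) = ∫ g, ψ (√t • g) * wt t (√t • g) x ∂(gam n) := by
    intro x
    have := gam_shift (fun g => ψ (√t • g)) (√t • x)
    simp_rw [wt_shift ht, ← this]
    congr 1; ext g
    rw [smul_add, smul_smul, Real.mul_self_sqrt ht, add_comm]
  simp_rw [h1, In, ← integral_const_mul]
  rw [integral_integral_swap]
  · congr 1; ext x; congr 1; ext g; ring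
  obtain ⟨R, hR, hx⟩ := CSupp.bdd (m := m)
  obtain ⟨D, hD0, hD⟩ := CSupp.bound m hφ
  have hC : 0 ≤ C := by
    have := (abs_nonneg _).trans (hb 0); simpa using this
  have hcont : Continuous (Function.uncurry fun (g x : E n) => ψ (√t • g) * (φ x * wt t (√t • g) x)) := by
    unfold wt Function.uncurry; fun_prop
  have hi : Integrable (fun g : E n => (C * D * exp (R^2 * |t|)) * exp ((C*√t + R * √t) * ‖g‖)) (gam n) := (integrable_exp_gam _).const_mul _
  refine (hi.comp_fst m).mono' hcont.aestronglyMeasurable ?_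
  have h2 : ∀ᵐ p : E n × E n ∂((gam n).prod m), ‖p.2‖ ≤ R ∧ |φ p.2| ≤ D := by
    exact Measure.quasiMeasurePreserving_snd.ae (hx.and hD)
  filter_upwards [h2] with p hp
  simp only [Function.uncurry]
  rw [norm_mul, norm_mul, norm_of_nonneg (wt_pos _ _ _).le]
  have b1 := hb (√t • p.1)
  have b2 := wt_le (t := t) (θ := √t • p.1) hR hp.1
  rw [norm_smul, norm_of_nonneg (sqrt_nonneg t)] at b1 b2
  calc ‖ψ (√t • p.1)‖ * (‖φ p.2‖ * wt t (√t • p.1) p.2) ≤ (C * exp (C * (√t * ‖p.1‖))) * (D * exp (R * (√t * ‖p.1‖) + R^2 * |t|)) := by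
        have b3 : ‖φ p.2‖ ≤ D := hp.2
        have := (wt_pos t (√t • p.1) p.2).le
        gcongr
        exact b1
    _ = _ := by rw [exp_add, add_mul (C*√t), exp_add]; ring_nf
end
end SL
end
section
namespace SL
variable {n : ℕ}
set_option linter.unusedSectionVars false
lemma bm1c {A B C : Set ℝ} (hA : IsCompact A) (hB : IsCompact B) (hA0 : A.Nonempty) (hB0 : B.Nonempty)
    (hC : ∀ x ∈ A, ∀ y ∈ B, (x + y)/2 ∈ C) : volume A + volume B ≤ 2 * volume C := by
  obtain ⟨a, ha, ha'⟩ := hA.exists_isGreatest hA0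
  obtain ⟨b, hb, hb'⟩ := hB.exists_isLeast hB0
  have h1 : (fun x => x + b) '' A ∪ (fun y => a + y) '' B ⊆ (fun z : ℝ => 2 * z) '' C := by
    rintro _ (⟨x, hx, rfl⟩ | ⟨y, hy, rfl⟩)
    · exact ⟨_, hC x hx b hb, by simp only; ring⟩
    · exact ⟨_, hC a ha y hy, by simp only; ring⟩
  have h2 : volume ((fun x => x + b) '' A ∩ (fun y => a + y) '' B) = 0 := by
    refine measure_mono_null (t := {a + b}) ?_ (by simp)
    rintro _ ⟨⟨x, hx, rfl⟩, ⟨y, hy, h⟩⟩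
    have := ha' hx; have := hb' hy
    simp only at h ⊢
    rw [mem_singleton_iff]; linarith
  have h3 : volume ((fun x => x + b) '' A) = volume A := by
    rw [image_add_right, measure_preimage_add_right]
  have h4 : volume ((fun y => a + y) '' B) = volume B := by
    rw [image_add_left, measure_preimage_add]
  have h5 : volume ((fun z : ℝ => 2 * z) '' C) = 2 * volume C := by
    have := Measure.addHaar_smul (volume : Measure ℝ) 2 C
    simp only [Module.finrank_self, pow_one] at this
    rw [abs_of_pos (by norm_num)] at this
    simpa [← image_smul] using this
  have hm : MeasurableSet ((fun y => a + y) '' B) := (hB.image (by fun_prop)).measurableSet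
  have := measure_union_add_inter ((fun x => x + b) '' A) hm (μ := volume)
  rw [h2, h3, h4, add_zero] at this
  rw [← this, ← h5]
  exact measure_mono h1
lemma exists_cpt {A : Set ℝ} (hA : MeasurableSet A) (h0 : A.Nonempty) {r : ℝ≥0∞} (hr : r < volume A ∨ r = 0) :
    ∃ K ⊆ A, IsCompact K ∧ K.Nonempty ∧ r ≤ volume K := by
  obtain ⟨a, ha⟩ := h0
  rcases hr with hr | rfl
  · obtain ⟨K, hK, hc, h⟩ := hA.exists_lt_isCompact hr
    exact ⟨K ∪ {a}, union_subset hK (by simpa), hc.union isCompact_singleton, ⟨a, by simp⟩, h.le.trans (measure_mono subset_union_left)⟩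
  · exact ⟨{a}, by simpa, isCompact_singleton, by simp, by simp⟩
lemma bm1 {A B C : Set ℝ} (hA : MeasurableSet A) (hB : MeasurableSet B) (hA0 : A.Nonempty) (hB0 : B.Nonempty)
    (hC : ∀ x ∈ A, ∀ y ∈ B, (x + y)/2 ∈ C) : volume A + volume B ≤ 2 * volume C := by
  have key : ∀ r s, (r < volume A ∨ r = 0) → (s < volume B ∨ s = 0) → r + s ≤ 2 * volume C := by
    intro r s hr hs
    obtain ⟨K, hK, hKc, hK0, h1⟩ := exists_cpt hA hA0 hr
    obtain ⟨K', hK', hKc', hK0', h2⟩ := exists_cpt hB hB0 hs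
    exact (add_le_add h1 h2).trans (bm1c hKc hKc' hK0 hK0' fun x hx y hy => hC x (hK hx) y (hK' hy))
  refine ENNReal.le_of_forall_pos_le_add ?_ |>.trans le_rfl
  intro ε hε hfin
  have hA' : volume A ≠ ∞ := by
    intro h
    have : 2 * volume C < ∞ := hfin
    obtain ⟨r, hr, hr'⟩ := ENNReal.lt_iff_exists_nnreal_btwn.1 this
    have := key r 0 (Or.inl (by rw [h]; exact hr')) (Or.inr rfl)
    simp at this; exact absurd hr (not_lt.2 this)
  have hB' : volume B ≠ ∞ := by
    intro h
    have : 2 * volume C < ∞ := hfin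
    obtain ⟨r, hr, hr'⟩ := ENNReal.lt_iff_exists_nnreal_btwn.1 this
    have := key 0 r (Or.inr rfl) (Or.inl (by rw [h]; exact hr'))
    simp at this; exact absurd hr (not_lt.2 this)
  have hε2 : (ε/2 : ℝ≥0∞) ≠ 0 := by simpa using hε.ne'
  have f : ∀ X : ℝ≥0∞, X ≠ ∞ → (X - ε/2 < X ∨ X - ε/2 = 0) := by
    intro X hX
    by_cases h : X = 0
    · right; simp [h]
    · left; exact ENNReal.sub_lt_self hX h hε2
  have := key _ _ (f _ hA') (f _ hB')
  calc volume A + volume B ≤ (volume A - ε/2 + ε/2) + (volume B - ε/2 + ε/2) := add_le_add le_tsub_add le_tsub_add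
    _ = (volume A - ε/2) + (volume B - ε/2) + (ε/2+ε/2) := by ring
    _ ≤ _ := by rw [ENNReal.add_halves]; gcongr
lemma pl1r {f g h : ℝ → ℝ} (hf : Measurable f) (hg : Measurable g) (hh : Measurable h) (f0 : ∀ x, 0 ≤ f x) (g0 : ∀ x, 0 ≤ g x)
    (h0 : ∀ x, 0 ≤ h x) {N : ℝ} (fN : ∀ x, f x ≤ N) (gN : ∀ x, g x ≤ N) (H : ∀ x y, f x * g y ≤ h ((x+y)/2)^2) :
    (∫⁻ x, ofReal (f x)) * (∫⁻ x, ofReal (g x)) ≤ (∫⁻ x, ofReal (h x))^2 := by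
  have bf : BddAbove (range f) := ⟨N, by rintro _ ⟨x, rfl⟩; exact fN x⟩
  have bg : BddAbove (range g) := ⟨N, by rintro _ ⟨x, rfl⟩; exact gN x⟩
  set a := ⨆ x, f x with ha
  set b := ⨆ x, g x with hb
  have fa : ∀ x, f x ≤ a := le_ciSup bf
  have gb : ∀ x, g x ≤ b := le_ciSup bg
  have a0 : 0 ≤ a := (f0 0).trans (fa 0)
  have b0 : 0 ≤ b := (g0 0).trans (gb 0)
  rcases a0.eq_or_lt with a0 | a0
  · have : ∀ x, f x = 0 := fun x => le_antisymm (by rw [a0]; exact fa x) (f0 x)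
    simp [this]
  rcases b0.eq_or_lt with b0 | b0
  · have : ∀ x, g x = 0 := fun x => le_antisymm (by rw [b0]; exact gb x) (g0 x)
    simp [this]
  set c := √(a*b) with hc
  have c0 : 0 < c := sqrt_pos.2 (mul_pos a0 b0)
  have c2 : c^2 = a*b := sq_sqrt (mul_pos a0 b0).le
  have key : (∫⁻ x, ofReal (f x / a)) + (∫⁻ x, ofReal (g x / b)) ≤ 2 * ∫⁻ x, ofReal (h x / c) := by
    rw [lintegral_eq_lintegral_meas_lt _ (Eventually.of_forall fun x => div_nonneg (f0 x) a0.le) (hf.div_const a).aemeasurable,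
      lintegral_eq_lintegral_meas_lt _ (Eventually.of_forall fun x => div_nonneg (g0 x) b0.le) (hg.div_const b).aemeasurable,
      lintegral_eq_lintegral_meas_lt _ (Eventually.of_forall fun x => div_nonneg (h0 x) c0.le) (hh.div_const c).aemeasurable]
    have anti : ∀ u : ℝ → ℝ, Measurable fun t => volume {x | t < u x} := fun u =>
      Antitone.measurable fun s t hst => measure_mono fun x hx => lt_of_le_of_lt hst hx
    rw [← lintegral_add_left (anti _), ← lintegral_const_mul _ (anti _)]
    refine setLIntegral_mono ((anti _).const_mul 2) fun s hs => ?_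
    have hs : 0 < s := hs
    by_cases h1 : 1 ≤ s
    · have e1 : {x | s < f x / a} = ∅ := by
        ext x; simp only [mem_ofPred_eq, mem_empty_iff_false, iff_false, not_lt]
        exact ((div_le_one a0).2 (fa x)).trans h1
      have e2 : {x | s < g x / b} = ∅ := by
        ext x; simp only [mem_ofPred_eq, mem_empty_iff_false, iff_false, not_lt]
        exact ((div_le_one b0).2 (gb x)).trans h1
      simp [e1, e2]
    push Not at h1
    refine bm1 (measurableSet_lt measurable_const (hf.div_const a)) (measurableSet_lt measurable_const (hg.div_const b)) ?_ ?_ ?_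
    · obtain ⟨x, hx⟩ := exists_lt_of_lt_ciSup (show s * a < ⨆ x, f x by rw [← ha]; nlinarith)
      exact ⟨x, by rwa [mem_ofPred_eq, lt_div_iff₀ a0]⟩
    · obtain ⟨x, hx⟩ := exists_lt_of_lt_ciSup (show s * b < ⨆ x, g x by rw [← hb]; nlinarith)
      exact ⟨x, by rwa [mem_ofPred_eq, lt_div_iff₀ b0]⟩
    · intro x hx y hy
      rw [mem_ofPred_eq, lt_div_iff₀] at * <;> try assumption
      refine lt_of_pow_lt_pow_left₀ 2 (h0 _) (lt_of_lt_of_le ?_ (H x y))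
      have : (s*c)^2 = (s*a)*(s*b) := by rw [mul_pow, c2]; ring
      rw [this]
      have := mul_pos hs a0; have := mul_pos hs b0
      gcongr
  have cv : ∀ (u : ℝ → ℝ) (r : ℝ), 0 < r → ∫⁻ x, ofReal (u x / r) = ofReal r⁻¹ * ∫⁻ x, ofReal (u x) := by
    intro u r hr
    rw [← lintegral_const_mul' _ _ (by simp)]
    congr 1; ext x
    rw [← ofReal_mul (by positivity)]; congr 1; ring
  rw [cv f a a0, cv g b b0, cv h c c0] at key
  by_cases hH : (∫⁻ x, ofReal (h x)) = ∞
  · rw [hH]; simp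
  have hfin : 2 * (ofReal c⁻¹ * ∫⁻ x, ofReal (h x)) ≠ ∞ := by finiteness
  have hF : (∫⁻ x, ofReal (f x)) ≠ ∞ := by
    intro hF; rw [hF] at key
    rw [ENNReal.mul_top (by simpa using a0)] at key
    exact hfin (top_le_iff.1 (le_trans (by simp) key))
  have hG : (∫⁻ x, ofReal (g x)) ≠ ∞ := by
    intro hF; rw [hF] at key
    rw [ENNReal.mul_top (by simpa using b0)] at key
    exact hfin (top_le_iff.1 (le_trans (by simp) key))
  lift (∫⁻ x, ofReal (h x)) to NNReal using hH with HH
  lift (∫⁻ x, ofReal (f x)) to NNReal using hF with FF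
  lift (∫⁻ x, ofReal (g x)) to NNReal using hG with GG
  have k2 := ENNReal.toReal_mono hfin key
  rw [ENNReal.toReal_add (by finiteness) (by finiteness)] at k2
  simp only [ENNReal.toReal_mul, toReal_ofReal (inv_nonneg.2 a0.le), toReal_ofReal (inv_nonneg.2 b0.le), toReal_ofReal (inv_nonneg.2 c0.le), ENNReal.coe_toReal, ENNReal.toReal_ofNat] at k2
  have : (FF:ℝ) * GG ≤ HH^2 := by
    have hF0 := FF.2; have hG0 := GG.2
    have h1 : 0 ≤ a⁻¹ * (FF:ℝ) + b⁻¹ * GG := by positivity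
    have h2 : (a⁻¹ * (FF:ℝ) + b⁻¹ * GG)^2 ≤ (2 * (c⁻¹ * HH))^2 := by gcongr
    have h3 : 4 * ((a⁻¹ * (FF:ℝ)) * (b⁻¹ * GG)) ≤ (a⁻¹ * (FF:ℝ) + b⁻¹ * GG)^2 := by nlinarith [sq_nonneg (a⁻¹ * (FF:ℝ) - b⁻¹ * GG)]
    have h4 : (2 * (c⁻¹ * HH))^2 = 4 * ((a⁻¹ * b⁻¹) * (HH:ℝ)^2) := by
      rw [mul_pow, mul_pow, inv_pow, c2, mul_inv]; ring
    have h5 : (a⁻¹ * b⁻¹) * ((FF:ℝ) * GG) ≤ (a⁻¹ * b⁻¹) * (HH:ℝ)^2 := by nlinarith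
    exact le_of_mul_le_mul_left h5 (by positivity)
  exact_mod_cast this
lemma pl1 {f g h : ℝ → ℝ≥0∞} (hf : Measurable f) (hg : Measurable g) (hh : Measurable h)
    (H : ∀ x y, f x * g y ≤ h ((x+y)/2)^2) :
    (∫⁻ x, f x) * (∫⁻ x, g x) ≤ (∫⁻ x, h x)^2 := by
  have key : ∀ N : ℕ, (∫⁻ x, min (f x) N) * (∫⁻ x, min (g x) N) ≤ (∫⁻ x, h x)^2 := by
    intro N
    have t : ∀ u : ℝ≥0∞, ofReal (min u N).toReal = min u N := fun u => ENNReal.ofReal_toReal (by simp)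
    have hN : ∀ u : ℝ≥0∞, (min u N).toReal ≤ N := fun u => by
      have := ENNReal.toReal_mono (by simp) (min_le_right u (N:ℝ≥0∞)); simpa using this
    have := pl1r (f := fun x => (min (f x) N).toReal) (g := fun x => (min (g x) N).toReal) (h := fun x => (min (h x) N).toReal)
      (hf.min measurable_const).ennreal_toReal (hg.min measurable_const).ennreal_toReal (hh.min measurable_const).ennreal_toReal
      (fun _ => by positivity) (fun _ => by positivity) (fun _ => by positivity) (N := N) (fun _ => hN _) (fun _ => hN _) (fun x y => by
        rw [← ENNReal.toReal_mul, ← ENNReal.toReal_pow]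
        refine ENNReal.toReal_mono (by simp) ?_
        rcases le_total (h ((x+y)/2)) N with hc | hc
        · rw [min_eq_left hc]
          exact (mul_le_mul' (min_le_left _ _) (min_le_left _ _)).trans (H x y)
        · rw [min_eq_right hc, sq]
          exact mul_le_mul' (min_le_right _ _) (min_le_right _ _))
    simp only [t] at this
    refine this.trans ?_
    gcongr with x
    exact min_le_left _ _
  have lim : ∀ u : ℝ → ℝ≥0∞, Measurable u → Filter.Tendsto (fun N : ℕ => ∫⁻ x, min (u x) N) Filter.atTop (nhds (∫⁻ x, u x)) := by
    intro u hu
    refine lintegral_tendsto_of_tendsto_of_monotone (fun N => (hu.min measurable_const).aemeasurable) ?_ ?_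
    · filter_upwards with x N M hNM
      exact min_le_min le_rfl (by exact_mod_cast hNM)
    · filter_upwards with x
      have : Filter.Tendsto (fun N : ℕ => min (u x) (N:ℝ≥0∞)) Filter.atTop (nhds (min (u x) ∞)) :=
        tendsto_const_nhds.min ENNReal.tendsto_nat_nhds_top
      simpa using this
  by_cases h1 : (∫⁻ x, f x) = 0
  · simp [h1]
  by_cases h2 : (∫⁻ x, g x) = 0
  · simp [h2]
  exact le_of_tendsto (ENNReal.Tendsto.mul (lim f hf) (Or.inl h1) (lim g hg) (Or.inl h2)) (Eventually.of_forall key)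
lemma pln : ∀ {n : ℕ} {f g h : (Fin n → ℝ) → ℝ≥0∞} (_ : Measurable f) (_ : Measurable g) (_ : Measurable h)
    (_ : ∀ x y, f x * g y ≤ h ((1/2:ℝ) • (x+y))^2),
    (∫⁻ x, f x) * (∫⁻ x, g x) ≤ (∫⁻ x, h x)^2
  | 0, f, g, h, _, _, _, H => by
    have e : ∀ u : (Fin 0 → ℝ) → ℝ≥0∞, ∫⁻ x, u x = u 0 := fun u => by
      rw [Measure.volume_pi_eq_dirac 0, lintegral_dirac]
    rw [e, e, e]; simpa using H 0 0
  | n+1, f, g, h, hf, hg, hh, H => by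
    have mp := volume_preserving_piFinSuccAbove (fun _ : Fin (n + 1) => ℝ) 0
    have hc : ∀ t z, (MeasurableEquiv.piFinSuccAbove (fun _ : Fin (n+1) => ℝ) 0).symm (t, z) = (Fin.cons t z : Fin (n+1) → ℝ) := by
      intro t z
      have := Fin.insertNth_zero (α := fun _ : Fin (n+1) => ℝ) t z
      simp only [cast_eq] at this
      rw [← this]; rfl
    have e : ∀ u : (Fin (n+1) → ℝ) → ℝ≥0∞, Measurable u → ∫⁻ x, u x = ∫⁻ t : ℝ, ∫⁻ z : Fin n → ℝ, u (Fin.cons t z) := by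
      intro u hu
      rw [← mp.symm.lintegral_comp hu, Measure.volume_eq_prod, lintegral_prod _ (by fun_prop)]
      simp only [hc]
    rw [e f hf, e g hg, e h hh]
    have mc : ∀ t : ℝ, Measurable fun z : Fin n → ℝ => (Fin.cons t z : Fin (n+1) → ℝ) := fun t => by
      have := mp.symm.measurable.comp (measurable_prodMk_left (x := t) (β := Fin n → ℝ))
      simpa only [Function.comp_def, hc] using this
    have mm : ∀ u : (Fin (n+1) → ℝ) → ℝ≥0∞, Measurable u → Measurable fun t : ℝ => ∫⁻ z : Fin n → ℝ, u (Fin.cons t z) := by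
      intro u hu
      have := (hu.comp mp.symm.measurable).lintegral_prod_right' (ν := volume)
      simpa only [Function.comp_def, hc] using this
    refine pl1 (mm f hf) (mm g hg) (mm h hh) fun s t => ?_
    refine pln (hf.comp (mc s)) (hg.comp (mc t)) (hh.comp (mc _)) fun x y => ?_
    refine (H (Fin.cons s x) (Fin.cons t y)).trans (le_of_eq ?_)
    congr 2
    ext i
    refine Fin.cases ?_ (fun i => ?_) i
    · simp; ring
    · simp; ring
lemma pl {f g h : E n → ℝ≥0∞} (hf : Measurable f) (hg : Measurable g) (hh : Measurable h)
    (H : ∀ x y, f x * g y ≤ h ((1/2:ℝ) • (x+y))^2) :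
    (∫⁻ x, f x) * (∫⁻ x, g x) ≤ (∫⁻ x, h x)^2 := by
  have mp := PiLp.volume_preserving_toLp (Fin n)
  rw [← mp.lintegral_comp hf, ← mp.lintegral_comp hg, ← mp.lintegral_comp hh]
  have := mp.measurable
  refine pln (by fun_prop) (by fun_prop) (by fun_prop) fun x y => (H _ _).trans (le_of_eq ?_)
  simp
end SL
end
section
namespace SL
variable {n : ℕ}
set_option linter.unusedSectionVars false
lemma maurey_pl {K : Set (E n)} (hK : Convex ℝ K) (hKm : MeasurableSet K) {s : ℝ} {θ : E n} {c : ℝ≥0∞}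
    {u w : E n → ℝ} (hu : Measurable u) (hw : Measurable w) (H : ∀ x ∈ K, ∀ y ∈ K, u x + w y ≤ s * ‖x - y‖^2/4)
    {μ : Measure (E n)} [IsProbabilityMeasure μ] (hμ : μ = c • (volume.restrict K).withDensity (fun x => ofReal (wt s θ x))) :
    (∫⁻ x, ofReal (exp (u x)) ∂μ) * (∫⁻ x, ofReal (exp (w x)) ∂μ) ≤ 1 := by
  have hwm : Measurable fun x : E n => ofReal (wt s θ x) := (wt_cont s θ).measurable.ennreal_ofReal
  have e : ∀ v : E n → ℝ≥0∞, Measurable v → ∫⁻ x, v x ∂μ = c * ∫⁻ x, K.indicator (fun x => ofReal (wt s θ x) * v x) x := by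
    intro v hv
    rw [hμ, lintegral_smul_measure, lintegral_withDensity_eq_lintegral_mul _ hwm hv, lintegral_indicator hKm]; rfl
  have e1 : (1:ℝ≥0∞) = (∫⁻ x, 1 ∂μ)^2 := by simp
  refine le_trans ?_ e1.symm.le
  have m1 : Measurable fun x => ofReal (exp (u x)) := (Real.measurable_exp.comp hu).ennreal_ofReal
  have m2 : Measurable fun x => ofReal (exp (w x)) := (Real.measurable_exp.comp hw).ennreal_ofReal
  rw [e _ m1, e _ m2, e _ measurable_const, mul_pow, mul_mul_mul_comm, ← sq]
  gcongr
  refine pl ((hwm.mul m1).indicator hKm) ((hwm.mul m2).indicator hKm) ((hwm.mul measurable_const).indicator hKm) fun x y => ?_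
  by_cases hx : x ∈ K
  swap
  · simp [hx]
  by_cases hy : y ∈ K
  swap
  · simp [hy]
  have hz : (1/2:ℝ) • (x+y) ∈ K := by
    have := hK hx hy (by norm_num : (0:ℝ) ≤ 1/2) (by norm_num : (0:ℝ) ≤ 1/2) (by norm_num)
    rwa [← smul_add] at this
  rw [indicator_of_mem hx, indicator_of_mem hy, indicator_of_mem hz, mul_one, ← ofReal_mul (wt_pos _ _ _).le,
    ← ofReal_mul (wt_pos _ _ _).le, ← ofReal_mul (mul_pos (wt_pos _ _ _) (exp_pos _)).le,
    ← ENNReal.ofReal_pow (wt_pos _ _ _).le]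
  refine ofReal_le_ofReal ?_
  unfold wt
  rw [← exp_add, ← exp_add, ← exp_add, sq (exp _), ← exp_add, exp_le_exp]
  have h1 := H x hx y hy
  have h2 : ‖(1/2:ℝ) • (x+y)‖^2 = (‖x‖^2 + 2 * ⟪x,y⟫ + ‖y‖^2)/4 := by
    rw [norm_smul, mul_pow, norm_add_sq_real]; norm_num; ring
  have h3 := norm_sub_sq_real x y
  rw [h2, inner_smul_right, inner_add_right]
  rw [h3] at h1
  nlinarith
lemma exp_lb {z : ℝ} (hz : |z| ≤ 1) : 1 + z + z^2/2 - |z|^3 ≤ exp z := by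
  have := Real.exp_bound hz (n := 3) (by norm_num)
  simp [Finset.sum_range_succ, Nat.factorial] at this
  have h := (abs_le.1 this).1
  have : |z|^3 * (4/(2*3*3)) ≤ |z|^3 := by
    have : 0 ≤ |z|^3 := by positivity
    linarith
  norm_num at h this ⊢
  linarith
lemma bdd_int {μ : Measure (E n)} [IsProbabilityMeasure μ] {f : E n → ℝ} (hf : Measurable f) {D : ℝ} (h : ∀ᵐ x ∂μ, |f x| ≤ D) : Integrable f μ :=
  Integrable.of_bound hf.aestronglyMeasurable D h
set_option maxHeartbeats 1000000 in
lemma maurey0 {K : Set (E n)} (hK : Convex ℝ K) (hKm : MeasurableSet K) {s : ℝ} (hs : 0 < s) {θ : E n} {c : ℝ≥0∞}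
    {f : E n → ℝ} {G : E n → E n} (hf : Measurable f) (hG : Measurable G) {B D : ℝ} (hB : 0 ≤ B) (hD : 0 ≤ D)
    (H : ∀ x ∈ K, ∀ y ∈ K, f x - f y ≤ ⟪G x, x - y⟫ + B * ‖x-y‖^2) (hfD : ∀ x ∈ K, |f x| ≤ D) (hGD : ∀ x ∈ K, ‖G x‖ ≤ D)
    {μ : Measure (E n)} [IsProbabilityMeasure μ] (hμ : μ = c • (volume.restrict K).withDensity (fun x => ofReal (wt s θ x)))
    (h0 : ∫ x, f x ∂μ = 0) :
    ∫ x, f x ^2 ∂μ ≤ (∫ x, ‖G x‖^2 ∂μ) / s := by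
  have hμK : ∀ᵐ x ∂μ, x ∈ K := by
    rw [hμ]
    refine Measure.ae_smul_measure ((withDensity_absolutelyContinuous _ _).ae_le (ae_restrict_mem hKm)) _
  have iG : Integrable (fun x => ‖G x‖^2) μ := bdd_int (by fun_prop) (D := D^2) (hμK.mono fun x hx => by
    rw [abs_of_nonneg (by positivity)]; have := hGD x hx; gcongr)
  have if1 : Integrable f μ := bdd_int hf (hμK.mono fun x hx => hfD x hx)
  have if2 : Integrable (fun x => f x^2) μ := bdd_int (by fun_prop) (D := D^2) (hμK.mono fun x hx => by
    rw [abs_pow]; have := hfD x hx; gcongr)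
  set V := ∫ x, f x ^2 ∂μ
  set W := ∫ x, ‖G x‖^2 ∂μ
  set D1 := D + 2 * D^2/s with hD1
  set D2 := D * (2 * D^2/s) + D1^3 + D^3 + 2 * D1 * D^2
  have hD10 : 0 ≤ D1 := by positivity
  have key : ∀ ε : ℝ, 0 < ε → 4 * ε * B ≤ s/2 → ε * (D1 + 1) ≤ 1 → V ≤ W / (s - 4 * ε * B) + D2 * ε := by
    intro ε hε h1 h2
    set r := s - 4 * ε * B with hr
    have hrs : s/2 ≤ r := by linarith
    have hr0 : 0 < r := by linarith
    have hε1 : ε ≤ 1 := by nlinarith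
    have hεD : ε * D1 ≤ 1 := by nlinarith
    set q : E n → ℝ := fun x => ‖G x‖^2 / r
    set u : E n → ℝ := fun x => ε * f x - ε^2 * q x with hu
    have hq : ∀ x ∈ K, 0 ≤ q x ∧ q x ≤ 2 * D^2/s := fun x hx => by
      refine ⟨by positivity, ?_⟩
      have := hGD x hx
      calc ‖G x‖^2 / r ≤ D^2 / (s/2) := by gcongr
        _ = _ := by field_simp
    have hu1 : ∀ x ∈ K, |u x| ≤ ε * D1 := fun x hx => by
      have a1 := hfD x hx
      obtain ⟨a2, a3⟩ := hq x hx
      calc |u x| ≤ |ε * f x| + |ε^2 * q x| := abs_sub _ _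
        _ = ε * |f x| + ε^2 * q x := by rw [abs_mul ε, abs_of_pos hε, abs_of_nonneg (mul_nonneg (sq_nonneg ε) a2)]
        _ ≤ ε * D + ε * (2 * D^2/s) := by
          have : ε^2 * q x ≤ ε * q x := mul_le_mul_of_nonneg_right (by nlinarith) a2
          exact add_le_add (by gcongr) (this.trans (by gcongr))
        _ = _ := by rw [hD1]; ring
    have mu : Measurable u := by fun_prop
    have P := maurey_pl hK hKm (s := s) (θ := θ) (c := c) mu (w := fun x => -(ε * f x)) (by fun_prop) (fun x hx y hy => by
      have a1 := H x hx y hy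
      have a2 := real_inner_le_norm (G x) (x-y)
      have a3 : ε * (‖G x‖ * ‖x-y‖) ≤ ε^2 * q x + r * ‖x-y‖^2/4 := by
        have : ε^2 * q x + r * ‖x-y‖^2/4 - ε * (‖G x‖ * ‖x-y‖) = (ε * ‖G x‖ - r * ‖x-y‖/2)^2 / r := by
          simp only [q]; field_simp; ring
        have : 0 ≤ (ε * ‖G x‖ - r * ‖x-y‖/2)^2 / r := by positivity
        linarith
      have a4 : ε * (f x - f y) ≤ ε * (‖G x‖ * ‖x-y‖ + B * ‖x-y‖^2) := by gcongr; linarith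
      simp only [hu]
      rw [hr] at a3
      nlinarith) hμ
    have iu : Integrable (fun x => exp (u x)) μ := bdd_int (by fun_prop) (D := exp (ε * D1)) (hμK.mono fun x hx => by
      rw [abs_of_pos (exp_pos _)]; exact exp_le_exp.2 ((le_abs_self _).trans (hu1 x hx)))
    have hf1 : ∀ x ∈ K, |-(ε * f x)| ≤ ε * D := fun x hx => by rw [abs_neg, abs_mul, abs_of_pos hε]; have := hfD x hx; gcongr
    have iw : Integrable (fun x => exp (-(ε * f x))) μ := bdd_int (by fun_prop) (D := exp (ε * D)) (hμK.mono fun x hx => by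
      rw [abs_of_pos (exp_pos _)]; exact exp_le_exp.2 ((le_abs_self _).trans (hf1 x hx)))
    rw [← ofReal_integral_eq_lintegral_ofReal iu (Eventually.of_forall fun _ => (exp_pos _).le),
      ← ofReal_integral_eq_lintegral_ofReal iw (Eventually.of_forall fun _ => (exp_pos _).le),
      ← ofReal_mul (integral_nonneg fun _ => (exp_pos _).le), ENNReal.ofReal_le_one] at P
    set a := ∫ x, exp (u x) ∂μ
    set b := ∫ x, exp (-(ε * f x)) ∂μ
    have hDD : D ≤ D1 := by rw [hD1]; have : 0 ≤ 2 * D^2/s := by positivity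
                            linarith
    have la : 1 - ε^2 * (W/r) + ε^2 * V/2 - ε^3 * (D * (2 * D^2/s) + D1^3) ≤ a := by
      have : ∫ x, (1 + ε * f x - ε^2 * (‖G x‖^2 / r) + ε^2 / 2 * f x^2  - ε^3 * (D * (2 * D^2/s) + D1^3)) ∂μ ≤ a := by
        refine integral_mono_ae (by fun_prop) iu (hμK.mono fun x hx => ?_)
        have a1 := hu1 x hx
        have a2 := exp_lb (a1.trans hεD)
        have a3 : |u x|^3 ≤ (ε * D1)^3 := by gcongr
        obtain ⟨q0, q1⟩ := hq x hx
        have a4 : ε^2 * f x^2 - 2 * ε^3 * (D * (2*D^2/s)) ≤ u x^2 := by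
          have : f x * q x ≤ D * (2*D^2/s) := by
            have := hfD x hx
            calc f x * q x ≤ |f x| * q x := by gcongr; exact le_abs_self _
              _ ≤ _ := by gcongr
          have h3 : ε^3 * (f x * q x) ≤ ε^3 * (D * (2*D^2/s)) := by gcongr
          have h4 : u x^2 = ε^2 * f x^2 - 2 * (ε^3 * (f x * q x)) + (ε^2 * q x)^2 := by simp only [hu]; ring
          nlinarith [sq_nonneg (ε^2 * q x)]
        have a5 : u x = ε * f x - ε^2 * (‖G x‖^2 / r) := rfl
        simp only
        nlinarith
      refine le_trans (le_of_eq ?_) this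
      rw [integral_sub (by fun_prop) (by fun_prop), integral_add (by fun_prop) (by fun_prop), integral_sub (by fun_prop) (by fun_prop),
        integral_add (by fun_prop) (by fun_prop), integral_const_mul, integral_const_mul, integral_const_mul, integral_div, h0]
      simp [V, W]; ring
    have lb : 1 + ε^2 * V/2 - ε^3 * D^3 ≤ b := by
      have : ∫ x, (1 - ε * f x + ε^2/2 * f x^2 - ε^3 * D^3) ∂μ ≤ b := by
        refine integral_mono_ae (by fun_prop) iw (hμK.mono fun x hx => ?_)
        have a1 := hf1 x hx
        have a2 := exp_lb (z := -(ε * f x)) (a1.trans (by nlinarith))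
        have a3 : |-(ε * f x)|^3 ≤ (ε * D)^3 := by gcongr
        simp only
        nlinarith
      refine le_trans (le_of_eq ?_) this
      rw [integral_sub (by fun_prop) (by fun_prop), integral_add (by fun_prop) (by fun_prop), integral_sub (by fun_prop) (by fun_prop),
        integral_const_mul, integral_const_mul, h0]
      simp [V]; ring
    have ua : |a - 1| ≤ 2 * (ε * D1) := by
      have : a - 1 = ∫ x, (exp (u x) - 1) ∂μ := by rw [integral_sub iu (by fun_prop)]; simp [a]
      rw [this]
      have := norm_integral_le_of_norm_le_const (μ := μ) (f := fun x => exp (u x) - 1) (C := 2 * (ε * D1)) (hμK.mono fun x hx => by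
        have := Real.abs_exp_sub_one_le ((hu1 x hx).trans hεD)
        rw [norm_eq_abs]; linarith [hu1 x hx])
      simpa using this
    have ub : |b - 1| ≤ (ε * D)^2 := by
      have : b - 1 = ∫ x, (exp (-(ε * f x)) - 1 - -(ε * f x)) ∂μ := by
        rw [integral_sub (by fun_prop) (by fun_prop), integral_sub iw (by fun_prop), integral_neg, integral_const_mul, h0]; simp [b]
      rw [this]
      have := norm_integral_le_of_norm_le_const (μ := μ) (f := fun x => exp (-(ε * f x)) - 1 - -(ε * f x)) (C := (ε * D)^2) (hμK.mono fun x hx => by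
        have h1 := hf1 x hx
        have h2 := Real.abs_exp_sub_one_sub_id_le (x := -(ε * f x)) (h1.trans (by nlinarith))
        rw [norm_eq_abs]
        refine h2.trans ?_
        rw [← sq_abs]; gcongr)
      simpa using this
    have up : a + b - 2 ≤ 2 * (ε * D1) * (ε * D)^2 := by
      have h3 : |(a-1)*(b-1)| ≤ 2 * (ε * D1) * (ε * D)^2 := by rw [abs_mul]; gcongr
      have := (abs_le.1 h3).1
      nlinarith
    have fin : ε^2 * V ≤ ε^2 * (W/r + D2 * ε) := by
      have e : ε^2 * (W/r + D2 * ε) = ε^2*(W/r) + ε^3*(D*(2*D^2/s)+D1^3) + ε^3*D^3 + 2*(ε*D1)*(ε*D)^2 := by simp only [D2]; ring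
      rw [e]; linarith
    exact le_of_mul_le_mul_left fin (by positivity)
  have lim : Filter.Tendsto (fun ε : ℝ => W / (s - 4 * ε * B) + D2 * ε) (nhdsWithin 0 (Ioi 0)) (nhds (W / s)) := by
    have : ContinuousAt (fun ε : ℝ => W / (s - 4 * ε * B) + D2 * ε) 0 := by
      refine ContinuousAt.add (ContinuousAt.div (by fun_prop) (by fun_prop) (by simpa using hs.ne')) (by fun_prop)
    have := this.tendsto
    simp only [mul_zero, zero_mul, sub_zero, add_zero] at this
    exact this.mono_left nhdsWithin_le_nhds
  refine ge_of_tendsto lim ?_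
  have g1 : ∀ᶠ ε : ℝ in nhds 0, 4 * ε * B < s/2 := by
    refine ContinuousAt.eventually_lt (by fun_prop) (by fun_prop) (by simpa using by linarith)
  have g2 : ∀ᶠ ε : ℝ in nhds 0, ε * (D1+1) < 1 := by
    refine ContinuousAt.eventually_lt (by fun_prop) (by fun_prop) (by simp)
  filter_upwards [self_mem_nhdsWithin, nhdsWithin_le_nhds g1, nhdsWithin_le_nhds g2] with ε h1 h2 h3
  exact key ε h1 h2.le h3.le
lemma maurey {K : Set (E n)} (hK : Convex ℝ K) (hKm : MeasurableSet K) {s : ℝ} (hs : 0 < s) {θ : E n} {c : ℝ≥0∞}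
    {f : E n → ℝ} {G : E n → E n} (hf : Measurable f) (hG : Measurable G) {B D : ℝ} (hB : 0 ≤ B) (hD : 0 ≤ D)
    (H : ∀ x ∈ K, ∀ y ∈ K, f x - f y ≤ ⟪G x, x - y⟫ + B * ‖x-y‖^2) (hfD : ∀ x ∈ K, |f x| ≤ D) (hGD : ∀ x ∈ K, ‖G x‖ ≤ D)
    {μ : Measure (E n)} [IsProbabilityMeasure μ] (hμ : μ = c • (volume.restrict K).withDensity (fun x => ofReal (wt s θ x))) :
    ∫ x, f x ^2 ∂μ - (∫ x, f x ∂μ)^2 ≤ (∫ x, ‖G x‖^2 ∂μ) / s := by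
  have hμK : ∀ᵐ x ∂μ, x ∈ K := by
    rw [hμ]
    refine Measure.ae_smul_measure ((withDensity_absolutelyContinuous _ _).ae_le (ae_restrict_mem hKm)) _
  have if1 : Integrable f μ := bdd_int hf (hμK.mono fun x hx => hfD x hx)
  have if2 : Integrable (fun x => f x^2) μ := bdd_int (by fun_prop) (D := D^2) (hμK.mono fun x hx => by
    rw [abs_pow]; have := hfD x hx; gcongr)
  set a := ∫ x, f x ∂μ with ha
  have := maurey0 hK hKm hs (f := fun x => f x - a) (G := G) (hf.sub_const a) hG hB (D := D + |a|) (by positivity)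
    (fun x hx y hy => by have := H x hx y hy; linarith) (fun x hx => (abs_sub _ _).trans (by gcongr; exact hfD x hx))
    (fun x hx => (hGD x hx).trans (by linarith [abs_nonneg a])) hμ (by rw [integral_sub if1 (by fun_prop)]; simp [ha])
  refine le_trans (le_of_eq ?_) this
  have e : ∀ x, (f x - a)^2 = f x^2 - 2 * a * f x + a^2 := fun x => by ring
  simp_rw [e]
  rw [integral_add (by fun_prop) (by fun_prop), integral_sub (by fun_prop) (by fun_prop), integral_const_mul]
  simp [← ha]; ring
end SL
end
section
namespace SL
variable {n : ℕ}
set_option linter.unusedSectionVars false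
def vec (G : Fin n → ℝ) : E n := WithLp.toLp 2 G
lemma vec_sq (G : Fin n → ℝ) : ‖vec G‖^2 = ∑ k, G k^2 := by
  rw [EuclideanSpace.real_norm_sq_eq]; rfl
lemma vec_inner (G : Fin n → ℝ) (y : E n) : ⟪vec G, y⟫ = ∑ k, G k * y k := by
  rw [PiLp.inner_apply]; simp [vec, mul_comm]
lemma vec_meas {G : Fin n → E n → ℝ} (h : ∀ k, Continuous (G k)) : Continuous fun x => vec (fun k => G k x) := by
  unfold vec; fun_prop
def C11 (f : E n → ℝ) (G : Fin n → E n → ℝ) : Prop :=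
  Continuous f ∧ (∀ k, Continuous (G k)) ∧ ∃ B : ℝ, 0 ≤ B ∧ ∀ x y : E n, |f y - f x - ∑ k, G k x * (y k - x k)| ≤ B * ‖y - x‖^2
lemma C11.lin {f φ : E n → ℝ} {G Φ} (h : C11 f G) (h' : C11 φ Φ) (s : ℝ) : C11 (fun x => f x + s * φ x) (fun k x => G k x + s * Φ k x) := by
  obtain ⟨a1, a2, B, hB, a3⟩ := h
  obtain ⟨b1, b2, B', hB', b3⟩ := h'
  refine ⟨by fun_prop, fun k => (a2 k).add (continuous_const.mul (b2 k)), B + |s| * B', by positivity, fun x y => ?_⟩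
  have e : f y + s * φ y - (f x + s * φ x) - ∑ k, (G k x + s * Φ k x) * (y k - x k)
      = (f y - f x - ∑ k, G k x * (y k - x k)) + s * (φ y - φ x - ∑ k, Φ k x * (y k - x k)) := by
    simp only [add_mul, sum_add_distrib, mul_sub s, mul_sum, mul_assoc]; ring
  rw [e, add_mul, mul_assoc]
  refine (abs_add_le _ _).trans (add_le_add (a3 x y) ?_)
  rw [abs_mul]; gcongr; exact b3 x y
lemma C11.const (c : ℝ) : C11 (fun _ : E n => c) (fun _ _ => 0) :=
  ⟨by fun_prop, by fun_prop, 0, le_rfl, fun x y => by simp⟩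
lemma C11.coord (u : Fin n → ℝ) : C11 (fun x : E n => ∑ k, u k * x k) (fun k _ => u k) :=
  ⟨by fun_prop, by fun_prop, 0, le_rfl, fun x y => by simp [mul_sub]⟩
def DS (d : Fin n → ℝ) : E n →L[ℝ] ℝ := ∑ k, d k • (EuclideanSpace.proj k : E n →L[ℝ] ℝ)
lemma DS_apply (d : Fin n → ℝ) (y : E n) : DS d y = ∑ k, d k * y k := by simp [DS]
lemma DS_norm (d : Fin n → ℝ) : ‖DS d‖ ≤ ∑ k, |d k| := by
  refine ContinuousLinearMap.opNorm_le_bound _ (by positivity) fun y => ?_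
  rw [DS_apply, norm_eq_abs, sum_mul]
  refine (Finset.abs_sum_le_sum_abs _ _).trans (sum_le_sum fun k _ => ?_)
  rw [abs_mul]; gcongr; exact abs_coord_le y k
lemma lip_of {F : E n → ℝ} {d : Fin n → E n → ℝ} (h : ∀ θ, HasFDerivAt F (DS fun k => d k θ) θ) {C : ℝ}
    (hC : ∀ k θ, |d k θ| ≤ C) (x y : E n) : |F y - F x| ≤ n * C * ‖y - x‖ := by
  refine convex_univ.norm_image_sub_le_of_norm_hasFDerivWithin_le (fun z _ => (h z).hasFDerivWithinAt) (fun z _ => ?_) (mem_univ x) (mem_univ y)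
  refine (DS_norm _).trans ((sum_le_sum fun k _ => hC k z).trans (by simp))
lemma C11.of_lip {F : E n → ℝ} {d : Fin n → E n → ℝ} (h : ∀ θ, HasFDerivAt F (DS fun k => d k θ) θ) {C : ℝ} (hC : 0 ≤ C)
    (hd : ∀ k x y, |d k y - d k x| ≤ C * ‖y - x‖) : C11 F d := by
  refine ⟨continuous_iff_continuousAt.2 fun x => (h x).continuousAt, fun k => ?_, n * C, by positivity, fun x y => ?_⟩
  · refine (LipschitzWith.of_dist_le_mul (K := ⟨C, hC⟩) fun x y => ?_).continuous
    rw [Real.dist_eq, dist_eq_norm]; exact hd k y x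
  have := (convex_segment x y).norm_image_sub_le_of_norm_hasFDerivWithin_le' (C := n * (C * ‖y - x‖)) (f := F)
    (f' := fun z => DS fun k => d k z) (φ := DS fun k => d k x)
    (fun z _ => (h z).hasFDerivWithinAt) (fun z hz => ?_) (left_mem_segment ℝ x y) (right_mem_segment ℝ x y)
  · rw [DS_apply] at this
    rw [sq, ← mul_assoc, mul_assoc (n:ℝ) C]; exact this
  · have e : (DS fun k => d k z) - (DS fun k => d k x) = DS fun k => d k z - d k x := by
      ext w; rw [sub_apply, DS_apply, DS_apply, DS_apply]; simp [sub_mul]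
    rw [e]
    refine (DS_norm _).trans ((sum_le_sum (g := fun _ => C * ‖y - x‖) fun k _ => ?_).trans (by simp))
    refine (hd k x z).trans ?_
    gcongr
    obtain ⟨a, b, ha, hb, hab, rfl⟩ := hz
    have : a • x + b • y - x = b • (y - x) := by
      have : a = 1 - b := by linarith
      rw [this]; module
    rw [this, norm_smul, norm_of_nonneg hb]
    nlinarith [norm_nonneg (y - x)]
def tilt (m : Measure (E n)) (t : ℝ) (θ : E n) : Measure (E n) := m.withDensity fun x => ofReal (wt t θ x / Zt m t θ)
section
variable (m : Measure (E n)) [CSupp m]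
lemma tilt_int (f : E n → ℝ) (t : ℝ) (θ : E n) : ∫ x, f x ∂(tilt m t θ) = Mn m f t θ := by
  unfold tilt
  have hm : Measurable fun x => wt t θ x / Zt m t θ := ((wt_cont t θ).div_const _).measurable
  rw [integral_withDensity_eq_integral_toReal_smul hm.ennreal_ofReal (Eventually.of_forall fun _ => ENNReal.ofReal_lt_top)]
  unfold Mn In
  rw [← integral_div]
  congr 1; ext x
  rw [toReal_ofReal (div_pos (wt_pos _ _ _) (Zt_pos m _ _)).le, smul_eq_mul]; ring
instance tilt_csupp (t : ℝ) (θ : E n) : CSupp (tilt m t θ) where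
  prob := by
    refine ⟨?_⟩
    unfold tilt
    rw [withDensity_apply _ MeasurableSet.univ, Measure.restrict_univ, ← ofReal_integral_eq_lintegral_ofReal]
    · rw [integral_div]
      have : ∫ x, wt t θ x ∂m = Zt m t θ := by unfold Zt In; simp
      rw [this, div_self (Zt_pos m t θ).ne']; simp
    · exact (int_m m (wt_cont t θ)).div_const _
    · exact Eventually.of_forall fun x => (div_pos (wt_pos _ _ _) (Zt_pos m _ _)).le
  bdd := by
    obtain ⟨R, hR, h⟩ := CSupp.bdd (m := m)
    exact ⟨R, hR, (withDensity_absolutelyContinuous _ _).ae_le h⟩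
lemma wt_add (t s : ℝ) (θ η x : E n) : wt t θ x * wt s η x = wt (t+s) (θ+η) x := by
  unfold wt; rw [← exp_add, inner_add_left]; congr 1; ring
end
def LC (m : Measure (E n)) (t : ℝ) : Prop :=
  ∃ (K : Set (E n)) (c : ℝ≥0∞) (θ : E n), IsCompact K ∧ Convex ℝ K ∧ m = c • (volume.restrict K).withDensity (fun x => ofReal (wt t θ x))
lemma LC.tilt {m : Measure (E n)} [CSupp m] {t : ℝ} (h : LC m t) (s : ℝ) (η : E n) : LC (tilt m s η) (t+s) := by
  obtain ⟨K, c, θ, hK, hc, e⟩ := h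
  refine ⟨K, c * ofReal ((Zt m s η)⁻¹), θ + η, hK, hc, ?_⟩
  unfold SL.tilt
  generalize hz : Zt m s η = z
  have hzp : 0 < z := hz ▸ Zt_pos m s η
  have m1 : Measurable fun x : E n => ofReal (wt t θ x) := (wt_cont t θ).measurable.ennreal_ofReal
  have m2 : Measurable fun x : E n => ofReal (wt s η x / z) := ((wt_cont s η).div_const _).measurable.ennreal_ofReal
  rw [e, withDensity_smul_measure, ← withDensity_mul _ m1 m2, mul_smul]
  congr 1
  rw [← withDensity_smul _ (wt_cont _ _).measurable.ennreal_ofReal]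
  congr 1
  ext x
  simp only [Pi.mul_apply, Pi.smul_apply, smul_eq_mul]
  rw [← ofReal_mul (wt_pos _ _ _).le, ← ofReal_mul (by positivity), ← wt_add]
  congr 1; ring
def Poi (m : Measure (E n)) (C : ℝ) : Prop := ∀ f G, C11 f G → ∫ x, f x^2 ∂m - (∫ x, f x ∂m)^2 ≤ C * ∑ k, ∫ x, G k x^2 ∂m
lemma LC.poi {m : Measure (E n)} [CSupp m] {t : ℝ} (ht : 0 < t) (h : LC m t) : Poi m (1/t) := by
  intro f G hf
  obtain ⟨K, c, θ, hK, hc, e⟩ := h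
  obtain ⟨h1, h2, B, hB, h3⟩ := hf
  have hv := vec_meas h2
  obtain ⟨D1, hD1⟩ := hK.exists_bound_of_continuousOn h1.continuousOn
  obtain ⟨D2, hD2⟩ := hK.exists_bound_of_continuousOn hv.continuousOn
  have := maurey hc hK.measurableSet ht (f := f) (G := fun x => vec fun k => G k x) h1.measurable hv.measurable (B := B)
    (D := |D1| + |D2|) hB (by positivity) (fun x _ y _ => ?_) (fun x hx => (hD1 x hx).trans ?_) (fun x hx => (hD2 x hx).trans ?_) e
  · simp only [vec_sq] at this
    rw [integral_finsetSum _ fun k _ => int_m m (f := fun x => G k x^2) ((h2 k).pow 2)] at this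
    rw [one_div, mul_comm, ← div_eq_mul_inv]; exact this
  · have := (abs_le.1 (h3 x y)).1
    rw [vec_inner, norm_sub_rev]
    have e : ∑ k, G k x * (x - y) k = - ∑ k, G k x * (y k - x k) := by
      rw [← Finset.sum_neg_distrib]; refine sum_congr rfl fun k _ => ?_
      rw [PiLp.sub_apply]; ring
    rw [e]; linarith
  · linarith [le_abs_self D1, abs_nonneg D2]
  · linarith [le_abs_self D2, abs_nonneg D1]
lemma LC.poi_Mn {m : Measure (E n)} [CSupp m] {t : ℝ} (h : LC m t) {s : ℝ} (hs : 0 < t + s) (θ : E n) {f G} (hf : C11 f G) :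
    Mn m (fun x => f x^2) s θ - (Mn m f s θ)^2 ≤ 1/(t+s) * ∑ k, Mn m (fun x => G k x^2) s θ := by
  have := (h.tilt s θ).poi hs f G hf
  simpa only [tilt_int] using this
structure Bd (f : E n → ℝ) : Prop where
  cont : Continuous f
  bd : ∃ C, 0 ≤ C ∧ ∀ x, |f x| ≤ C
lemma Bd.mul {f g : E n → ℝ} (hf : Bd f) (hg : Bd g) : Bd fun x => f x * g x := by
  obtain ⟨a, A, hA, h1⟩ := hf
  obtain ⟨b, B, hB, h2⟩ := hg
  exact ⟨a.mul b, A * B, by positivity, fun x => by rw [abs_mul]; gcongr; exacts [h1 x, h2 x]⟩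
lemma Bd.sq {f : E n → ℝ} (hf : Bd f) : Bd fun x => f x ^2 := by simpa only [_root_.sq] using hf.mul hf
lemma Bd.cmul {f : E n → ℝ} (hf : Bd f) (c : ℝ) : Bd fun x => c * f x := by
  obtain ⟨a, A, hA, h1⟩ := hf
  exact ⟨by fun_prop, |c| * A, by positivity, fun x => by rw [abs_mul]; gcongr; exact h1 x⟩
lemma Bd.int {f : E n → ℝ} (hf : Bd f) (μ : Measure (E n)) [IsProbabilityMeasure μ] : Integrable f μ :=
  bdd_int hf.cont.measurable (D := hf.bd.choose) (Eventually.of_forall fun x => hf.bd.choose_spec.2 x)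
lemma Bd.shift {f : E n → ℝ} (hf : Bd f) (a : E n) (c : ℝ) : Bd fun g => f (a + c • g) := by
  obtain ⟨a, A, hA, h1⟩ := hf
  exact ⟨by fun_prop, A, hA, fun x => h1 _⟩
lemma gam_lc : gam n = ofReal (((2 * Real.pi) ^ ((n : ℝ) / 2))⁻¹) • (volume.restrict univ).withDensity (fun x : E n => ofReal (wt 1 0 x)) := by
  rw [Measure.restrict_univ, ← withDensity_smul _ (wt_cont _ _).measurable.ennreal_ofReal]
  unfold gam
  congr 1; ext x
  simp only [Pi.smul_apply, smul_eq_mul]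
  rw [← ofReal_mul (by positivity)]
  unfold gd wt
  simp [neg_div]
lemma gam_poi {f G} (h : C11 (n := n) f G) (hf : Bd f) (hG : ∀ k, Bd (G k)) :
    ∫ x, f x^2 ∂(gam n) - (∫ x, f x ∂(gam n))^2 ≤ ∑ k, ∫ x, G k x^2 ∂(gam n) := by
  obtain ⟨h1, h2, B, hB, h3⟩ := h
  obtain ⟨_, D1, hD10, hD1⟩ := hf
  choose D2 hD20 hD2 using fun k => (hG k).bd
  have hv := vec_meas h2
  have := maurey convex_univ MeasurableSet.univ one_pos (f := f) (G := fun x => vec fun k => G k x) h1.measurable hv.measurable (B := B)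
    (D := D1 + (1 + ∑ k, D2 k^2)) hB (by positivity) (fun x _ y _ => ?_) (fun x hx => (hD1 x).trans ?_) (fun x hx => ?_) (gam_lc (n := n))
  · simp only [vec_sq] at this
    rw [integral_finsetSum _ fun k _ => (hG k).sq.int _, div_one] at this
    exact this
  · have := (abs_le.1 (h3 x y)).1
    rw [vec_inner, norm_sub_rev]
    have e : ∑ k, G k x * (x - y) k = - ∑ k, G k x * (y k - x k) := by
      rw [← Finset.sum_neg_distrib]; refine sum_congr rfl fun k _ => ?_
      rw [PiLp.sub_apply]; ring
    rw [e]; linarith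
  · have : 0 ≤ 1 + ∑ k, D2 k^2 := by positivity
    linarith
  · have : ‖vec fun k => G k x‖^2 ≤ ∑ k, D2 k^2 := by
      rw [vec_sq]; refine sum_le_sum fun k _ => ?_
      rw [← sq_abs]; have := hD2 k x; gcongr
    nlinarith [norm_nonneg (vec fun k => G k x), sq_nonneg (‖vec fun k => G k x‖ - 1)]
def Qs (ρ : ℝ) (ψ : E n → ℝ) (x : E n) : ℝ := ∫ g, ψ (ρ • x + √ρ • g) ∂(gam n)
lemma Bd.Qs {ψ : E n → ℝ} (h : Bd ψ) (ρ : ℝ) : Bd (Qs ρ ψ) := by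
  obtain ⟨hc, C, hC, hb⟩ := h
  refine ⟨?_, C, hC, fun x => ?_⟩
  · unfold SL.Qs
    refine continuous_of_dominated (bound := fun _ => C) (fun x => ?_) (fun x => ?_) (by fun_prop) ?_
    · exact (by fun_prop : Continuous _).aestronglyMeasurable
    · exact Eventually.of_forall fun g => hb _
    · exact Eventually.of_forall fun g => by fun_prop
  · have := norm_integral_le_of_norm_le_const (μ := gam n) (f := fun g => ψ (ρ • x + √ρ • g)) (C := C) (Eventually.of_forall fun g => hb _)
    simpa [SL.Qs] using this
lemma C11.Qs {φ : E n → ℝ} {Φ} (h : C11 φ Φ) (b : Bd φ) (b' : ∀ k, Bd (Φ k)) {ρ : ℝ} : C11 (Qs ρ φ) (fun k x => ρ * Qs ρ (Φ k) x) := by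
  refine ⟨(b.Qs ρ).cont, fun k => (((b' k).Qs ρ).cmul ρ).cont, ?_⟩
  obtain ⟨h1, h2, B, hB, h3⟩ := h
  refine ⟨B * ρ^2, by positivity, fun x y => ?_⟩
  have i1 : ∀ z, Integrable (fun g => φ (ρ • z + √ρ • g)) (gam n) := fun z => (b.shift _ _).int _
  have i2 : ∀ k, Integrable (fun g => Φ k (ρ • x + √ρ • g)) (gam n) := fun k => ((b' k).shift _ _).int _
  have e : SL.Qs ρ φ y - SL.Qs ρ φ x - ∑ k, ρ * SL.Qs ρ (Φ k) x * (y k - x k) =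
      ∫ g, (φ (ρ • y + √ρ • g) - φ (ρ • x + √ρ • g) - ∑ k, Φ k (ρ • x + √ρ • g) * ((ρ • y + √ρ • g) k - (ρ • x + √ρ • g) k)) ∂(gam n) := by
    have e1 : ∀ k (g : E n), (ρ • y + √ρ • g) k - (ρ • x + √ρ • g) k = ρ * (y k - x k) := fun k g => by simp; ring
    simp only [e1]
    have i3 : Integrable (fun g => φ (ρ • y + √ρ • g) - φ (ρ • x + √ρ • g)) (gam n) := (i1 y).sub (i1 x)
    rw [integral_sub i3 (integrable_finsetSum _ fun k _ => (i2 k).mul_const _), integral_sub (i1 y) (i1 x),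
      integral_finsetSum _ fun k _ => (i2 k).mul_const _]
    simp only [integral_mul_const]
    unfold SL.Qs
    congr 1
    refine sum_congr rfl fun k _ => by ring
  rw [e]
  have := norm_integral_le_of_norm_le_const (μ := gam n) (C := B * ρ^2 * ‖y-x‖^2) (f := fun g => (φ (ρ • y + √ρ • g) - φ (ρ • x + √ρ • g) - ∑ k, Φ k (ρ • x + √ρ • g) * ((ρ • y + √ρ • g) k - (ρ • x + √ρ • g) k)))
    (Eventually.of_forall fun g => by
      refine (h3 _ _).trans (le_of_eq ?_)
      rw [add_sub_add_right_eq_sub, ← smul_sub, norm_smul, mul_pow, norm_eq_abs, sq_abs]; ring)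
  simpa using this
lemma jensen_sq {μ : Measure (E n)} [IsProbabilityMeasure μ] {f : E n → ℝ} (h1 : Integrable f μ) (h2 : Integrable (fun x => f x^2) μ) :
    (∫ x, f x ∂μ)^2 ≤ ∫ x, f x^2 ∂μ := by
  set a := ∫ x, f x ∂μ with ha
  have : 0 ≤ ∫ x, (f x - a)^2 ∂μ := integral_nonneg fun x => sq_nonneg _
  have e : ∀ x, (f x - a)^2 = f x^2 - 2 * a * f x + a^2 := fun x => by ring
  simp_rw [e] at this
  rw [integral_add (by fun_prop) (by fun_prop), integral_sub (by fun_prop) (by fun_prop), integral_const_mul, ← ha] at this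
  simp at this
  nlinarith
lemma Qs_sq {ψ : E n → ℝ} (h : Bd ψ) (ρ : ℝ) (x : E n) : Qs ρ ψ x^2 ≤ Qs ρ (fun z => ψ z^2) x :=
  jensen_sq ((h.shift _ _).int _) ((h.shift (ρ • x) (√ρ)).sq.int _)
section
variable (m : Measure (E n)) [CSupp m]
lemma EE_Qs {F : ℝ → E n → ℝ} {ρ : ℝ} (hρ : 0 ≤ ρ) (h : Bd (F ρ)) : EE m F ρ = ∫ x, Qs ρ (F ρ) x ∂m := by
  obtain ⟨C, hC, hb⟩ := h.bd
  have := bayes m (φ := fun _ => 1) continuous_const h.cont (C := C) (fun x => (hb x).trans ?_) hρ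
  · simpa [EE, Zt, Qs] using this
  · have : 1 ≤ exp (C * ‖x‖) := one_le_exp (by positivity)
    nlinarith
lemma EE_Qs_Mn {F : ℝ → E n → ℝ} {ρ : ℝ} (hρ : 0 ≤ ρ) (h : Bd (F ρ)) {φ : E n → ℝ} (hφ : Continuous φ) :
    EE m (fun t θ => F t θ * Mn m φ t θ) ρ = ∫ x, φ x * Qs ρ (F ρ) x ∂m := by
  obtain ⟨C, hC, hb⟩ := h.bd
  have := bayes m hφ h.cont (C := C) (fun x => (hb x).trans ?_) hρ
  · unfold EE Mn
    simp only [mul_assoc, div_mul_cancel₀ _ (Zt_pos m _ _).ne']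
    exact this
  · have : 1 ≤ exp (C * ‖x‖) := one_le_exp (by positivity)
    nlinarith
lemma var_EE {C : ℝ} (hC0 : 0 ≤ C) (hC : Poi m C) {ρ : ℝ} (hρ : 0 ≤ ρ) {F : ℝ → E n → ℝ} {d : Fin n → ℝ → E n → ℝ}
    (h : C11 (F ρ) (fun k => d k ρ)) (b : Bd (F ρ)) (b' : ∀ k, Bd (d k ρ)) :
    EE m (fun t θ => F t θ^2) ρ - (EE m F ρ)^2 ≤ (ρ^2 * C + ρ) * ∑ k, EE m (fun t θ => d k t θ^2) ρ := by
  rw [EE_Qs m hρ b, EE_Qs m (F := fun t θ => F t θ^2) hρ b.sq]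
  simp_rw [fun k => EE_Qs m (F := fun t θ => d k t θ^2) hρ (b' k).sq]
  have h1 := hC _ _ (h.Qs b b' (ρ := ρ))
  have i1 := (b.sq.Qs ρ).int m
  have i2 := (b.Qs ρ).sq.int m
  have i3 : ∀ k, Integrable (Qs ρ fun θ => d k ρ θ^2) m := fun k => ((b' k).sq.Qs ρ).int m
  have h2 : ∫ x, Qs ρ (fun θ => F ρ θ^2) x ∂m - ∫ x, Qs ρ (F ρ) x^2 ∂m ≤ ρ * ∑ k, ∫ x, Qs ρ (fun θ => d k ρ θ^2) x ∂m := by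
    rw [← integral_sub i1 i2, ← integral_finsetSum _ fun k _ => i3 k, ← integral_const_mul]
    refine integral_mono (i1.sub i2) ((integrable_finsetSum _ fun k _ => i3 k).const_mul _) fun x => ?_
    have c := gam_poi (f := fun g => F ρ (ρ • x + √ρ • g)) (G := fun k g => √ρ * d k ρ (ρ • x + √ρ • g)) ?_ (b.shift _ _)
      (fun k => ((b' k).shift _ _).cmul _)
    · simp only [mul_pow, sq_sqrt hρ, integral_const_mul] at c
      rw [← mul_sum] at c
      exact c
    · obtain ⟨h1, h2, B, hB, h3⟩ := h
      refine ⟨by fun_prop, fun k => ((b' k).shift (ρ • x) (√ρ)).cont.const_mul _, B * ρ, by positivity, fun y z => ?_⟩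
      have := h3 (ρ • x + √ρ • y) (ρ • x + √ρ • z)
      rw [add_sub_add_left_eq_sub, ← smul_sub, norm_smul, mul_pow, norm_eq_abs, sq_abs, sq_sqrt hρ] at this
      rw [mul_assoc]
      refine le_trans (le_of_eq ?_) this
      congr 2
      refine sum_congr rfl fun k _ => ?_
      simp; ring
  have h4 : C * ∑ k, ∫ x, (ρ * Qs ρ (d k ρ) x)^2 ∂m ≤ ρ^2 * C * ∑ k, ∫ x, Qs ρ (fun θ => d k ρ θ^2) x ∂m := by
    simp only [mul_pow, integral_const_mul, ← mul_sum]
    have : ∑ k, ∫ x, Qs ρ (d k ρ) x^2 ∂m ≤ ∑ k, ∫ x, Qs ρ (fun θ => d k ρ θ^2) x ∂m :=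
      sum_le_sum fun k _ => integral_mono (((b' k).Qs ρ).sq.int m) (i3 k) fun x => Qs_sq (b' k) ρ x
    have := mul_le_mul_of_nonneg_left this (by positivity : 0 ≤ ρ^2 * C)
    linarith
  linarith
end
end SL
end
section
namespace SL
variable {n : ℕ}
set_option linter.unusedSectionVars false
inductive MP (m : Measure (E n)) : (ℝ → E n → ℝ) → Prop
  | mn {f : E n → ℝ} (hf : Continuous f) : MP m (Mn m f)
  | const (c : ℝ) : MP m (fun _ _ => c)
  | add {F G : ℝ → E n → ℝ} (hF : MP m F) (hG : MP m G) : MP m (fun t θ => F t θ + G t θ)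
  | mul {F G : ℝ → E n → ℝ} (hF : MP m F) (hG : MP m G) : MP m (fun t θ => F t θ * G t θ)
section
variable {m : Measure (E n)} [CSupp m]
lemma MP.cmul {F : ℝ → E n → ℝ} (hF : MP m F) (c : ℝ) : MP m (fun t θ => c * F t θ) := (MP.const c).mul hF
lemma MP.sub {F G : ℝ → E n → ℝ} (hF : MP m F) (hG : MP m G) : MP m (fun t θ => F t θ - G t θ) := by
  have := hF.add (hG.cmul (-1))
  simpa [← sub_eq_add_neg] using this
lemma MP.sq {F : ℝ → E n → ℝ} (hF : MP m F) : MP m (fun t θ => F t θ ^ 2) := by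
  simpa only [_root_.sq] using hF.mul hF
lemma MP.sum {ι : Type*} {s : Finset ι} {F : ι → ℝ → E n → ℝ} (h : ∀ i, MP m (F i)) : MP m (fun t θ => ∑ i ∈ s, F i t θ) := by
  classical
  induction s using Finset.induction_on with
  | empty => simpa using MP.const 0
  | insert a s ha ih => simpa [Finset.sum_insert ha] using (h a).add ih
lemma MP.av (k : Fin n) : MP m (av m k) := MP.mn (by fun_prop)
lemma MP.bd {F : ℝ → E n → ℝ} (h : MP m F) : ∃ C, 0 ≤ C ∧ ∀ t θ, |F t θ| ≤ C := by
  induction h with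
  | mn hf => obtain ⟨C, hC, h⟩ := CSupp.bound m hf; exact ⟨C, hC, fun t θ => Mn_le m hf h t θ⟩
  | const c => exact ⟨|c|, abs_nonneg _, fun _ _ => le_rfl⟩
  | add _ _ h1 h2 =>
    obtain ⟨a, ha, h1⟩ := h1; obtain ⟨b, hb, h2⟩ := h2
    exact ⟨a + b, by positivity, fun t θ => (abs_add_le _ _).trans (add_le_add (h1 t θ) (h2 t θ))⟩
  | mul _ _ h1 h2 =>
    obtain ⟨a, ha, h1⟩ := h1; obtain ⟨b, hb, h2⟩ := h2
    exact ⟨a * b, by positivity, fun t θ => by rw [abs_mul]; exact mul_le_mul (h1 t θ) (h2 t θ) (abs_nonneg _) ha⟩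
lemma MP.gen {F : ℝ → E n → ℝ} (h : MP m F) : ∃ l d, Gen m F l d ∧ MP m l ∧ ∀ k, MP m (d k) := by
  induction h with
  | mn hf => exact ⟨_, _, Gen.Mn m hf, MP.const 0, fun k => (MP.mn (by fun_prop)).sub ((MP.av k).mul (MP.mn hf))⟩
  | const c => exact ⟨_, _, Gen.const c, MP.const 0, fun k => MP.const 0⟩
  | add _ _ h1 h2 =>
    obtain ⟨_, _, a, b, c⟩ := h1; obtain ⟨_, _, a', b', c'⟩ := h2
    exact ⟨_, _, a.add a', b.add b', fun k => (c k).add (c' k)⟩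
  | mul u v h1 h2 =>
    obtain ⟨_, _, a, b, c⟩ := h1; obtain ⟨_, _, a', b', c'⟩ := h2
    exact ⟨_, _, a.mul a', ((b.mul v).add (u.mul b')).add (MP.sum fun k => (c k).mul (c' k)), fun k => ((c k).mul v).add (u.mul (c' k))⟩
lemma MP.eb {F : ℝ → E n → ℝ} (h : MP m F) : EB F := by
  obtain ⟨_, _, h, _⟩ := h.gen; exact h.eb
lemma MP.Bd {F : ℝ → E n → ℝ} (h : MP m F) (t : ℝ) : Bd (F t) :=
  ⟨h.eb.cont t, by obtain ⟨C, hC, h⟩ := h.bd; exact ⟨C, hC, h t⟩⟩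
lemma Gen.fd {F l} {d : Fin n → ℝ → E n → ℝ} (h : Gen m F l d) {t : ℝ} (ht : 0 < t) (θ : E n) :
    HasFDerivAt (F t) (DS fun k => d k t θ) θ := by
  obtain ⟨Ft, D2, h, _⟩ := h
  have h1 : HasFDerivAt (fun θ : E n => (t, θ)) (ContinuousLinearMap.inr ℝ ℝ (E n)) θ := hasFDerivAt_prodMk_right t θ
  refine ((h.hF t ht θ).comp θ h1).congr_fderiv ?_
  ext y
  rw [DS_apply, ContinuousLinearMap.comp_apply, ContinuousLinearMap.inr_apply, DL_apply]; simp
lemma MP.lip {F : ℝ → E n → ℝ} (h : MP m F) : ∃ C, 0 ≤ C ∧ ∀ t, 0 < t → ∀ x y, |F t y - F t x| ≤ C * ‖y - x‖ := by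
  obtain ⟨l, d, hg, _, hd⟩ := h.gen
  choose C hC0 hC using fun k => (hd k).bd
  refine ⟨n * ∑ k, C k, by have := sum_nonneg fun k (_ : k ∈ Finset.univ) => hC0 k
                           positivity, fun t ht x y => ?_⟩
  exact lip_of (fun θ => hg.fd ht θ) (fun k θ => (hC k t θ).trans (Finset.single_le_sum (fun k _ => hC0 k) (Finset.mem_univ k))) x y
lemma Gen.c11 {F l} {d : Fin n → ℝ → E n → ℝ} (h : Gen m F l d) (hd : ∀ k, MP m (d k)) {t : ℝ} (ht : 0 < t) :
    C11 (F t) (fun k => d k t) := by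
  choose C hC0 hC using fun k => (hd k).lip
  refine C11.of_lip (fun θ => h.fd ht θ) (C := ∑ k, C k) (sum_nonneg fun k _ => hC0 k) fun k x y => (hC k t ht x y).trans ?_
  gcongr
  exact Finset.single_le_sum (fun k _ => hC0 k) (Finset.mem_univ k)
end
lemma disc {A B C : ℝ} (h : ∀ s : ℝ, 0 ≤ A + 2 * s * B + s^2 * C) : B^2 ≤ A * C := by
  have := discrim_le_zero (a := C) (b := 2 * B) (c := A) fun s => by have := h s; linarith [sq s]
  unfold discrim at this; linarith
section
variable (m : Measure (E n)) [CSupp m]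
lemma EE_cs {F G : ℝ → E n → ℝ} (hF : MP m F) (hG : MP m G) (t : ℝ) :
    (EE m (fun t θ => F t θ * G t θ) t)^2 ≤ EE m (fun t θ => F t θ^2) t * EE m (fun t θ => G t θ^2) t := by
  refine disc fun s => ?_
  have := EE_nonneg m (F := fun t θ => (F t θ + s * G t θ)^2) (t := t) fun θ => sq_nonneg _
  have e : (fun t θ => (F t θ + s * G t θ)^2) = fun t θ => F t θ^2 + ((2 * s) * (F t θ * G t θ) + s^2 * G t θ^2) := by
    ext; ring
  rw [e, EE_add m hF.sq.eb (((hF.mul hG).cmul _).add (hG.sq.cmul _)).eb, EE_add m ((hF.mul hG).cmul _).eb (hG.sq.cmul _).eb, EE_cmul, EE_cmul] at this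
  linarith
lemma EE_css {F G : Fin n → ℝ → E n → ℝ} (hF : ∀ k, MP m (F k)) (hG : ∀ k, MP m (G k)) (t : ℝ) :
    (∑ k, EE m (fun t θ => F k t θ * G k t θ) t)^2 ≤ (∑ k, EE m (fun t θ => F k t θ^2) t) * ∑ k, EE m (fun t θ => G k t θ^2) t := by
  refine disc fun s => ?_
  have := sum_nonneg fun k (_ : k ∈ Finset.univ) => EE_nonneg m (F := fun t θ => (F k t θ + s * G k t θ)^2) (t := t) fun θ => sq_nonneg _
  have e : ∀ k, (fun t θ => (F k t θ + s * G k t θ)^2) = fun t θ => F k t θ^2 + ((2 * s) * (F k t θ * G k t θ) + s^2 * G k t θ^2) := fun k => by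
    ext; ring
  simp only [e, fun k => EE_add m (hF k).sq.eb ((((hF k).mul (hG k)).cmul (2*s)).add ((hG k).sq.cmul (s^2))).eb, fun k => EE_add m (((hF k).mul (hG k)).cmul (2*s)).eb ((hG k).sq.cmul (s^2)).eb, EE_cmul,
    sum_add_distrib, ← mul_sum] at this
  linarith
lemma EE_jensen {F : ℝ → E n → ℝ} (hF : MP m F) {t : ℝ} (ht : 0 ≤ t) : (EE m F t)^2 ≤ EE m (fun t θ => F t θ^2) t := by
  have := EE_cs m hF (MP.const 1) t
  simpa [EE_const m _ ht] using this
lemma cov_cs {f g : E n → ℝ} (hf : Continuous f) (hg : Continuous g) :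
    (∫ x, f x * g x ∂m - (∫ x, f x ∂m) * ∫ x, g x ∂m)^2 ≤ (∫ x, f x^2 ∂m - (∫ x, f x ∂m)^2) * (∫ x, g x^2 ∂m - (∫ x, g x ∂m)^2) := by
  refine disc fun s => ?_
  have := jensen_sq (μ := m) (f := fun x => f x + s * g x) (int_m m (by fun_prop)) (int_m m (by fun_prop))
  have e : ∀ x, (f x + s * g x)^2 = f x^2 + ((2 * s) * (f x * g x) + s^2 * g x^2) := fun x => by ring
  simp_rw [e] at this
  have i1 := int_m m hf
  have i2 := int_m m hg
  have i3 : Integrable (fun x => f x * g x) m := int_m m (hf.mul hg)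
  have i4 : Integrable (fun x => f x^2) m := int_m m (hf.pow 2)
  have i5 : Integrable (fun x => g x^2) m := int_m m (hg.pow 2)
  rw [integral_add i1 (i2.const_mul s), integral_add i4 (by fun_prop), integral_add (i3.const_mul _) (i5.const_mul _), integral_const_mul, integral_const_mul, integral_const_mul] at this
  nlinarith
def cv (f g : E n → ℝ) (t : ℝ) (θ : E n) : ℝ := Mn m (fun x => f x * g x) t θ - Mn m f t θ * Mn m g t θ
lemma cv_comm (f g : E n → ℝ) (t : ℝ) (θ : E n) : cv m f g t θ = cv m g f t θ := by
  unfold cv; simp only [mul_comm]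
lemma cv_eq (f g : E n → ℝ) (t : ℝ) (θ : E n) : cv m f g t θ = ∫ x, f x * g x ∂(tilt m t θ) - (∫ x, f x ∂(tilt m t θ)) * ∫ x, g x ∂(tilt m t θ) := by
  unfold cv; simp only [tilt_int]
lemma cv_self (f : E n → ℝ) (t : ℝ) (θ : E n) : cv m f f t θ = Mn m (fun x => f x^2) t θ - Mn m f t θ^2 := by
  unfold cv; simp only [sq]
lemma cv_cs {f g : E n → ℝ} (hf : Continuous f) (hg : Continuous g) (t : ℝ) (θ : E n) :
    cv m f g t θ^2 ≤ cv m f f t θ * cv m g g t θ := by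
  have := cov_cs (tilt m t θ) hf hg
  rw [cv_eq, cv_eq, cv_eq]; simpa only [sq] using this
lemma cv_lin {ι : Type*} [Fintype ι] (u : ι → ℝ) {f : ι → E n → ℝ} (hf : ∀ i, Continuous (f i)) {g : E n → ℝ} (hg : Continuous g) (t : ℝ) (θ : E n) :
    cv m (fun x => ∑ k, u k * f k x) g t θ = ∑ k, u k * cv m (f k) g t θ := by
  simp only [cv_eq, sum_mul]
  rw [integral_finsetSum _ fun k _ => int_m _ (by fun_prop), integral_finsetSum _ fun k _ => int_m _ (by fun_prop)]
  simp only [mul_assoc, integral_const_mul, mul_sub, sum_sub_distrib, sum_mul]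
lemma MP.cv {m : Measure (E n)} [CSupp m] {f g : E n → ℝ} (hf : Continuous f) (hg : Continuous g) : MP m (cv m f g) :=
  (MP.mn (hf.mul hg)).sub ((MP.mn hf).mul (MP.mn hg))
variable {m}
lemma cv_le {t : ℝ} (h : LC m t) {s : ℝ} (hs : 0 < t + s) (θ : E n) (u : Fin n → ℝ) :
    cv m (fun x => ∑ k, u k * x k) (fun x => ∑ k, u k * x k) s θ ≤ 1/(t+s) * ∑ k, u k^2 := by
  have := h.poi_Mn hs θ (C11.coord u)
  rw [cv_self]
  refine this.trans (le_of_eq ?_)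
  congr 1
  refine sum_congr rfl fun k _ => ?_
  rw [← tilt_int]; simp
lemma Mn_jensen {f : E n → ℝ} (hf : Continuous f) (t : ℝ) (θ : E n) : Mn m f t θ^2 ≤ Mn m (fun x => f x^2) t θ := by
  have := jensen_sq (μ := tilt m t θ) (int_m _ hf) (int_m _ (hf.pow 2))
  simpa only [tilt_int] using this
lemma ge_lim {a c : ℝ} {F : ℝ → ℝ} {r : ℝ} (h : ∀ T, r ≤ T → a ≤ F T) (hF : Filter.Tendsto F Filter.atTop (nhds c)) : a ≤ c :=
  ge_of_tendsto hF (Filter.eventually_atTop.2 ⟨r, h⟩)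
lemma spec_gap {C : ℝ} (hC0 : 0 ≤ C) (hC : Poi m C) {g : E n → ℝ} (hg : Continuous g) {ρ : ℝ} (hρ : 0 < ρ) :
    (EE m (fun t θ => Mn m g t θ^2) ρ - (∫ x, g x ∂m)^2) * (C + 1/ρ) ≤ C * (∫ x, g x^2 ∂m - (∫ x, g x ∂m)^2) := by
  set a := ∫ x, g x ∂m with ha
  set v : Fin n → ℝ → E n → ℝ := fun k t θ => Mn m (fun x => x k * g x) t θ - av m k t θ * Mn m g t θ
  have hM := Gen.Mn m hg
  have hv : ∀ k, MP m (v k) := fun k => (MP.mn (by fun_prop)).sub ((MP.av k).mul (MP.mn hg))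
  have hMM : MP m (Mn m g) := MP.mn hg
  set R := EE m (fun t θ => Mn m g t θ^2)
  have hgen : Gen m (fun t θ => Mn m g t θ^2) (fun t θ => ∑ k, v k t θ^2) _ :=
    (hM.mul hM).congr (fun t θ => by ring) (fun t θ => by simp [v, sq]) (fun k t θ => rfl)
  have hd : ∀ s, 0 < s → HasDerivAt R (∑ k, EE m (fun t θ => v k t θ^2) s) s := fun s hs => by
    have := hgen.deriv hs
    rwa [EE_sum m _ (fun k => (hv k).sq.eb)] at this
  refine ge_lim (r := ρ) (F := fun T => (∫ x, g x^2 ∂m - a^2) * (C + 1/T)) (fun T hT => ?_) ?_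
  · have h1 : (R ρ - a^2) * (C + 1/ρ) ≤ (R T - a^2) * (C + 1/T) := by
      have hder : ∀ s, 0 < s → HasDerivAt (fun s => (R s - a^2) * (C + 1/s))
          ((∑ k, EE m (fun t θ => v k t θ^2) s) * (C + 1/s) + (R s - a^2) * (-(s^2)⁻¹)) s := fun s hs => by
        have := ((hd s hs).sub_const (a^2)).mul ((hasDerivAt_inv hs.ne').const_add C)
        simp only [one_div]; exact this
      refine mono_of (f := fun s => (R s - a^2) * (C + 1/s)) hT (fun s hs => (hder s (hρ.trans_le hs.1)).continuousAt.continuousWithinAt) (fun s hs => hder s (hρ.trans hs.1)) fun s hs => ?_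
      have hs0 := hρ.trans hs.1
      have := var_EE m hC0 hC hs0.le (F := Mn m g) (d := v) (hM.c11 hv hs0) (hMM.Bd s) (fun k => (hv k).Bd s)
      rw [EE_Mn m hg hs0.le, ← ha] at this
      have e : (∑ k, EE m (fun t θ => v k t θ^2) s) * (C + 1/s) + (R s - a^2) * (-(s^2)⁻¹) =
        ((s^2 * C + s) * (∑ k, EE m (fun t θ => v k t θ^2) s) - (R s - a^2)) / s^2 := by field_simp; ring
      rw [e]
      refine div_nonneg ?_ (by positivity)
      linarith
    refine h1.trans ?_
    have hT0 := hρ.trans_le hT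
    gcongr
    rw [← EE_Mn m (f := fun x => g x^2) (hg.pow 2) hT0.le]
    exact EE_mono m hMM.sq.eb (EB.Mn m (hg.pow 2)) fun θ => Mn_jensen hg T θ
  · have : Filter.Tendsto (fun T : ℝ => (∫ x, g x^2 ∂m - a^2) * (C + 1/T)) Filter.atTop (nhds ((∫ x, g x^2 ∂m - a^2) * (C + 0))) := by
      refine (tendsto_const_nhds.add ?_).const_mul _
      exact tendsto_inv_atTop_zero.congr fun x => by simp
    rwa [add_zero, mul_comm] at this
lemma dual_gap {C : ℝ} (hC0 : 0 ≤ C) (hC : Poi m C) {F : ℝ → E n → ℝ} {ρ : ℝ} (hρ : 0 < ρ) (hF : MP m F) (h0 : EE m F ρ = 0) :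
    (∫ x, Qs ρ (F ρ) x^2 ∂m) * (C + 1/ρ) ≤ C * EE m (fun t θ => F t θ^2) ρ := by
  set φ := Qs ρ (F ρ)
  have hφ : Bd φ := (hF.Bd ρ).Qs ρ
  have a0 : ∫ x, φ x ∂m = 0 := by rw [← EE_Qs m hρ.le (hF.Bd ρ), h0]
  have h1 := spec_gap hC0 hC hφ.cont hρ
  rw [a0] at h1
  have h2 := EE_Qs_Mn m hρ.le (hF.Bd ρ) hφ.cont
  have h3 := EE_cs m hF (MP.mn hφ.cont) ρ
  rw [h2] at h3
  have e : ∫ x, φ x * Qs ρ (F ρ) x ∂m = ∫ x, φ x^2 ∂m := by simp only [φ, sq]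
  rw [e] at h3
  set N := ∫ x, φ x^2 ∂m
  set P := EE m (fun t θ => F t θ^2) ρ
  set Q := EE m (fun t θ => Mn m φ t θ^2) ρ
  have hN : 0 ≤ N := integral_nonneg fun _ => sq_nonneg _
  have hP : 0 ≤ P := EE_nonneg m fun _ => sq_nonneg _
  have hc : 0 < C + 1/ρ := by positivity
  rcases hN.eq_or_lt with h | h
  · rw [← h]; simp; positivity
  · have : N * (N * (C + 1/ρ)) ≤ N * (C * P) := by nlinarith
    exact le_of_mul_le_mul_left this h
end
end SL
end
section
namespace SL
variable {n : ℕ}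
set_option linter.unusedSectionVars false
structure Ext (m : Measure (E n)) (t α lam ε : ℝ) (f : E n → ℝ) (G : Fin n → E n → ℝ) : Prop where
  ht : 0 < t
  lc : LC m t
  hα0 : 0 ≤ α
  hα : ∀ u : Fin n → ℝ, ∫ x, (∑ k, u k * x k)^2 ∂m - (∫ x, ∑ k, u k * x k ∂m)^2 ≤ α * ∑ k, u k^2
  hl : 0 < lam
  poi : Poi m (1/lam)
  hf : C11 f G
  f0 : ∫ x, f x ∂m = 0
  f1 : ∫ x, f x^2 ∂m = 1
  hε : 0 ≤ ε
  en : ∑ k, ∫ x, G k x^2 ∂m ≤ lam + ε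
variable {m : Measure (E n)} [CSupp m] {t α lam ε : ℝ} {f : E n → ℝ} {G : Fin n → E n → ℝ}
lemma Ext.G0 (h : Ext m t α lam ε f G) : ∀ k, Integrable (fun x => G k x^2) m := fun k => int_m m ((h.hf.2.1 k).pow 2)
lemma Ext.var1 (h : Ext m t α lam ε f G) {φ Φ} (hφ : C11 φ Φ) :
    (∑ k, ∫ x, G k x * Φ k x ∂m - lam * ∫ x, f x * φ x ∂m)^2 ≤ ε * ∑ k, ∫ x, Φ k x^2 ∂m := by
  have c1 := h.hf.1
  have c2 := hφ.1
  have c3 := h.hf.2.1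
  have c4 := hφ.2.1
  have hl := h.hl
  have i1 : Integrable (fun x => f x^2) m := int_m m (c1.pow 2)
  have i2 : Integrable (fun x => f x * φ x) m := int_m m (c1.mul c2)
  have i3 : Integrable (fun x => φ x^2) m := int_m m (c2.pow 2)
  have i4 := int_m m c1
  have i5 := int_m m c2
  have j2 : ∀ k, Integrable (fun x => G k x * Φ k x) m := fun k => int_m m ((c3 k).mul (c4 k))
  have j3 : ∀ k, Integrable (fun x => Φ k x^2) m := fun k => int_m m ((c4 k).pow 2)
  refine disc fun s => ?_
  have := h.poi _ _ (h.hf.lin hφ s)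
  have e1 : ∀ x, (f x + s * φ x)^2 = f x^2 + ((2*s) * (f x * φ x) + s^2 * φ x^2) := fun x => by ring
  have e2 : ∀ k x, (G k x + s * Φ k x)^2 = G k x^2 + ((2*s) * (G k x * Φ k x) + s^2 * Φ k x^2) := fun k x => by ring
  simp_rw [e1, e2] at this
  rw [integral_add i1 (by fun_prop), integral_add (i2.const_mul _) (i3.const_mul _), integral_add i4 (i5.const_mul _),
    integral_const_mul, integral_const_mul, integral_const_mul, h.f0, h.f1] at this
  have s2 : ∀ k, ∫ x, (G k x^2 + ((2*s) * (G k x * Φ k x) + s^2 * Φ k x^2)) ∂m =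
      ∫ x, G k x^2 ∂m + (2*s*∫ x, G k x * Φ k x ∂m + s^2*∫ x, Φ k x^2 ∂m) := fun k => by
    have a1 := (j2 k).const_mul (2*s)
    have a2 := (j3 k).const_mul (s^2)
    rw [integral_add (h.G0 k) (by fun_prop), integral_add a1 a2, integral_const_mul, integral_const_mul]
  simp_rw [s2] at this
  rw [sum_add_distrib, sum_add_distrib, ← mul_sum, ← mul_sum] at this
  have jn := jensen_sq i5 i3
  have en := h.en
  rw [one_div, ← div_eq_inv_mul, le_div_iff₀ hl] at this
  have : 0 ≤ (s^2 * lam) * (∫ x, φ x^2 ∂m - (∫ x, φ x ∂m)^2) := mul_nonneg (by positivity) (by linarith)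
  nlinarith
lemma Ext.k0 (h : Ext m t α lam ε f G) : ∑ k, (∫ x, G k x ∂m)^2 ≤ (lam * √α + √ε)^2 := by
  set u : Fin n → ℝ := fun k => ∫ x, G k x ∂m
  set κ := ∑ k, u k^2
  have hκ : 0 ≤ κ := by positivity
  have h1 := h.var1 (C11.coord u)
  have e1 : ∑ k, ∫ x, G k x * u k ∂m = κ := by
    simp only [integral_mul_const, κ, sq, u]
  have e2 : ∑ k, ∫ _, u k^2 ∂m = κ := by simp [κ]
  rw [e1, e2] at h1
  have h2 := cov_cs m h.hf.1 (C11.coord u).1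
  rw [h.f0, h.f1] at h2
  have h3 := h.hα u
  set p := ∫ x, f x * ∑ k, u k * x k ∂m
  have h4 : p^2 ≤ α * κ := by simp only [zero_mul, sub_zero] at h2; nlinarith
  have a1 : |p| ≤ √α * √κ := by rw [← Real.sqrt_mul h.hα0]; exact Real.abs_le_sqrt h4
  have a2 : |κ - lam * p| ≤ √ε * √κ := by rw [← Real.sqrt_mul h.hε]; exact Real.abs_le_sqrt h1
  have a3 : √κ * √κ ≤ √κ * (lam * √α + √ε) := by
    rw [Real.mul_self_sqrt hκ]
    have := (abs_le.1 a2).2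
    have := mul_le_mul_of_nonneg_left ((le_abs_self p).trans a1) h.hl.le
    nlinarith
  have hb : 0 ≤ lam * √α + √ε := by have := h.hl; positivity
  have a4 : √κ ≤ lam * √α + √ε := by
    rcases (sqrt_nonneg κ).eq_or_lt with h0 | h0
    · rw [← h0]; exact hb
    · exact le_of_mul_le_mul_left a3 h0
  calc κ = √κ^2 := (sq_sqrt hκ).symm
    _ ≤ _ := by gcongr
lemma Ext.m0 (h : Ext m t α lam ε f G) {r : ℝ} (hr : 0 < r) :
    (∑ k, EE m (fun t θ => Mn m (G k) t θ^2) r) * (r + lam) ≤ r * (lam + ε) + lam * (lam * √α + √ε)^2 := by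
  have hl := h.hl
  have h1 : ∀ k, EE m (fun t θ => Mn m (G k) t θ^2) r * (r + lam) ≤ r * (∫ x, G k x^2 ∂m) + lam * (∫ x, G k x ∂m)^2 := fun k => by
    have := spec_gap (by positivity) h.poi (h.hf.2.1 k) hr
    have := mul_le_mul_of_nonneg_left this (by positivity : 0 ≤ lam * r)
    have e1 : ∀ z, lam * r * (z * (1/lam + 1/r)) = z * (r + lam) := fun z => by field_simp
    have e2 : ∀ z, lam * r * (1/lam * z) = r * z := fun z => by field_simp
    rw [e1, e2] at this
    linarith
  rw [sum_mul]
  refine (sum_le_sum fun k _ => h1 k).trans ?_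
  rw [sum_add_distrib, ← mul_sum, ← mul_sum]
  gcongr
  exacts [h.en, h.k0]
variable (m f) in
def vv (k : Fin n) : ℝ → E n → ℝ := cv m (fun x => x k) f
lemma vv_mp (hf : Continuous f) (k : Fin n) : MP m (vv m f k) := MP.cv (by fun_prop) hf
lemma vv_gen (hf : Continuous f) : Gen m (Mn m f) (fun _ _ => 0) (vv m f) := Gen.Mn m hf
variable (m) in
def AA (i j : Fin n) : ℝ → E n → ℝ := cv m (fun x => x i) (fun x => x j)
lemma AA_mp (i j : Fin n) : MP m (AA m i j) := MP.cv (by fun_prop) (by fun_prop)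
lemma AA_comm (i j : Fin n) (t θ) : AA m i j t θ = AA m j i t θ := cv_comm _ _ _ _ _
lemma AA_form (u w : Fin n → ℝ) (t : ℝ) (θ : E n) :
    cv m (fun x => ∑ k, u k * x k) (fun x => ∑ k, w k * x k) t θ = ∑ k, u k * ∑ j, w j * AA m k j t θ := by
  rw [cv_lin m u (fun i => by fun_prop) (by fun_prop)]
  refine sum_congr rfl fun k _ => ?_
  rw [cv_comm, cv_lin m w (fun i => by fun_prop) (by fun_prop)]
  simp only [cv_comm, AA]
lemma Ext.R (h : Ext m t α lam ε f G) {r : ℝ} (hr : 0 < r) : 1 - (lam + ε)/(r+t) ≤ EE m (fun t θ => Mn m f t θ^2) r := by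
  have ht := h.ht
  have c := h.hf.1
  have h1 : ∀ θ, Mn m (fun x => f x^2) r θ - 1/(t+r) * ∑ k, Mn m (fun x => G k x^2) r θ ≤ Mn m f r θ^2 := fun θ => by
    have := h.lc.poi_Mn (by positivity : 0 < t + r) θ h.hf
    linarith
  have p1 : MP m (Mn m fun x => f x^2) := MP.mn (c.pow 2)
  have p2 : ∀ k, MP m (Mn m fun x => G k x^2) := fun k => MP.mn ((h.hf.2.1 k).pow 2)
  have h2 := EE_mono m (F := fun s θ => Mn m (fun x => f x^2) s θ - 1/(t+r) * ∑ k, Mn m (fun x => G k x^2) s θ) (G := fun s θ => Mn m f s θ^2) (p1.sub ((MP.sum p2).cmul _)).eb (MP.mn c).sq.eb h1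
  rw [EE_sub m p1.eb ((MP.sum p2).cmul _).eb, EE_cmul, EE_sum m _ fun k => (p2 k).eb, EE_Mn m (f := fun x => f x^2) (c.pow 2) hr.le, h.f1] at h2
  simp_rw [fun k => EE_Mn m (f := fun x => G k x^2) ((h.hf.2.1 k).pow 2) hr.le] at h2
  refine le_trans ?_ h2
  rw [add_comm r t, div_eq_inv_mul, one_div]
  have := mul_le_mul_of_nonneg_left h.en (by positivity : 0 ≤ (t+r)⁻¹)
  linarith
lemma le_of_sq {a b : ℝ} (ha : 0 ≤ a) (hb : 0 ≤ b) (h : a^2 ≤ a * b) : a ≤ b := by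
  rcases ha.eq_or_lt with h0 | h0
  · rwa [← h0]
  · rw [sq] at h; exact le_of_mul_le_mul_left h h0
lemma Ext.Y (h : Ext m t α lam ε f G) {r : ℝ} (hr : 0 < r) : (r+t)^2 * ∑ k, EE m (fun t θ => vv m f k t θ^2) r ≤ lam + ε := by
  have ht := h.ht
  have c := h.hf.1
  have p2 : ∀ k, MP m (Mn m fun x => G k x^2) := fun k => MP.mn ((h.hf.2.1 k).pow 2)
  have p1 : ∀ k, MP m (fun t θ => vv m f k t θ^2) := fun k => (vv_mp c k).sq
  have hp : ∀ θ, (r+t)^2 * ∑ k, vv m f k r θ^2 ≤ ∑ k, Mn m (fun x => G k x^2) r θ := fun θ => by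
    set u : Fin n → ℝ := fun k => vv m f k r θ
    have hg : 0 ≤ ∑ k, Mn m (fun x => G k x^2) r θ := sum_nonneg fun k _ => (sq_nonneg _).trans (Mn_jensen (h.hf.2.1 k) r θ)
    set g := ∑ k, Mn m (fun x => G k x^2) r θ
    have a1 := cv_cs m (f := fun x => ∑ k, u k * x k) (by fun_prop) c r θ
    rw [cv_lin m u (fun i => by fun_prop) c] at a1
    have a2 := cv_le h.lc (by positivity : 0 < t + r) θ u
    have a3 := h.lc.poi_Mn (by positivity : 0 < t + r) θ h.hf
    rw [← cv_self] at a3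
    have e : ∑ k, u k * cv m (fun x => x k) f r θ = ∑ k, u k^2 := sum_congr rfl fun k _ => by rw [sq]; rfl
    rw [e] at a1
    have hu : 0 ≤ ∑ k, u k^2 := by positivity
    set q := ∑ k, u k^2
    have a4 : q^2 ≤ q * (g/(r+t)^2) := by
      refine a1.trans ((mul_le_mul a2 a3 ?_ (by positivity)).trans (le_of_eq ?_))
      · rw [cv_self]; exact sub_nonneg.2 (Mn_jensen c r θ)
      · rw [add_comm t r]; change _ * (_ * g) = _; field_simp
    have := le_of_sq hu (by positivity) a4
    rwa [le_div_iff₀ (by positivity), mul_comm] at this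
  have := EE_mono m (F := fun s θ => (r+t)^2 * ∑ k, vv m f k s θ^2) (G := fun s θ => ∑ k, Mn m (fun x => G k x^2) s θ) ((MP.sum p1).cmul _).eb (MP.sum p2).eb hp
  rw [EE_cmul, EE_sum m _ fun k => (p1 k).eb, EE_sum m _ fun k => (p2 k).eb] at this
  simp_rw [fun k => EE_Mn m (f := fun x => G k x^2) ((h.hf.2.1 k).pow 2) hr.le] at this
  exact this.trans h.en
lemma Ext.kk (h : Ext m t α lam ε f G) {r : ℝ} (hr : 0 < r) :
    ∑ k, (EE m (vv m f k) r)^2 ≤ α * (1 - (2 - r/(r+lam)) * EE m (fun t θ => Mn m f t θ^2) r) := by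
  have hl := h.hl
  have c := h.hf.1
  have hM : MP m (Mn m f) := MP.mn c
  set φ := Qs r (Mn m f r)
  have hφ : Bd φ := (hM.Bd r).Qs r
  have hφc := hφ.cont
  set R := EE m (fun t θ => Mn m f t θ^2) r
  have e0 : EE m (Mn m f) r = 0 := by rw [EE_Mn m c hr.le, h.f0]
  have g1 : (∫ x, φ x^2 ∂m) ≤ r/(r+lam) * R := by
    have := dual_gap (by positivity) h.poi hr hM e0
    have := mul_le_mul_of_nonneg_left this (by positivity : 0 ≤ lam * r)
    have e1 : ∀ z, lam * r * (z * (1/lam + 1/r)) = z * (r + lam) := fun z => by field_simp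
    have e2 : ∀ z, lam * r * (1/lam * z) = r * z := fun z => by field_simp
    rw [e1, e2] at this
    rw [div_mul_eq_mul_div, le_div_iff₀ (by positivity)]; exact this
  have g2 : ∫ x, f x * φ x ∂m = R := by
    rw [← EE_Qs_Mn m hr.le (hM.Bd r) c]; simp only [R, sq]
  have g3 : ∫ x, φ x ∂m = 0 := by rw [← EE_Qs m hr.le (hM.Bd r), e0]
  have i1 : Integrable (fun x => f x^2) m := int_m m (c.pow 2)
  have i2 : Integrable (fun x => f x * φ x) m := int_m m (c.mul hφc)
  have i3 : Integrable (fun x => φ x^2) m := int_m m (hφc.pow 2)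
  have g4 : ∫ x, (f x - φ x)^2 ∂m ≤ 1 - (2 - r/(r+lam)) * R := by
    have e : ∀ x, (f x - φ x)^2 = f x^2 - 2 * (f x * φ x) + φ x^2 := fun x => by ring
    simp_rw [e]
    rw [integral_add (by fun_prop) i3, integral_sub i1 (by fun_prop), integral_const_mul, h.f1, g2]; linarith
  have g0 : ∫ x, (f x - φ x) ∂m = 0 := by rw [integral_sub (int_m m c) (int_m m hφc), h.f0, g3, sub_zero]
  set u : Fin n → ℝ := fun k => EE m (vv m f k) r
  have hu : ∀ k, u k = ∫ x, x k * (f x - φ x) ∂m := fun k => by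
    have cx : Continuous fun x : E n => x k := by fun_prop
    have e : vv m f k = fun t θ => Mn m (fun x => x k * f x) t θ - Mn m f t θ * Mn m (fun x => x k) t θ := by
      ext t θ; unfold vv cv; ring
    simp only [u]
    rw [e, EE_sub m (EB.Mn m (f := fun x => x k * f x) (cx.mul c)) (hM.mul (MP.mn cx)).eb, EE_Mn m (f := fun x => x k * f x) (cx.mul c) hr.le, EE_Qs_Mn m hr.le (hM.Bd r) cx]
    simp_rw [mul_sub]
    exact (integral_sub (int_m m (f := fun x => x k * f x) (cx.mul c)) (int_m m (f := fun x => x k * φ x) (cx.mul hφc))).symm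
  have a1 := cov_cs m (f := fun x => ∑ k, u k * x k) (g := fun x => f x - φ x) (by fun_prop) (by fun_prop)
  have e : ∫ x, (∑ k, u k * x k) * (f x - φ x) ∂m = ∑ k, u k^2 := by
    simp only [sum_mul, mul_assoc]
    rw [integral_finsetSum _ fun k _ => int_m m (by fun_prop)]
    simp only [integral_const_mul, ← hu, sq]
  rw [e, g0] at a1
  simp only [mul_zero, sub_zero, ne_eq, OfNat.ofNat_ne_zero, not_false_eq_true, zero_pow] at a1
  have hp : 0 ≤ ∑ k, u k^2 := by positivity
  have hp2 : 0 ≤ ∫ x, (f x - φ x)^2 ∂m := integral_nonneg fun x => sq_nonneg _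
  have hα0 := h.hα0
  refine le_of_sq hp (mul_nonneg hα0 (hp2.trans g4)) (a1.trans ?_)
  calc _ ≤ (α * ∑ k, u k^2) * (1 - (2 - r/(r+lam)) * R) := mul_le_mul (h.hα u) g4 hp2 (by positivity)
    _ = _ := by ring
end SL
end
section
namespace SL
variable {n : ℕ}
set_option linter.unusedSectionVars false
variable {m : Measure (E n)} [CSupp m] {t α lam ε : ℝ} {f : E n → ℝ} {G : Fin n → E n → ℝ}
lemma cv_gen (m : Measure (E n)) [CSupp m] {f g : E n → ℝ} (hf : Continuous f) (hg : Continuous g) :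
    Gen m (cv m f g) (fun t θ => -∑ k, vv m f k t θ * vv m g k t θ)
      (fun k t θ => vv m (fun x => f x * g x) k t θ - (vv m f k t θ * Mn m g t θ + Mn m f t θ * vv m g k t θ)) :=
  ((vv_gen (f := fun x => f x * g x) (hf.mul hg)).sub ((vv_gen hf).mul (vv_gen hg))).congr (fun _ _ => rfl)
    (fun _ _ => by simp) (fun _ _ _ => rfl)
variable (m f) in
def ww (k j : Fin n) : ℝ → E n → ℝ := fun t θ => vv m (fun x => x k * f x) j t θ - (AA m j k t θ * Mn m f t θ + Mn m (fun x => x k) t θ * vv m f j t θ)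
lemma ww_mp (hf : Continuous f) (k j : Fin n) : MP m (ww m f k j) :=
  (vv_mp (f := fun x => x k * f x) (by fun_prop) j).sub (((AA_mp j k).mul (MP.mn hf)).add ((MP.mn (by fun_prop)).mul (vv_mp hf j)))
variable (m f) in
def Av (k : Fin n) : ℝ → E n → ℝ := fun t θ => ∑ j, AA m j k t θ * vv m f j t θ
lemma Av_mp (hf : Continuous f) (k : Fin n) : MP m (Av m f k) := MP.sum fun j => (AA_mp j k).mul (vv_mp hf j)
lemma vv_gen' (hf : Continuous f) (k : Fin n) : Gen m (vv m f k) (fun t θ => -Av m f k t θ) (ww m f k) :=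
  cv_gen m (f := fun x => x k) (by fun_prop) hf
lemma Av_pt {t : ℝ} (h : LC m t) {s : ℝ} (hs : 0 < t + s) (f : E n → ℝ) (θ : E n) :
    (t+s) * ∑ k, Av m f k s θ^2 ≤ ∑ k, vv m f k s θ * Av m f k s θ := by
  set u : Fin n → ℝ := fun k => Av m f k s θ
  set w : Fin n → ℝ := fun k => vv m f k s θ
  have a1 := cv_cs m (f := fun x => ∑ k, u k * x k) (g := fun x => ∑ k, w k * x k) (by fun_prop) (by fun_prop) s θ
  have a2 := cv_le h hs θ u
  have e : ∀ z : Fin n → ℝ, cv m (fun x => ∑ k, z k * x k) (fun x => ∑ k, w k * x k) s θ = ∑ k, z k * u k := fun z => by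
    rw [AA_form]
    refine sum_congr rfl fun k _ => ?_
    simp only [u, w, Av]
    congr 1
    exact sum_congr rfl fun j _ => by rw [AA_comm]; ring
  rw [e u, e w] at a1
  have h0 : 0 ≤ ∑ k, w k * u k := by rw [← e w, cv_self]; exact sub_nonneg.2 (Mn_jensen (by fun_prop) s θ)
  have e2 : ∑ k, u k * u k = ∑ k, u k^2 := by simp only [sq]
  rw [e2] at a1
  have hu : 0 ≤ ∑ k, u k^2 := by positivity
  have := le_of_sq (b := (∑ k, w k * u k)/(t+s)) hu (by positivity) (a1.trans ((mul_le_mul_of_nonneg_right a2 h0).trans (le_of_eq (by field_simp))))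
  rwa [le_div_iff₀ hs, mul_comm] at this
variable (m f) in
def YY (r : ℝ) : ℝ := ∑ k, EE m (fun t θ => vv m f k t θ^2) r
variable (m f) in
def KK (r : ℝ) : ℝ := ∑ k, (EE m (vv m f k) r)^2
lemma Ext.psi (h : Ext m t α lam ε f G) {r : ℝ} (hr : lam ≤ r) :
    (r+t)^2 * (YY m f r * (1/lam + 1/r) - (2/r) * KK m f r) ≤ (lam + ε) * (1/lam) := by
  have ht := h.ht
  have hl := h.hl
  have hr0 := hl.trans_le hr
  have c := h.hf.1
  set C := 1/lam
  have hC0 : 0 < C := by positivity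
  have hv := vv_mp (m := m) c
  have hA := Av_mp (m := m) c
  have hw := ww_mp (m := m) c
  set B : ℝ → ℝ := fun r => ∑ k, EE m (fun t θ => vv m f k t θ * Av m f k t θ) r
  set b : Fin n → ℝ → ℝ := fun k => EE m (Av m f k)
  set kk : Fin n → ℝ → ℝ := fun k => EE m (vv m f k)
  set Wd : ℝ → ℝ := fun r => ∑ k, ∑ j, EE m (fun t θ => ww m f k j t θ^2) r
  have dY : ∀ s, 0 < s → HasDerivAt (YY m f) (-2 * B s + Wd s) s := fun s hs => by
    have := HasDerivAt.fun_sum fun k (_ : k ∈ Finset.univ) => (((vv_gen' (m := m) c k).mul (vv_gen' c k)).congr (F' := fun t θ => vv m f k t θ^2)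
      (l' := fun t θ => (-2) * (vv m f k t θ * Av m f k t θ) + ∑ j, ww m f k j t θ^2) (fun _ _ => by ring) (fun _ _ => by simp only [sq]; ring) (fun _ _ _ => rfl)).deriv hs
    refine this.congr_deriv ?_
    simp only [fun k => EE_add m (((hv k).mul (hA k)).cmul (-2)).eb (MP.sum (s := Finset.univ) fun j => (hw k j).sq).eb, fun k => EE_sum m Finset.univ fun j => (hw k j).sq.eb, EE_cmul, sum_add_distrib, ← mul_sum, B, Wd]
  have dk : ∀ s, 0 < s → HasDerivAt (KK m f) (∑ k, 2 * kk k s * (-b k s)) s := fun s hs => by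
    refine HasDerivAt.fun_sum fun k _ => ?_
    have := ((vv_gen' (m := m) c k).deriv hs).pow 2
    refine this.congr_deriv ?_
    have e := EE_cmul m (Av m f k) (-1) s
    simp only [neg_one_mul] at e
    simp only [e, b, kk]; norm_num
  refine ge_lim (r := r) (F := fun T => (lam + ε) * (C + 1/T)) (fun T hT => ?_) ?_
  · have h1 : (r+t)^2 * (YY m f r * (C + 1/r) - (2/r) * KK m f r) ≤ (T+t)^2 * (YY m f T * (C + 1/T) - (2/T) * KK m f T) := by
      have hder : ∀ s, 0 < s → HasDerivAt (fun s => (s+t)^2 * (YY m f s * (C + 1/s) - (2/s) * KK m f s))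
          ((2*(s+t)) * (YY m f s * (C + 1/s) - (2/s) * KK m f s) + (s+t)^2 * (((-2 * B s + Wd s) * (C + 1/s) + YY m f s * (-(s^2)⁻¹)) - ((2 * (-(s^2)⁻¹)) * KK m f s + (2/s) * ∑ k, 2 * kk k s * (-b k s)))) s := fun s hs => by
        have i1 : HasDerivAt (fun s => (s+t)^2) (2*(s+t)) s := by
          have := ((hasDerivAt_id s).add_const t).pow 2
          refine this.congr_deriv ?_
          simp
        have := i1.mul (((dY s hs).mul ((hasDerivAt_inv hs.ne').const_add C)).sub ((((hasDerivAt_inv hs.ne').const_mul 2)).mul (dk s hs)))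
        simp only [div_eq_mul_inv, one_mul]; exact this
      refine mono_of (f := fun s => (s+t)^2 * (YY m f s * (C + 1/s) - (2/s) * KK m f s)) hT (fun s hs => (hder s (hr0.trans_le hs.1)).continuousAt.continuousWithinAt) (fun s hs => hder s (hr0.trans hs.1)) fun s hs => ?_
      have hs0 := hr0.trans hs.1
      have k1 : YY m f s - KK m f s ≤ (s^2 * C + s) * Wd s := by
        have := sum_le_sum fun k (_ : k ∈ Finset.univ) => var_EE m hC0.le h.poi hs0.le (F := vv m f k) (d := ww m f k) ((vv_gen' c k).c11 (hw k) hs0) ((hv k).Bd s) (fun j => (hw k j).Bd s)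
        rwa [sum_sub_distrib, ← mul_sum] at this
      set q : Fin n → ℝ := fun k => kk k s - (s+t) * b k s
      have k2 : ∑ k, q k^2 ≤ YY m f s - (s+t) * B s := by
        have hq : ∀ k, MP m (fun t' θ => vv m f k t' θ - (s+t) * Av m f k t' θ) := fun k => (hv k).sub ((hA k).cmul _)
        have e1 : ∀ k, q k = EE m (fun t' θ => vv m f k t' θ - (s+t) * Av m f k t' θ) s := fun k => by
          rw [EE_sub m (hv k).eb ((hA k).cmul _).eb, EE_cmul]
        simp only [e1]
        refine (sum_le_sum fun k _ => EE_jensen m (hq k) hs0.le).trans ?_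
        rw [← EE_sum m _ fun k => (hq k).sq.eb]
        have e2 : YY m f s - (s+t) * B s = EE m (fun t' θ => ∑ k, (vv m f k t' θ^2 - (s+t) * (vv m f k t' θ * Av m f k t' θ))) s := by
          rw [EE_sum m _ fun k => ((hv k).sq.sub (((hv k).mul (hA k)).cmul _)).eb]
          simp only [fun k => EE_sub m (hv k).sq.eb (((hv k).mul (hA k)).cmul (s+t)).eb, EE_cmul, sum_sub_distrib, ← mul_sum, YY, B]
        rw [e2]
        refine EE_mono m (MP.sum fun k => (hq k).sq).eb (MP.sum fun k => ((hv k).sq.sub (((hv k).mul (hA k)).cmul _))).eb fun θ => ?_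
        have := mul_le_mul_of_nonneg_left (Av_pt h.lc (by positivity : 0 < t + s) f θ) (by positivity : 0 ≤ s + t)
        rw [← sub_nonneg] at this ⊢
        refine this.trans (le_of_eq ?_)
        simp only [mul_sum, ← sum_sub_distrib]
        exact sum_congr rfl fun k _ => by ring
      have k3 : 0 ≤ 4 * ∑ k, q k^2 - 4 * (KK m f s - (s+t) * ∑ k, kk k s * b k s) + KK m f s := by
        have : 0 ≤ ∑ k, (2 * q k - kk k s)^2 := by positivity
        refine this.trans (le_of_eq ?_)
        simp only [KK, mul_sum, ← sum_sub_distrib, ← sum_add_distrib]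
        exact sum_congr rfl fun k _ => by simp only [q, kk]; ring
      have e3 : ∑ k, 2 * kk k s * (-b k s) = -2 * ∑ k, kk k s * b k s := by
        rw [mul_sum]; exact sum_congr rfl fun k _ => by ring
      rw [e3]
      have hK : 0 ≤ KK m f s := by unfold KK; positivity
      have hQ : 0 ≤ ∑ k, q k^2 := by positivity
      generalize KK m f s = κ at *
      generalize YY m f s = Y at *
      generalize Wd s = W at *
      generalize B s = Bs at *
      generalize ∑ k, kk k s * b k s = P at *
      generalize ∑ k, q k^2 = Q at *
      have hCs : 1/s ≤ C := one_div_le_one_div_of_le hl (hr.trans hs.1.le)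
      obtain ⟨δ, hδ, hCe⟩ : ∃ δ, 0 ≤ δ ∧ C = 1/s + δ := ⟨C - 1/s, by linarith, by ring⟩
      rw [hCe] at k1 ⊢
      have x1 : 0 ≤ (s+t)^2/s^2 * ((s^2 * (1/s + δ) + s) * W - (Y - κ)) := mul_nonneg (by positivity) (by linarith)
      have x2 : 0 ≤ 2 * (s+t) * (1/s+δ+1/s) * (Y - (s+t) * Bs - Q) := mul_nonneg (by positivity) (by linarith)
      have x3 : 0 ≤ 2 * (s+t) * δ * Q := by positivity
      have x4 := mul_nonneg (by positivity : 0 ≤ (s+t)/s) k3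
      have x5 : 0 ≤ (s+t)*t/s^2 * κ := by positivity
      refine (add_nonneg (add_nonneg (add_nonneg (add_nonneg x1 x2) x3) x4) x5).trans (le_of_eq ?_)
      field_simp
      ring
    refine h1.trans ?_
    have hT0 := hr0.trans_le hT
    have hK : 0 ≤ KK m f T := by unfold KK; positivity
    have := mul_le_mul_of_nonneg_right (h.Y hT0) (by positivity : 0 ≤ C + 1/T)
    have h0 : 0 ≤ (T+t)^2 * (2/T * KK m f T) := by positivity
    unfold YY at *
    linarith
  · have : Filter.Tendsto (fun T : ℝ => (lam + ε) * (C + 1/T)) Filter.atTop (nhds ((lam + ε) * (C + 0))) := by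
      refine (tendsto_const_nhds.add ?_).const_mul _
      exact tendsto_inv_atTop_zero.congr fun x => by simp
    rwa [add_zero] at this
lemma Ext.c5 (h : Ext m t α lam ε f G) {r : ℝ} (hr : 0 < r) :
    lam * EE m (fun t θ => Mn m f t θ^2) r ≤ r * √(YY m f r) * (√(∑ k, EE m (fun t θ => Mn m (G k) t θ^2) r) + √ε) := by
  have c := h.hf.1
  have hM : MP m (Mn m f) := MP.mn c
  have hv := vv_mp (m := m) c
  have hg : ∀ k, MP m (Mn m (G k)) := fun k => MP.mn (h.hf.2.1 k)
  have h1 := h.var1 (((vv_gen c).c11 hv hr).Qs (hM.Bd r) (fun k => (hv k).Bd r) (ρ := r))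
  have g2 : ∫ x, f x * Qs r (Mn m f r) x ∂m = EE m (fun t θ => Mn m f t θ^2) r := by
    rw [← EE_Qs_Mn m hr.le (hM.Bd r) c]; simp only [sq]
  have g3 : ∀ k, ∫ x, G k x * (r * Qs r (vv m f k r) x) ∂m = r * EE m (fun t θ => vv m f k t θ * Mn m (G k) t θ) r := fun k => by
    rw [EE_Qs_Mn m hr.le ((hv k).Bd r) (h.hf.2.1 k), ← integral_const_mul]
    exact integral_congr_ae (.of_forall fun x => by ring)
  have g4 : ∑ k, ∫ x, (r * Qs r (vv m f k r) x)^2 ∂m ≤ r^2 * YY m f r := by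
    unfold YY
    rw [mul_sum]
    refine sum_le_sum fun k _ => ?_
    rw [EE_Qs m (F := fun t θ => vv m f k t θ^2) hr.le ((hv k).Bd r).sq, ← integral_const_mul]
    have b1 := ((hv k).Bd r).Qs r
    have b2 := ((hv k).Bd r).sq.Qs r
    refine integral_mono (int_m m ((b1.cmul r).cont.pow 2)) (int_m m (b2.cmul (r^2)).cont) fun x => ?_
    simp only [mul_pow]
    exact mul_le_mul_of_nonneg_left (Qs_sq ((hv k).Bd r) r x) (by positivity)
  have g5 := EE_css m hv hg r
  change _ ≤ YY m f r * _ at g5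
  simp only [g2, g3, ← mul_sum] at h1
  set Y := YY m f r
  have hY : 0 ≤ Y := sum_nonneg fun k _ => EE_nonneg m fun _ => sq_nonneg _
  set P := ∑ k, EE m (fun t θ => vv m f k t θ * Mn m (G k) t θ) r
  set m0 := ∑ k, EE m (fun t θ => Mn m (G k) t θ^2) r
  set R := EE m (fun t θ => Mn m f t θ^2) r
  have a1 : |P| ≤ √Y * √m0 := by rw [← Real.sqrt_mul hY]; exact Real.abs_le_sqrt g5
  have a2 : |r * P - lam * R| ≤ √ε * (r * √Y) := by
    have e : √ε * (r * √Y) = √(ε * (r^2 * Y)) := by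
      rw [Real.sqrt_mul h.hε, Real.sqrt_mul (by positivity), sqrt_sq hr.le]
    rw [e]
    exact Real.abs_le_sqrt (h1.trans (mul_le_mul_of_nonneg_left g4 h.hε))
  have := (abs_le.1 a2).1
  have := mul_le_mul_of_nonneg_left ((le_abs_self P).trans a1) hr.le
  linarith
lemma elim (hl : 0 < lam) (ht : 0 < t) (htl : t ≤ lam) (hα : 0 ≤ α) (H : ∀ ε > 0, ∃ f G, Ext m t α lam ε f G) : t ≤ 5/2 * α * lam^2 := by
  have key : ∀ r, lam ≤ r → t * r ≤ lam^2 + 5/2 * α * lam^2 * r := fun r hr => by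
    have hr0 := hl.trans_le hr
    set Yb : ℝ → ℝ := fun ε => ((lam + ε) * (1/lam) / (r+t)^2 + (2/r) * (α * (1 - (2 - r/(r+lam)) * (1 - (lam + ε)/(r+t)))))/(1/lam + 1/r)
    set mb : ℝ → ℝ := fun ε => (r * (lam + ε) + lam * (lam * √α + √ε)^2)/(r+lam)
    have h1 : ∀ ε ∈ Ioi (0:ℝ), lam * (1 - (lam + ε)/(r+t)) ≤ r * √(Yb ε) * (√(mb ε) + √ε) := fun ε hε => by
      obtain ⟨f, G, h⟩ := H ε hε
      have a1 := h.R hr0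
      have a2 := h.kk hr0
      have a3 := h.psi hr
      have a4 := h.m0 hr0
      rw [← le_div_iff₀ (by positivity)] at a4
      have a5 : YY m f r ≤ Yb ε := by
        rw [le_div_iff₀ (by positivity)]
        rw [← le_div_iff₀' (by positivity)] at a3
        have hb : 0 ≤ 2 - r/(r+lam) := by
          have : r/(r+lam) ≤ 1 := (div_le_one (by positivity)).2 (by linarith)
          linarith
        have : KK m f r ≤ α * (1 - (2 - r/(r+lam)) * (1 - (lam + ε)/(r+t))) := a2.trans (by gcongr)
        have := mul_le_mul_of_nonneg_left this (by positivity : 0 ≤ 2/r)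
        linarith
      exact (mul_le_mul_of_nonneg_left a1 hl.le).trans ((h.c5 hr0).trans (by gcongr))
    have h2 : lam * (1 - (lam + 0)/(r+t)) ≤ r * √(Yb 0) * (√(mb 0) + √0) := by
      refine le_of_tendsto_of_tendsto (b := nhdsWithin 0 (Ioi 0)) (f := fun ε => lam * (1 - (lam + ε)/(r+t))) (g := fun ε => r * √(Yb ε) * (√(mb ε) + √ε)) ?_ ?_ (eventually_nhdsWithin_of_forall h1)
      · exact ((by fun_prop : Continuous fun ε => lam * (1 - (lam + ε)/(r+t))).tendsto 0).mono_left nhdsWithin_le_nhds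
      · exact ((by fun_prop : Continuous fun ε => r * √(Yb ε) * (√(mb ε) + √ε)).tendsto 0).mono_left nhdsWithin_le_nhds
    have e1 : mb 0 = lam * (r + α * lam^2)/(r+lam) := by
      simp only [mb, Real.sqrt_zero, add_zero, mul_pow, sq_sqrt hα]; ring
    have e2 : Yb 0 ≤ lam * (r + 4 * α * lam^2) / ((r+lam)*(r+t)^2) := by
      have : Yb 0 = lam * (r * (r + lam) + 2 * α * lam * (2 * lam - t) * (r+t)) / ((r+lam)^2*(r+t)^2) := by
        simp only [Yb, add_zero]; field_simp; ring
      rw [this, div_le_div_iff₀ (by positivity) (by positivity)]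
      have : r * (r + lam) + 2 * α * lam * (2 * lam - t) * (r+t) ≤ (r + 4 * α * lam^2) * (r+lam) := by
        have : (2 * lam - t) * (r+t) ≤ 2 * lam * (r + lam) := by nlinarith
        have := mul_le_mul_of_nonneg_left this (by positivity : 0 ≤ 2 * α * lam)
        linarith
      have := mul_le_mul_of_nonneg_left this (by positivity : 0 ≤ lam * ((r+lam)*(r+t)^2))
      linarith
    have h3 : lam * (1 - lam/(r+t)) ≤ r * (lam * (r + 5/2 * α * lam^2) / ((r+lam) * (r+t))) := by
      rw [Real.sqrt_zero, add_zero, add_zero, mul_assoc, ← Real.sqrt_mul' _ (by rw [e1]; positivity)] at h2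
      refine h2.trans (mul_le_mul_of_nonneg_left (Real.sqrt_le_iff.2 ⟨by positivity, ?_⟩) hr0.le)
      refine (mul_le_mul_of_nonneg_right e2 (by rw [e1]; positivity)).trans ?_
      rw [e1, div_mul_div_comm, div_pow, div_le_div_iff₀ (by positivity) (by positivity)]
      have : (r + 4 * α * lam^2) * (r + α * lam^2) ≤ (r + 5/2 * α * lam^2)^2 := by nlinarith [sq_nonneg (α * lam^2)]
      have := mul_le_mul_of_nonneg_left this (by positivity : 0 ≤ lam^2 * ((r+lam) * (r+t))^2)
      linarith
    rw [← mul_div_assoc, le_div_iff₀ (by positivity)] at h3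
    have e3 : lam * (1 - lam/(r+t)) * ((r+lam)*(r+t)) = lam * ((r + t - lam) * (r + lam)) := by field_simp
    rw [e3] at h3
    have := le_of_mul_le_mul_left (h3.trans (le_of_eq (by ring : _ = lam * (r * (r + 5/2 * α * lam^2))))) hl
    nlinarith
  by_contra hc
  push Not at hc
  set δ := t - 5/2 * α * lam^2
  have hδ : 0 < δ := by simp only [δ]; linarith
  have := key (max lam ((lam^2+1)/δ)) (le_max_left _ _)
  have h2 : lam^2 + 1 ≤ max lam ((lam^2+1)/δ) * δ := by rw [← div_le_iff₀ hδ]; exact le_max_right _ _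
  simp only [δ] at h2 this
  nlinarith
lemma ilich (ht : 0 < t) (h : LC m t) (hα0 : 0 ≤ α)
    (hα : ∀ u : Fin n → ℝ, ∫ x, (∑ k, u k * x k)^2 ∂m - (∫ x, ∑ k, u k * x k ∂m)^2 ≤ α * ∑ k, u k^2) :
    ∃ C, 0 ≤ C ∧ Poi m C ∧ t * C^2 ≤ 5/2 * α := by
  set S := {C : ℝ | 0 ≤ C ∧ Poi m C}
  have hb : BddBelow S := ⟨0, fun C hC => hC.1⟩
  have hin : 1/t ∈ S := ⟨by positivity, h.poi ht⟩
  have hcl : IsClosed S := by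
    have : S = Ici 0 ∩ ⋂ (f : E n → ℝ) (G : Fin n → E n → ℝ) (_ : C11 f G), {C : ℝ | ∫ x, f x^2 ∂m - (∫ x, f x ∂m)^2 ≤ C * ∑ k, ∫ x, G k x^2 ∂m} := by
      ext C; simp only [S, mem_inter_iff, mem_iInter]; rfl
    rw [this]
    exact isClosed_Ici.inter (isClosed_iInter fun f => isClosed_iInter fun G => isClosed_iInter fun _ => isClosed_le (by fun_prop) (by fun_prop))
  set C := sInf S
  obtain ⟨hC0, hC⟩ : C ∈ S := hcl.csInf_mem ⟨_, hin⟩ hb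
  refine ⟨C, hC0, hC, ?_⟩
  rcases hC0.eq_or_lt with h0 | h0
  · rw [← h0]; simp; positivity
  have hCt : C ≤ 1/t := csInf_le hb hin
  have := elim (m := m) (lam := 1/C) (t := t) (α := α) (by positivity) ht ((le_div_iff₀ h0).2 (by rw [le_div_iff₀ ht] at hCt; linarith)) hα0 fun ε hε => ?_
  · rw [one_div, inv_pow, ← div_eq_mul_inv, le_div_iff₀ (by positivity)] at this; exact this
  · set C' := 1/(1/C + ε)
    have hC'0 : 0 < C' := by positivity
    have hlt : C' < C := by
      rw [div_lt_iff₀ (by positivity)]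
      have : C * (1/C + ε) = 1 + C * ε := by field_simp
      rw [this]; nlinarith
    have hn : ¬ Poi m C' := fun hh => absurd (csInf_le hb ⟨hC'0.le, hh⟩) (not_le.2 hlt)
    unfold Poi at hn
    push Not at hn
    obtain ⟨f, G, hf, hv⟩ := hn
    have c := hf.1
    set a := ∫ x, f x ∂m
    set V := ∫ x, f x^2 ∂m - a^2
    have hG : 0 ≤ ∑ k, ∫ x, G k x^2 ∂m := sum_nonneg fun k _ => integral_nonneg fun x => sq_nonneg _
    have hV : 0 < V := lt_of_le_of_lt (by positivity) hv
    have hV' : (1/√V)^2 = V⁻¹ := by rw [div_pow, sq_sqrt hV.le, one_pow, one_div]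
    set q := 1/√V
    have i1 : Integrable (fun x => f x^2) m := int_m m (c.pow 2)
    have i2 := int_m m c
    refine ⟨_, _, ht, h, hα0, hα, by positivity, by rwa [one_div_one_div], (C11.const (-(q * a))).lin hf q, ?_, ?_, hε.le, ?_⟩
    · rw [integral_add (by fun_prop) (by fun_prop), integral_const_mul]; simp [a]
    · have e : ∀ x, (-(q*a) + q * f x)^2 = q^2 * f x^2 - (2 * q^2 * a) * f x + (q*a)^2 := fun x => by ring
      simp_rw [e]
      rw [integral_add (by fun_prop) (by fun_prop), integral_sub (by fun_prop) (by fun_prop), integral_const_mul, integral_const_mul]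
      simp only [integral_const, probReal_univ, smul_eq_mul, one_mul]
      change q^2 * _ - 2 * q^2 * a * a + (q*a)^2 = 1
      have : q^2 * V = 1 := by rw [hV', inv_mul_cancel₀ hV.ne']
      simp only [V] at this
      linarith
    · simp only [zero_add, mul_pow, integral_const_mul, ← mul_sum, hV']
      have : C' * (1/C+ε) = 1 := by simp only [C']; field_simp
      rw [inv_mul_le_iff₀ hV]
      have : (∑ k, ∫ x, G k x^2 ∂m) = (C' * ∑ k, ∫ x, G k x^2 ∂m) * (1/C+ε) := by rw [mul_right_comm, this, one_mul]
      rw [this]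
      exact mul_le_mul_of_nonneg_right hv.le (by positivity)
end SL
end
section
namespace SL
variable {n : ℕ}
set_option linter.unusedSectionVars false
abbrev Mx (n : ℕ) := Matrix (Fin n) (Fin n) ℝ
lemma spec {N : Mx n} (hN : N.transpose = N) : ∃ (l : Fin n → ℝ) (U : Mx n), U.transpose * U = 1 ∧ U * U.transpose = 1 ∧
    ∀ x : ℕ, N^x = U * Matrix.diagonal (fun i => l i^x) * U.transpose := by
  have hH : N.IsHermitian := by rw [Matrix.IsHermitian, Matrix.conjTranspose_eq_transpose_of_trivial, hN]
  have h1 := hH.spectral_theorem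
  set U : Mx n := hH.eigenvectorUnitary.1
  have u1 : U.transpose * U = 1 := by
    have := (Matrix.mem_unitaryGroup_iff').1 hH.eigenvectorUnitary.2
    rwa [Matrix.star_eq_conjTranspose, Matrix.conjTranspose_eq_transpose_of_trivial] at this
  have u2 : U * U.transpose = 1 := mul_eq_one_comm.1 u1
  have h2 : N = U * Matrix.diagonal hH.eigenvalues * U.transpose := by
    rw [Unitary.conjStarAlgAut_apply] at h1
    rw [Matrix.star_eq_conjTranspose, Matrix.conjTranspose_eq_transpose_of_trivial] at h1
    exact h1
  clear_value U
  generalize hH.eigenvalues = l at h2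
  refine ⟨l, U, u1, u2, fun x => ?_⟩
  induction x with
  | zero => simp [u2]
  | succ x ih =>
    rw [pow_succ, ih]
    conv_lhs => rw [h2]
    have : (Matrix.diagonal fun i => l i^(x+1)) = Matrix.diagonal (fun i => l i^x) * Matrix.diagonal l := by
      rw [Matrix.diagonal_mul_diagonal]; simp only [pow_succ]
    rw [this]
    simp only [Matrix.mul_assoc]
    rw [← Matrix.mul_assoc U.transpose U, u1, Matrix.one_mul]
lemma tr_pow {N U : Mx n} {l : Fin n → ℝ} (u1 : U.transpose * U = 1) (h : ∀ x : ℕ, N^x = U * Matrix.diagonal (fun i => l i^x) * U.transpose) (x : ℕ) :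
    (N^x).trace = ∑ i, l i^x := by
  rw [h, Matrix.trace_mul_comm, ← Matrix.mul_assoc, u1, Matrix.one_mul, Matrix.trace_diagonal]
lemma tr_NTNT {N T : Mx n} (hN : N.transpose = N) (hT : T.transpose = T) {x y z : ℕ} (hz : x + y = 2 * z) :
    |(N^x * T * N^y * T).trace| ≤ 2 * (N^(2*z) * T * T).trace := by
  obtain ⟨l, U, u1, u2, h⟩ := spec hN
  set T' := U.transpose * T * U
  have hT' : ∀ i j, T' i j = T' j i := fun i j => by
    have : T'.transpose = T' := by simp [T', Matrix.transpose_mul, hT, Matrix.mul_assoc]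
    exact congrFun (congrFun this.symm i) j
  have key : ∀ x y : ℕ, (N^x * T * N^y * T).trace = ∑ i, ∑ j, l i^x * l j^y * T' i j^2 := fun x y => by
    have e : (N^x * T * N^y * T).trace = (Matrix.diagonal (fun i => l i^x) * T' * (Matrix.diagonal (fun i => l i^y) * T')).trace := by
      rw [h x, h y]
      rw [show U * Matrix.diagonal (fun i => l i^x) * U.transpose * T * (U * Matrix.diagonal (fun i => l i^y) * U.transpose) * T
        = U * (Matrix.diagonal (fun i => l i^x) * U.transpose * T * U * Matrix.diagonal (fun i => l i^y) * U.transpose * T) by simp only [Matrix.mul_assoc], Matrix.trace_mul_comm]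
      simp only [T', Matrix.mul_assoc]
    rw [e, Matrix.trace]
    refine sum_congr rfl fun i _ => ?_
    rw [Matrix.diag_apply, Matrix.mul_apply]
    refine sum_congr rfl fun j _ => ?_
    rw [Matrix.diagonal_mul, Matrix.diagonal_mul, hT' j i]; ring
  have k2 := key (2*z) 0
  have e3 : ∑ i, ∑ j, l j^(2*z) * T' i j^2 = (N^(2*z) * T * T).trace := by
    rw [pow_zero, Matrix.mul_one] at k2
    rw [k2, sum_comm]
    exact sum_congr rfl fun i _ => sum_congr rfl fun j _ => by rw [hT' j i]; ring
  rw [pow_zero, Matrix.mul_one] at k2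
  rw [key, two_mul]
  nth_rewrite 1 [← e3]
  rw [k2, ← sum_add_distrib]
  refine (Finset.abs_sum_le_sum_abs _ _).trans (sum_le_sum fun i _ => ?_)
  rw [← sum_add_distrib]
  refine (Finset.abs_sum_le_sum_abs _ _).trans (sum_le_sum fun j _ => ?_)
  rw [abs_mul, abs_mul, abs_pow, abs_pow, abs_of_nonneg (sq_nonneg (T' i j)), pow_zero, mul_one, ← add_mul]
  gcongr
  have p : ∀ w : ℝ, w^(2*z) = |w|^(2*z) := fun w => by rw [pow_mul, pow_mul, sq_abs]
  rw [p (l i), p (l j)]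
  rcases le_total |l i| |l j| with hh | hh
  · have : |l i|^x * |l j|^y ≤ |l j|^(2*z) := by rw [← hz, pow_add]; gcongr
    have : 0 ≤ |l i|^(2*z) := by positivity
    linarith
  · have : |l i|^x * |l j|^y ≤ |l i|^(2*z) := by rw [← hz, pow_add]; gcongr
    have : 0 ≤ |l j|^(2*z) := by positivity
    linarith
def Dp (N T : Mx n) : ℕ → Mx n
  | 0 => 0
  | j+1 => Dp N T j * N + N^j * T
def Lp (N L : Mx n) (T : Fin n → Mx n) : ℕ → Mx n
  | 0 => 0
  | j+1 => Lp N L T j * N + N^j * L + ∑ k, Dp N (T k) j * T k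
lemma tr_Dp {N T : Mx n} (hN : N.transpose = N) (hT : T.transpose = T) (z j : ℕ) : ∀ x y, x + y + j = 2 * z + 1 →
    (N^x * Dp N T j * N^y * T).trace ≤ j * (2 * (N^(2*z) * T * T).trace) := by
  induction j with
  | zero => intro x y _; simp [Dp]
  | succ j ih =>
    intro x y h
    have e : N^x * Dp N T (j+1) * N^y * T = N^x * Dp N T j * N^(y+1) * T + N^(x+j) * T * N^y * T := by
      rw [Dp, pow_succ' N y, pow_add]; noncomm_ring
    rw [e, Matrix.trace_add]
    have a1 := ih x (y+1) (by omega)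
    have a2 := le_of_abs_le (tr_NTNT hN hT (x := x + j) (y := y) (z := z) (by omega))
    push_cast; linarith
lemma tr_Lp {N L : Mx n} {T : Fin n → Mx n} (hN : N.transpose = N) (hT : ∀ k, (T k).transpose = T k) (z j : ℕ) : ∀ x, j + x = 2 * z + 2 →
    (Lp N L T j * N^x).trace ≤ j * ((N^(2*z+1) * L).trace + (2*z+2) * (2 * ∑ k, (N^(2*z) * T k * T k).trace)) := by
  induction j with
  | zero => intro x _; simp [Lp]
  | succ j ih =>
    intro x h
    have e : (Lp N L T (j+1) * N^x).trace = (Lp N L T j * N^(x+1)).trace + (N^(2*z+1) * L).trace + ∑ k, (N^x * Dp N (T k) j * N^0 * T k).trace := by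
      rw [Lp, pow_succ' N x, add_mul, add_mul, Matrix.trace_add, Matrix.trace_add, sum_mul, Matrix.trace_sum, Matrix.mul_assoc, Matrix.trace_mul_comm (N^j * L), ← Matrix.mul_assoc (N^x), ← pow_add]
      congr 2
      · rw [show x + j = 2*z+1 by omega]
      · ext k; rw [Matrix.trace_mul_comm, pow_zero, Matrix.mul_one, Matrix.mul_assoc]
    rw [e]
    have a1 := ih (x+1) (by omega)
    have a2 : ∑ k, (N^x * Dp N (T k) j * N^0 * T k).trace ≤ (2*z+2) * (2 * ∑ k, (N^(2*z) * T k * T k).trace) := by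
      rw [mul_sum, mul_sum]
      refine sum_le_sum fun k _ => (tr_Dp hN (hT k) z j x 0 (by omega)).trans ?_
      have : 0 ≤ 2 * (N^(2*z) * T k * T k).trace := (abs_nonneg _).trans (tr_NTNT hN (hT k) (x := 2*z) (y := 0) rfl)
      gcongr
      have : j ≤ 2 * z + 2 := by omega
      exact_mod_cast this
    push_cast; linarith
section
variable {m : Measure (E n)} [CSupp m]
def GM (m : Measure (E n)) (F L : ℝ → E n → Mx n) (D : Fin n → ℝ → E n → Mx n) : Prop :=
  ∀ i j, Gen m (fun t θ => F t θ i j) (fun t θ => L t θ i j) (fun k t θ => D k t θ i j)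
lemma GM.mul {F L F' L'} {D D' : Fin n → ℝ → E n → Mx n} (h : GM m F L D) (h' : GM m F' L' D') :
    GM m (fun t θ => F t θ * F' t θ) (fun t θ => L t θ * F' t θ + F t θ * L' t θ + ∑ k, D k t θ * D' k t θ)
      (fun k t θ => D k t θ * F' t θ + F t θ * D' k t θ) := fun i j => by
  refine (Gen.sum Finset.univ fun x => (h i x).mul (h' x j)).congr (fun t θ => ?_) (fun t θ => ?_) (fun k t θ => ?_)
  · exact (Matrix.mul_apply ..).symm
  · simp only [Matrix.add_apply, Matrix.mul_apply, Matrix.sum_apply, sum_add_distrib]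
    rw [sum_comm]
  · simp only [Matrix.add_apply, Matrix.mul_apply, sum_add_distrib]
lemma GM.pow {F L} {D : Fin n → ℝ → E n → Mx n} (h : GM m F L D) (j : ℕ) :
    GM m (fun t θ => F t θ^j) (fun t θ => Lp (F t θ) (L t θ) (fun k => D k t θ) j) (fun k t θ => Dp (F t θ) (D k t θ) j) := by
  induction j with
  | zero => intro a b; simpa [Lp, Dp] using Gen.const _
  | succ j ih => exact fun a b => (ih.mul h a b).congr (fun t θ => by simp only [pow_succ]) (fun _ _ => rfl) (fun _ _ _ => rfl)
variable (m) in
def NN (t : ℝ) (θ : E n) : Mx n := Matrix.of (fun i j => AA m i j t θ) - 1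
variable (m) in
def TT (k : Fin n) (t : ℝ) (θ : E n) : Mx n := Matrix.of fun i j => ww m (fun x => x j) i k t θ
lemma NN_gen : GM m (NN m) (fun t θ => -((1 + NN m t θ) * (1 + NN m t θ))) (TT m) := fun i j => by
  refine ((cv_gen m (f := fun x => x i) (g := fun x => x j) (by fun_prop) (by fun_prop)).sub (Gen.const ((1 : Mx n) i j))).congr (fun t θ => rfl) (fun t θ => ?_) (fun k t θ => ?_)
  · have : 1 + NN m t θ = Matrix.of (fun i j => AA m i j t θ) := by simp [NN]
    change _ = (-((1 + NN m t θ) * (1 + NN m t θ)) : Mx n) i j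
    rw [this, Matrix.neg_apply, Matrix.mul_apply, sub_zero]
    congr 1
    refine sum_congr rfl fun k _ => ?_
    simp only [Matrix.of_apply]
    rw [AA_comm]; rfl
  · simp only [TT, Matrix.of_apply, ww, sub_zero]; rfl
lemma NN_symm (t : ℝ) (θ : E n) : (NN m t θ).transpose = NN m t θ := by
  ext i j; simp only [NN, Matrix.transpose_apply, Matrix.sub_apply, Matrix.of_apply]
  rw [AA_comm, Matrix.one_apply, Matrix.one_apply]; simp only [eq_comm]
lemma TT_symm (k i j : Fin n) (t : ℝ) (θ : E n) : TT m k t θ i j = TT m k t θ j i := by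
  simp only [TT, Matrix.of_apply, ww, vv, AA, cv, mul_comm, mul_left_comm]; ring
lemma TT_symm' (k i j : Fin n) (t : ℝ) (θ : E n) : TT m k t θ i j = TT m i t θ k j := by
  simp only [TT, Matrix.of_apply, ww, vv, AA, cv, mul_comm, mul_left_comm]; ring
lemma TT_bound {t α C : ℝ} {θ : E n} (hα0 : 0 ≤ α) (hC0 : 0 ≤ C) (hα : ∀ u : Fin n → ℝ, cv m (fun x => ∑ k, u k * x k) (fun x => ∑ k, u k * x k) t θ ≤ α * ∑ k, u k^2)
    (hC : Poi (tilt m t θ) C) (u : Fin n → ℝ) :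
    ∑ k, ∑ i, (∑ l, u l * TT m l t θ k i)^2 ≤ 4 * α^2 * C * ∑ k, u k^2 := by
  set τ : Fin n → Fin n → ℝ := fun k i => ∑ l, u l * TT m l t θ k i
  have hτ : ∀ k i, τ k i = τ i k := fun k i => sum_congr rfl fun l _ => by rw [TT_symm]
  set a : Fin n → ℝ := fun k => Mn m (fun x => x k) t θ
  set Q : E n → ℝ := fun x => ∑ p : Fin n × Fin n, τ p.1 p.2 * ((x p.1 - a p.1) * (x p.2 - a p.2))
  have hQ : Continuous Q := by fun_prop
  have hM : ∀ f g : E n → ℝ, Continuous f → Continuous g → ∀ c : ℝ, Mn m (fun x => f x + c * g x) t θ = Mn m f t θ + c * Mn m g t θ := fun f g hf hg c => by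
    simp only [← tilt_int]
    rw [integral_add (int_m _ hf) ((int_m _ hg).const_mul c), integral_const_mul]
  have e1 : ∀ l k i, cv m (fun x => x l) (fun x => (x k - a k) * (x i - a i)) t θ = TT m l t θ k i := fun l k i => by
    have z1 : ∀ x : E n, (x k - a k) * (x i - a i) = ((x k * x i + (-a k) * x i) + (-a i) * x k) + (a k * a i) * 1 := fun x => by ring
    have z2 : ∀ x : E n, x l * (((x k * x i + (-a k) * x i) + (-a i) * x k) + (a k * a i) * 1) = ((x l * (x k * x i) + (-a k) * (x l * x i)) + (-a i) * (x l * x k)) + (a k * a i) * x l := fun x => by ring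
    simp only [TT, Matrix.of_apply, ww, vv, AA, cv, z1, z2]
    rw [hM _ _ (by fun_prop) (by fun_prop), hM _ _ (by fun_prop) (by fun_prop), hM _ _ (by fun_prop) (by fun_prop), hM _ _ (by fun_prop) (by fun_prop), hM _ _ (by fun_prop) (by fun_prop), hM _ _ (by fun_prop) (by fun_prop)]
    have : Mn m (fun _ => 1) t θ = 1 := by rw [← tilt_int]; simp
    rw [this]
    ring
  have e2 : cv m (fun x => ∑ k, u k * x k) Q t θ = ∑ k, ∑ i, τ k i^2 := by
    rw [cv_lin m u (fun i => by fun_prop) hQ]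
    have : ∀ l, cv m (fun x => x l) Q t θ = ∑ p : Fin n × Fin n, τ p.1 p.2 * TT m l t θ p.1 p.2 := fun l => by
      rw [cv_comm, cv_lin m (fun p : Fin n × Fin n => τ p.1 p.2) (f := fun p x => (x p.1 - a p.1) * (x p.2 - a p.2)) (fun p => by fun_prop) (by fun_prop)]
      exact sum_congr rfl fun p _ => by rw [cv_comm, e1]
    simp only [this, mul_sum]
    rw [sum_comm, Fintype.sum_prod_type]
    refine sum_congr rfl fun k _ => sum_congr rfl fun i _ => ?_
    rw [sq]; simp only [τ]
    rw [mul_sum]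
    exact sum_congr rfl fun l _ => by ring
  set G : Fin n → E n → ℝ := fun k x => 2 * ∑ i, τ k i * (x i - a i)
  have cG : C11 Q G := by
    refine ⟨hQ, fun k => by fun_prop, ∑ p : Fin n × Fin n, |τ p.1 p.2|, by positivity, fun x y => ?_⟩
    have : Q y - Q x - ∑ k, G k x * (y k - x k) = ∑ p : Fin n × Fin n, τ p.1 p.2 * ((y - x) p.1 * (y - x) p.2) := by
      have s1 : ∑ k, G k x * (y k - x k) = ∑ p : Fin n × Fin n, τ p.1 p.2 * ((x p.2 - a p.2) * (y p.1 - x p.1) + (x p.1 - a p.1) * (y p.2 - x p.2)) := by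
        have s2 : ∑ k, G k x * (y k - x k) = 2 * ∑ k, ∑ i, τ k i * ((x i - a i) * (y k - x k)) := by
          simp only [G, mul_sum, sum_mul]
          exact sum_congr rfl fun k _ => sum_congr rfl fun i _ => by ring
        rw [s2, two_mul]
        nth_rewrite 2 [sum_comm]
        rw [Fintype.sum_prod_type, ← sum_add_distrib]
        refine sum_congr rfl fun k _ => ?_
        rw [← sum_add_distrib]
        exact sum_congr rfl fun i _ => by rw [hτ i k]; ring
      rw [s1]
      simp only [Q, ← sum_sub_distrib]
      exact sum_congr rfl fun p _ => by simp only [PiLp.sub_apply]; ring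
    rw [this, sum_mul]
    refine (Finset.abs_sum_le_sum_abs _ _).trans (sum_le_sum fun p _ => ?_)
    rw [abs_mul, abs_mul, sq]
    gcongr <;> exact abs_coord_le _ _
  have hv := hC _ _ cG
  simp only [tilt_int] at hv
  rw [← cv_self] at hv
  have hG : ∀ k, Mn m (fun x => G k x^2) t θ ≤ 4 * α * ∑ i, τ k i^2 := fun k => by
    have h1 := hα (τ k)
    rw [cv_self] at h1
    have z : ∀ x, G k x = 2 * (∑ i, τ k i * x i) + (-2 * ∑ i, τ k i * a i) * 1 := fun x => by
      simp only [G, mul_sub, sum_sub_distrib]; ring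
    have cL : Continuous fun x : E n => ∑ i, τ k i * x i := by fun_prop
    have hL : Mn m (fun x => ∑ i, τ k i * x i) t θ = ∑ i, τ k i * a i := by
      simp only [a, ← tilt_int]
      rw [integral_finsetSum _ fun k _ => int_m _ (by fun_prop)]
      simp only [integral_const_mul]
    set A := ∑ i, τ k i * a i
    have z2 : ∀ x, G k x^2 = ((4*A^2) * 1 + 4 * (∑ i, τ k i * x i)^2) + (-8 * A) * (∑ i, τ k i * x i) := fun x => by rw [z]; ring
    simp only [z2]
    rw [hM _ _ (by fun_prop) cL, hM _ (fun x => (∑ i, τ k i * x i)^2) (by fun_prop) (by fun_prop), hL]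
    have : Mn m (fun _ => 4*A^2*1) t θ = 4*A^2 := by rw [← tilt_int]; simp
    rw [this]
    rw [hL] at h1
    linarith
  have hcs := cv_cs m (f := fun x => ∑ k, u k * x k) (by fun_prop) hQ t θ
  rw [e2] at hcs
  have hs0 : 0 ≤ ∑ k, ∑ i, τ k i^2 := by positivity
  refine le_of_sq hs0 (by positivity) (hcs.trans ?_)
  have hq : cv m Q Q t θ ≤ C * (4 * α * ∑ k, ∑ i, τ k i^2) := hv.trans (by
    refine mul_le_mul_of_nonneg_left ?_ hC0
    rw [mul_sum]; exact sum_le_sum fun k _ => hG k)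
  have hq0 : 0 ≤ cv m Q Q t θ := by rw [cv_self]; exact sub_nonneg.2 (Mn_jensen hQ t θ)
  calc _ ≤ (α * ∑ k, u k^2) * (C * (4 * α * ∑ k, ∑ i, τ k i^2)) := mul_le_mul (hα u) hq hq0 (by positivity)
    _ = _ := by ring
end
end SL
end
section
namespace SL
variable {n : ℕ}
set_option linter.unusedSectionVars false
section
variable {m : Measure (E n)} [CSupp m]
lemma spec_NN (m : Measure (E n)) [CSupp m] (t : ℝ) (θ : E n) : ∃ (l : Fin n → ℝ) (U : Mx n), U.transpose * U = 1 ∧ U * U.transpose = 1 ∧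
    (∀ x : ℕ, NN m t θ^x = U * Matrix.diagonal (fun i => l i^x) * U.transpose) ∧
    (∀ u, cv m (fun x => ∑ k, u k * x k) (fun x => ∑ k, u k * x k) t θ = ∑ i, (1 + l i) * (U.transpose.mulVec u i)^2) ∧
    (∀ u : Fin n → ℝ, ∑ i, (U.transpose.mulVec u i)^2 = ∑ i, u i^2) ∧ ∀ i, -1 ≤ l i := by
  obtain ⟨l, U, u1, u2, h⟩ := spec (NN_symm (m := m) t θ)
  have n2 : ∀ u : Fin n → ℝ, ∑ i, (U.transpose.mulVec u i)^2 = ∑ i, u i^2 := fun u => by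
    have : U.transpose.mulVec u ⬝ᵥ U.transpose.mulVec u = u ⬝ᵥ u := by
      rw [Matrix.dotProduct_mulVec, Matrix.vecMul_transpose, Matrix.mulVec_mulVec, u2, Matrix.one_mulVec]
    simpa only [dotProduct, sq] using this
  have f : ∀ u, cv m (fun x => ∑ k, u k * x k) (fun x => ∑ k, u k * x k) t θ = ∑ i, (1 + l i) * (U.transpose.mulVec u i)^2 := fun u => by
    have e : cv m (fun x => ∑ k, u k * x k) (fun x => ∑ k, u k * x k) t θ = u ⬝ᵥ u + u ⬝ᵥ (NN m t θ).mulVec u := by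
      rw [AA_form, ← dotProduct_add]
      refine sum_congr rfl fun k _ => ?_
      congr 1
      simp only [Pi.add_apply, NN, Matrix.sub_mulVec, Pi.sub_apply, Matrix.one_mulVec, add_sub_cancel]
      exact sum_congr rfl fun j _ => mul_comm _ _
    have e2 : u ⬝ᵥ (NN m t θ).mulVec u = ∑ i, l i * (U.transpose.mulVec u i)^2 := by
      have := h 1
      simp only [pow_one] at this
      rw [this, ← Matrix.mulVec_mulVec, ← Matrix.mulVec_mulVec, Matrix.dotProduct_mulVec, ← Matrix.mulVec_transpose]
      refine sum_congr rfl fun i _ => ?_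
      rw [Matrix.mulVec_diagonal]; ring
    rw [e, e2]
    simp only [add_mul, one_mul, sum_add_distrib, n2]
    simp only [dotProduct, sq]
  refine ⟨l, U, u1, u2, h, f, n2, fun i => ?_⟩
  have h1 := f (U.mulVec (Pi.single i 1))
  rw [Matrix.mulVec_mulVec, u1, Matrix.one_mulVec, Finset.sum_eq_single i (fun j _ hj => by simp [hj]) (by simp)] at h1
  simp only [Pi.single_eq_same, one_pow, mul_one] at h1
  rw [cv_self] at h1
  have := Mn_jensen (m := m) (f := fun x => ∑ k, U.mulVec (Pi.single i 1) k * x k) (by fun_prop) t θ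
  linarith
variable (m) in
def SS (z : ℕ) (t : ℝ) (θ : E n) : ℝ := 4^(z+1) * (NN m t θ^(2*(z+1))).trace
lemma SS_eq {l : Fin n → ℝ} {U : Mx n} {t : ℝ} {θ : E n} (u1 : U.transpose * U = 1)
    (h : ∀ x : ℕ, NN m t θ^x = U * Matrix.diagonal (fun i => l i^x) * U.transpose) (z : ℕ) :
    SS m z t θ = ∑ i, ((2 * l i)^2)^(z+1) := by
  rw [SS, tr_pow u1 h, mul_sum]
  exact sum_congr rfl fun i _ => by rw [pow_mul, ← mul_pow]; ring
lemma SS_nonneg (z : ℕ) (t : ℝ) (θ : E n) : 0 ≤ SS m z t θ := by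
  obtain ⟨l, U, u1, u2, h, -⟩ := spec_NN m t θ
  rw [SS_eq u1 h]; positivity
lemma SS_gen (z : ℕ) : ∃ d, Gen m (SS m z) (fun t θ => 4^(z+1) * (Lp (NN m t θ) (-((1 + NN m t θ) * (1 + NN m t θ))) (fun k => TT m k t θ) (2*(z+1))).trace) d :=
  ⟨_, ((Gen.sum Finset.univ fun i => (NN_gen (m := m)).pow (2*(z+1)) i i).cmul (4^(z+1))).congr (fun _ _ => rfl) (fun _ _ => rfl) (fun _ _ _ => rfl)⟩
lemma TT_tr {t α C : ℝ} {θ : E n} (hα0 : 0 ≤ α) (hC0 : 0 ≤ C) (hα : ∀ u : Fin n → ℝ, cv m (fun x => ∑ k, u k * x k) (fun x => ∑ k, u k * x k) t θ ≤ α * ∑ k, u k^2)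
    (hC : Poi (tilt m t θ) C) (z : ℕ) :
    ∑ k, (NN m t θ^(2*z) * TT m k t θ * TT m k t θ).trace ≤ 4 * α^2 * C * (NN m t θ^(2*z)).trace := by
  set M := NN m t θ^z
  have hM : M.transpose = M := by rw [Matrix.transpose_pow, NN_symm]
  have hT : ∀ k, (TT m k t θ).transpose = TT m k t θ := fun k => by ext i j; exact TT_symm _ _ _ _ _
  have e : NN m t θ^(2*z) = M * M := by rw [two_mul, pow_add]
  have sq_tr : ∀ B : Mx n, (B * B.transpose).trace = ∑ a, ∑ b, B a b^2 := fun B => by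
    simp only [Matrix.trace, Matrix.diag, Matrix.mul_apply, Matrix.transpose_apply, sq]
  have e1 : ∀ k, (NN m t θ^(2*z) * TT m k t θ * TT m k t θ).trace = ∑ a, ∑ b, (∑ l, M a l * TT m l t θ k b)^2 := fun k => by
    have : NN m t θ^(2*z) * TT m k t θ * TT m k t θ = M * (M * TT m k t θ * TT m k t θ) := by rw [e]; simp only [Matrix.mul_assoc]
    rw [this, Matrix.trace_mul_comm]
    have e3 : M * TT m k t θ * TT m k t θ * M = (M * TT m k t θ) * (M * TT m k t θ).transpose := by
      rw [Matrix.transpose_mul, hM, hT]; simp only [Matrix.mul_assoc]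
    rw [e3, sq_tr]
    refine sum_congr rfl fun a _ => sum_congr rfl fun b _ => ?_
    rw [Matrix.mul_apply]
    congr 1
    exact sum_congr rfl fun l _ => by rw [TT_symm' k l b]
  simp only [e1]
  rw [sum_comm, e]
  have e4 : (M * M).trace = ∑ a, ∑ b, M a b^2 := by rw [← sq_tr, hM]
  rw [e4, mul_sum]
  exact sum_le_sum fun a _ => TT_bound hα0 hC0 hα hC (M a)
lemma drift (h0 : LC m 0) {z : ℕ} (hz : 1 ≤ z) {t : ℝ} (ht : 0 < t) (ht1 : t ≤ 1) (θ : E n) {B : ℝ} (hB : 0 < B) :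
    4^(z+1) * (Lp (NN m t θ) (-((1 + NN m t θ) * (1 + NN m t θ))) (fun k => TT m k t θ) (2*(z+1))).trace
      ≤ 1792 * (z+1)^2 * (√t)⁻¹ * (1 + SS m z t θ) * (B⁻¹ * SS m z t θ + n * B^z) := by
  obtain ⟨l, U, u1, u2, h, f, n2, l1⟩ := spec_NN m t θ
  have hS0 := SS_nonneg (m := m) z t θ
  have hS := SS_eq u1 h z
  obtain ⟨α, hα1, hα3, hαl⟩ : ∃ α : ℝ, 1 ≤ α ∧ α^3 ≤ 8 * (1 + SS m z t θ) ∧ ∀ i, 1 + l i ≤ α := by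
    by_cases hl : ∀ i, l i ≤ 1
    · exact ⟨2, by norm_num, by linarith, fun i => by linarith [hl i]⟩
    · push Not at hl
      obtain ⟨i0, hi0⟩ := hl
      obtain ⟨i, -, hi⟩ := Finset.exists_max_image Finset.univ l ⟨i0, Finset.mem_univ _⟩
      have hl1 : 1 < l i := hi0.trans_le (hi i0 (Finset.mem_univ _))
      refine ⟨2 * l i, by linarith, ?_, fun j => by linarith [hi j (Finset.mem_univ _)]⟩
      have : ((2 * l i)^2)^(z+1) ≤ SS m z t θ := by
        rw [hS]; exact Finset.single_le_sum (f := fun i => ((2 * l i)^2)^(z+1)) (fun _ _ => by positivity) (Finset.mem_univ i)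
      have h2 : (2 * l i)^3 ≤ ((2 * l i)^2)^(z+1) := by
        rw [← pow_mul]; exact pow_le_pow_right₀ (by linarith) (by omega)
      linarith
  have hα : ∀ u : Fin n → ℝ, cv m (fun x => ∑ k, u k * x k) (fun x => ∑ k, u k * x k) t θ ≤ α * ∑ k, u k^2 := fun u => by
    rw [f, ← n2, mul_sum]; exact sum_le_sum fun i _ => by gcongr; exact hαl i
  obtain ⟨C, hC0, hC, hC2⟩ := ilich (m := tilt m t θ) (t := t) (α := α) ht (by simpa using h0.tilt t θ) (by linarith) fun u => by
    have := hα u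
    rw [cv_self] at this
    simpa only [tilt_int] using this
  have hs : 0 < √t := sqrt_pos.2 ht
  have hs2 : √t^2 = t := sq_sqrt ht.le
  have hs1 : √t ≤ 1 := by rw [Real.sqrt_le_iff]; constructor <;> linarith
  have hC3 : C ≤ 1.6 * α * (√t)⁻¹ := by
    rw [← div_eq_mul_inv, le_div_iff₀ hs]
    refine le_of_sq_le_sq ?_ (by positivity)
    rw [mul_pow, hs2]; nlinarith
  have hT := TT_tr (by linarith) hC0 hα hC z
  have hLp := tr_Lp (NN_symm (m := m) t θ) (L := -((1 + NN m t θ) * (1 + NN m t θ))) (T := fun k => TT m k t θ) (fun k => by ext i j; exact TT_symm _ _ _ _ _) z (2*z+2) 0 (by omega)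
  rw [pow_zero, Matrix.mul_one] at hLp
  set P := (NN m t θ^(2*z)).trace
  have hP : P = ∑ i, l i^(2*z) := tr_pow u1 h _
  have hP0 : 0 ≤ P := by rw [hP]; exact sum_nonneg fun i _ => by rw [pow_mul]; positivity
  have hL : (NN m t θ^(2*z+1) * -((1 + NN m t θ) * (1 + NN m t θ))).trace ≤ P := by
    have : NN m t θ^(2*z+1) * -((1 + NN m t θ) * (1 + NN m t θ)) = -(NN m t θ^(2*z+1) + NN m t θ^(2*z+2) + NN m t θ^(2*z+2) + NN m t θ^(2*z+3)) := by
      simp only [pow_succ]; noncomm_ring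
    rw [this]
    simp only [Matrix.trace_neg, Matrix.trace_add, tr_pow u1 h, hP, ← sum_add_distrib, ← Finset.sum_neg_distrib]
    refine sum_le_sum fun i _ => ?_
    have p0 : 0 ≤ l i^(2*z) := by rw [pow_mul]; positivity
    have : -(l i * (1 + l i)^2) ≤ 1 := by
      rcases le_total 0 (l i) with h | h
      · have : 0 ≤ l i * (1 + l i)^2 := by positivity
        linarith
      · nlinarith [l1 i, mul_nonneg (neg_nonneg.2 h) (by linarith [l1 i] : 0 ≤ 1 + l i)]
    have := mul_le_mul_of_nonneg_left this p0
    simp only [pow_add, pow_one]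
    nlinarith
  have hR : 4^z * P ≤ B⁻¹ * SS m z t θ + n * B^z := by
    have : (n : ℝ) * B^z = ∑ i : Fin n, B^z := by simp
    rw [hS, hP, this, mul_sum, mul_sum, ← sum_add_distrib]
    refine sum_le_sum fun i _ => ?_
    have : (4:ℝ)^z * l i^(2*z) = ((2 * l i)^2)^z := by rw [pow_mul, ← mul_pow]; ring
    rw [this]
    set y := (2 * l i)^2
    have hy : 0 ≤ y := by positivity
    rcases le_total y B with hh | hh
    · have : y^z ≤ B^z := by gcongr
      have : 0 ≤ B⁻¹ * y^(z+1) := by positivity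
      linarith
    · have : y^z ≤ B⁻¹ * y^(z+1) := by
        rw [inv_mul_eq_div, le_div_iff₀ hB, pow_succ]; gcongr
      have : 0 ≤ B^z := by positivity
      linarith
  have hi1 : 1 ≤ (√t)⁻¹ := (one_le_inv₀ hs).2 hs1
  set r := (√t)⁻¹
  have hα3' : 1 ≤ α^3 * r := by have := one_le_pow₀ hα1 (n := 3); nlinarith
  have hz1 : (1:ℝ) ≤ z := by exact_mod_cast hz
  have k1 : (2*z+2 : ℝ) * (2 * ∑ k, (NN m t θ^(2*z) * TT m k t θ * TT m k t θ).trace) ≤ (2*z+2) * (2 * (4 * α^2 * (1.6 * α * r) * P)) := by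
    gcongr; exact hT.trans (by gcongr)
  have k2 : (Lp (NN m t θ) (-((1 + NN m t θ) * (1 + NN m t θ))) (fun k => TT m k t θ) (2*(z+1))).trace ≤ 56 * (z+1)^2 * (α^3 * r) * P := by
    refine hLp.trans ?_
    push_cast
    have k3 : P ≤ (2*z+2) * (α^3 * r) * P := by
      have : 1 ≤ (2*z+2) * (α^3 * r) := by nlinarith
      nlinarith
    calc _ ≤ (2*z+2 : ℝ) * (P + (2*z+2) * (2 * (4 * α^2 * (1.6 * α * r) * P))) := by gcongr
      _ ≤ (2*z+2 : ℝ) * ((2*z+2) * (α^3 * r) * P + (2*z+2) * (2 * (4 * α^2 * (1.6 * α * r) * P))) := by gcongr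
      _ = 55.2 * ((z+1)^2 * (α^3 * r) * P) := by ring
      _ ≤ 56 * ((z+1)^2 * (α^3 * r) * P) := by gcongr; norm_num
      _ = _ := by ring
  calc _ ≤ 4^(z+1) * (56 * (z+1)^2 * (α^3 * r) * P) := by gcongr
    _ = 224 * (z+1)^2 * r * α^3 * (4^z * P) := by ring
    _ ≤ 224 * (z+1)^2 * r * (8 * (1 + SS m z t θ)) * (B⁻¹ * SS m z t θ + n * B^z) := by gcongr
    _ = _ := by ring
variable (m) in
def Th (z : ℕ) (t : ℝ) (θ : E n) : ℝ := SS m z t θ / (1 + SS m z t θ)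
lemma Th_nonneg (z : ℕ) (t : ℝ) (θ : E n) : 0 ≤ Th m z t θ := by
  have := SS_nonneg (m := m) z t θ
  rw [Th]; positivity
lemma Th_le (z : ℕ) (t : ℝ) (θ : E n) : Th m z t θ ≤ 1 := by
  have := SS_nonneg (m := m) z t θ
  rw [Th, div_le_one (by positivity)]; linarith
lemma SS_cont (z : ℕ) : Continuous (Function.uncurry (SS m z)) := by
  obtain ⟨d, h⟩ := SS_gen (m := m) z
  exact h.eb.1
lemma Th_eb (z : ℕ) : EB (Th m z) := by
  refine EB.of_bdd ?_ 1 fun t θ => by rw [abs_of_nonneg (Th_nonneg z t θ)]; exact Th_le z t θ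
  exact (SS_cont z).div (continuous_const.add (SS_cont z)) fun p => by have := SS_nonneg (m := m) z p.1 p.2; exact ne_of_gt (add_pos_of_pos_of_nonneg one_pos this)
lemma Th_EE (h0 : LC m 0) (hN : NN m 0 0 = 0) {z : ℕ} (hz : 1 ≤ z) {T : ℝ} (hT : 0 < T) (hT1 : T ≤ 1) :
    EE m (Th m z) T ≤ n * (10^4 * (z+1) * √T)^(z+1) := by
  obtain ⟨d, hg⟩ := SS_gen (m := m) z
  have hS0 := SS_nonneg (m := m) z
  have hp : ∀ t θ, 0 < 1 + SS m z t θ := fun t θ => by linarith [hS0 t θ]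
  have ci : Continuous (Function.uncurry fun t θ => (1 + SS m z t θ)⁻¹) :=
    (continuous_const.add (SS_cont z)).inv₀ fun p => (hp p.1 p.2).ne'
  have ei : EB fun t θ => (1 + SS m z t θ)⁻¹ := EB.of_bdd ci 1 fun t θ => by
    rw [abs_of_nonneg (inv_nonneg.2 (hp t θ).le)]; exact inv_le_one_of_one_le₀ (by linarith [hS0 t θ])
  have hd1 : ∀ s : ℝ, 0 < 1 + s → HasDerivAt (fun s : ℝ => s / (1 + s)) ((1+s)⁻¹^2) s := fun s hs =>
    ((hasDerivAt_id s).div ((hasDerivAt_id s).const_add 1) hs.ne').congr_deriv (by simp only [id]; field_simp; ring)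
  have hd2 : ∀ s : ℝ, 0 < 1 + s → HasDerivAt (fun s : ℝ => (1 + s)⁻¹^2) (-2 * (1+s)⁻¹^3) s := fun s hs =>
    ((((hasDerivAt_id s).const_add 1).inv hs.ne').pow 2).congr_deriv (by simp; field_simp)
  have hG := hg.comp (φ := fun s => s / (1 + s)) (φ' := fun s => (1+s)⁻¹^2) (φ'' := fun s => -2 * (1+s)⁻¹^3) (Th_eb z)
    (by simpa only [sq] using ei.mul ei) (by simpa only [pow_succ, pow_zero, one_mul] using ((ei.mul ei).mul ei).cmul (-2))
    (fun t _ θ => hd1 _ (hp t θ)) (fun t _ θ => hd2 _ (hp t θ))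
  change Gen m (Th m z) _ _ at hG
  set B : ℝ := 3584 * (z+1) * √T
  have hsT : 0 < √T := sqrt_pos.2 hT
  have hB : 0 < B := by positivity
  set κ : ℝ := 1792 * (z+1)^2
  have hle : ∀ t ∈ Ioo 0 T, EE m _ t ≤ κ * (√t)⁻¹ * (B⁻¹ * EE m (Th m z) t + n * B^z) := fun t ht => by
    refine (EE_mono m hG.el (((Th_eb (m := m) z).cmul (κ * (√t)⁻¹ * B⁻¹)).add (EB.const (κ * (√t)⁻¹ * (n * B^z)) : EB fun (_ : ℝ) (_ : E n) => _)) fun θ => ?_).trans (le_of_eq ?_)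
    · have h1 := drift h0 hz ht.1 (ht.2.le.trans hT1) θ hB
      have i0 : 0 < (1 + SS m z t θ)⁻¹ := inv_pos.2 (hp t θ)
      have i1 : (1 + SS m z t θ)⁻¹ ≤ 1 := inv_le_one_of_one_le₀ (by linarith [hS0 t θ])
      have d0 : 0 ≤ (1 + SS m z t θ)⁻¹^3 * ∑ k, d k t θ^2 := by positivity
      have h2 := mul_le_mul_of_nonneg_left h1 (sq_nonneg (1 + SS m z t θ)⁻¹)
      have h3 : (1 + SS m z t θ)⁻¹^2 * (1792 * (z+1)^2 * (√t)⁻¹ * (1 + SS m z t θ) * (B⁻¹ * SS m z t θ + n * B^z)) = κ * (√t)⁻¹ * (B⁻¹ * Th m z t θ) + κ * (√t)⁻¹ * (n * B^z) * (1 + SS m z t θ)⁻¹ := by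
        rw [Th]; have := (hp t θ).ne'; field_simp; simp only [κ]; ring
      have h4 : κ * (√t)⁻¹ * (n * B^z) * (1 + SS m z t θ)⁻¹ ≤ κ * (√t)⁻¹ * (n * B^z) * 1 := by gcongr
      nlinarith
    · rw [EE_add m ((Th_eb z).cmul _) (EB.const _), EE_cmul, EE_const m _ ht.1.le]; ring
  set c : ℝ := n * B^(z+1)
  have key := anti_of (f := fun t => (EE m (Th m z) t + c) * exp (-(2 * κ * B⁻¹ * √t)))
    (f' := fun t => EE m _ t * exp (-(2 * κ * B⁻¹ * √t)) + (EE m (Th m z) t + c) * (exp (-(2 * κ * B⁻¹ * √t)) * -(2 * κ * B⁻¹ * (1 / (2 * √t))))) hT.le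
    (((EE_cont m (Th_eb z)).add continuous_const).mul (by fun_prop)).continuousOn
    (fun t ht => ((hG.deriv ht.1).add_const c).mul (((Real.hasDerivAt_sqrt ht.1.ne').const_mul (2 * κ * B⁻¹)).neg.exp)) fun t ht => by
      have h1 := hle t ht
      have hE := exp_pos (-(2 * κ * B⁻¹ * √t))
      have hst : 0 < √t := sqrt_pos.2 ht.1
      have h2 : κ * (√t)⁻¹ * (B⁻¹ * EE m (Th m z) t + n * B^z) = (EE m (Th m z) t + c) * (2 * κ * B⁻¹ * (1 / (2 * √t))) := by
        simp only [c, pow_succ]; field_simp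
      rw [h2] at h1
      nlinarith
  simp only [Real.sqrt_zero, mul_zero, neg_zero, Real.exp_zero, mul_one, EE_zero] at key
  have t0 : Th m z 0 0 = 0 := by rw [Th, SS, hN, zero_pow (by omega)]; simp
  have e1 : 2 * κ * B⁻¹ * √T = z+1 := by simp only [κ, B]; field_simp; norm_num
  rw [t0, zero_add, e1, exp_neg, ← div_eq_mul_inv, div_le_iff₀ (exp_pos _)] at key
  have hc0 : 0 ≤ c := by positivity
  have e2 : exp (z+1:ℝ) ≤ 2.7182818286^(z+1) := by
    have : exp (z+1:ℝ) = exp 1^(z+1) := by rw [← Real.exp_nat_mul]; push_cast; ring_nf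
    rw [this]; gcongr; exact Real.exp_one_lt_d9.le
  calc EE m (Th m z) T ≤ c * exp (z+1) := by linarith
    _ ≤ c * 2.7182818286^(z+1) := by gcongr
    _ = n * (B * 2.7182818286)^(z+1) := by simp only [c, mul_pow]; ring
    _ ≤ _ := by
      refine mul_le_mul_of_nonneg_left (pow_le_pow_left₀ (by positivity) ?_ _) (by positivity)
      simp only [B]
      nlinarith [mul_pos (by positivity : (0:ℝ) < z+1) hsT]
end
end SL
end
section
namespace SL
variable {n : ℕ}
set_option linter.unusedSectionVars false
def ML (M : Mx n) : E n →L[ℝ] E n := Matrix.toEuclideanCLM (𝕜 := ℝ) M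
lemma ML_det (M : Mx n) : (ML M).det = M.det := by
  have : ((ML M : E n →L[ℝ] E n) : E n →ₗ[ℝ] E n) = Matrix.toLin (EuclideanSpace.basisFun (Fin n) ℝ).toBasis (EuclideanSpace.basisFun (Fin n) ℝ).toBasis M := rfl
  rw [ContinuousLinearMap.det, this, LinearMap.det_toLin]
lemma ML_apply (M : Mx n) (x : E n) (i : Fin n) : ML M x i = ∑ j, M i j * x j := rfl
lemma fd_vec {F : Fin n → E n → ℝ} {M : Mx n} {x : E n} (h : ∀ i, HasFDerivAt (F i) (DS (M i)) x) :
    HasFDerivAt (fun y => vec (fun i => F i y)) (ML M) x := by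
  have h1 : HasFDerivAt (fun y i => F i y) (ContinuousLinearMap.pi fun i => DS (M i)) x := hasFDerivAt_pi.2 h
  refine ((PiLp.hasFDerivAt_toLp (𝕜 := ℝ) 2 _).comp x h1).congr_fderiv ?_
  ext y i
  exact (DS_apply _ _).trans (ML_apply M y i).symm
structure Iso (m : Measure (E n)) (K : Set (E n)) : Prop where
  comp : IsCompact K
  conv : Convex ℝ K
  hm : m = (volume K)⁻¹ • volume.restrict K
  cov : NN m 0 0 = 0
  mean : ∀ k, ∫ x, x k ∂m = 0
section
variable {m : Measure (E n)} [CSupp m] {K : Set (E n)}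
lemma Iso.lc (h : Iso m K) : LC m 0 := ⟨K, _, 0, h.comp, h.conv, by simpa [wt] using h.hm⟩
lemma Iso.ae (h : Iso m K) : ∀ᵐ x ∂m, x ∈ K := by
  rw [h.hm]; exact Measure.ae_smul_measure (ae_restrict_mem h.comp.measurableSet) _
lemma Iso.vol0 (h : Iso m K) : volume K ≠ 0 := fun h0 => by
  have h1 : m univ = 1 := measure_univ
  rw [h.hm] at h1
  simp [h0] at h1
lemma Iso.volt (h : Iso m K) : volume K ≠ ⊤ := h.comp.measure_lt_top.ne
lemma Mn_zero (f : E n → ℝ) : Mn m f 0 0 = ∫ x, f x ∂m := by simp [Mn, Zt, In, wt]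
lemma cv_iso (h : NN m 0 0 = 0) (v : Fin n → ℝ) : cv m (fun x => ∑ k, v k * x k) (fun x => ∑ k, v k * x k) 0 0 = ∑ k, v k^2 := by
  have : ∀ i j, AA m i j 0 0 = (1 : Mx n) i j := fun i j => by
    have := congrFun (congrFun (sub_eq_zero.1 h) i) j; exact this
  rw [AA_form]
  simp [this, Matrix.one_apply, sq]
lemma var_c (μ : Measure (E n)) [CSupp μ] {f : E n → ℝ} (hf : Continuous f) (c : ℝ) :
    ∫ x, (f x - c)^2 ∂μ = ∫ x, f x^2 ∂μ - 2 * c * ∫ x, f x ∂μ + c^2 := by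
  have : ∀ x, (f x - c)^2 = f x^2 + (-2 * c) * f x + c^2 := fun x => by ring
  simp only [this]
  rw [integral_add (int_m μ (by fun_prop)) (integrable_const _), integral_add (int_m μ (by fun_prop)) (int_m μ (by fun_prop)), integral_const_mul]
  simp; ring
lemma cv_pos (h : NN m 0 0 = 0) {v : Fin n → ℝ} (hv : 0 < ∑ k, v k^2) (t : ℝ) (θ : E n) :
    0 < cv m (fun x => ∑ k, v k * x k) (fun x => ∑ k, v k * x k) t θ := by
  set f : E n → ℝ := fun x => ∑ k, v k * x k
  have hf : Continuous f := by fun_prop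
  have h0 := cv_iso h v
  rw [cv_self, Mn_zero, Mn_zero] at h0
  rw [cv_self]
  set c := Mn m f t θ
  have e1 : Mn m (fun x => f x^2) t θ - c^2 = Mn m (fun x => (f x - c)^2) t θ := by
    have := var_c (tilt m t θ) hf c
    simp only [tilt_int] at this
    rw [this]; ring
  have e2 := var_c m hf c
  have wc := wt_cont t θ
  obtain ⟨C, hC0, hC⟩ := CSupp.bound m (f := fun x => (wt t θ x)⁻¹) (wc.inv₀ fun x => (wt_pos t θ x).ne')
  have e3 : ∫ x, (f x - c)^2 ∂m ≤ C * In m (fun x => (f x - c)^2) t θ := by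
    rw [In, ← integral_const_mul]
    refine integral_mono_ae (int_m m (by fun_prop)) (int_m m (by fun_prop)) ?_
    filter_upwards [hC] with x hx
    have w0 := wt_pos t θ x
    rw [abs_of_pos (inv_pos.2 w0), inv_le_iff_one_le_mul₀ w0] at hx
    nlinarith [sq_nonneg (f x - c)]
  have e4 : 0 < In m (fun x => (f x - c)^2) t θ := by
    by_contra hh
    push Not at hh
    nlinarith [sq_nonneg (∫ x, f x ∂m - c)]
  rw [e1, Mn]
  exact div_pos e4 (Zt_pos m t θ)
lemma Mn_lin (v : Fin n → ℝ) (t : ℝ) (θ : E n) : Mn m (fun x => ∑ k, v k * x k) t θ = ∑ k, v k * av m k t θ := by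
  rw [← tilt_int, integral_finsetSum _ fun k _ => int_m _ (by fun_prop)]
  simp only [integral_const_mul, tilt_int]; rfl
lemma av_inj (h : NN m 0 0 = 0) {t : ℝ} (ht : 0 < t) : Function.Injective fun θ => vec fun k => av m k t θ := by
  intro θ η he
  by_contra hne
  set v : Fin n → ℝ := fun k => η k - θ k
  have hv : 0 < ∑ k, v k^2 := by
    have : ∑ k, v k^2 = ‖η - θ‖^2 := by rw [EuclideanSpace.real_norm_sq_eq]; rfl
    rw [this]; exact pow_pos (norm_pos_iff.2 (sub_ne_zero.2 (Ne.symm hne))) 2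
  set f : E n → ℝ := fun x => ∑ k, v k * x k
  have hf : Continuous f := by fun_prop
  have hd : ∀ s : ℝ, HasDerivAt (fun s : ℝ => Mn m f t (θ + s • (η - θ))) (cv m f f t (θ + s • (η - θ))) s := fun s => by
    have h1 : HasDerivAt (fun s : ℝ => θ + s • (η - θ)) (η - θ) s := by
      simpa using ((hasDerivAt_id s).smul_const (η - θ)).const_add θ
    refine (((vv_gen hf).fd (m := m) ht (θ + s • (η - θ))).comp_hasDerivAt s h1).congr_deriv ?_
    rw [DS_apply, cv_lin m v (fun i => by fun_prop) hf]
    exact sum_congr rfl fun k _ => mul_comm _ _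
  have hm := strictMono_of_deriv_pos fun s => by rw [(hd s).deriv]; exact cv_pos h hv _ _
  have := hm (zero_lt_one)
  simp only [zero_smul, add_zero, one_smul, add_sub_cancel, f, Mn_lin] at this
  have e : ∀ k, av m k t θ = av m k t η := fun k => congrArg (fun x : E n => x k) he
  simp only [e, lt_self_iff_false] at this
lemma Iso.av_mem (h : Iso m K) (t : ℝ) (θ : E n) : (vec fun k => av m k t θ) ∈ K := by
  have h1 : ∀ᵐ x ∂(tilt m t θ), x ∈ K := (withDensity_absolutelyContinuous m _).ae_le h.ae
  have hi : Integrable (fun x : E n => x) (tilt m t θ) := by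
    obtain ⟨R, hR, hx⟩ := CSupp.bdd (m := tilt m t θ)
    exact Integrable.of_bound continuous_id.aestronglyMeasurable R hx
  convert h.conv.integral_mem h.comp.isClosed h1 hi
  ext k
  have := (EuclideanSpace.proj k : E n →L[ℝ] ℝ).integral_comp_comm hi
  exact (tilt_int m _ t θ).symm.trans this
lemma AA_det {t : ℝ} {θ : E n} (z : ℕ) (h : SS m z t θ < 1) : (1/2 : ℝ)^n ≤ |(Matrix.of fun i j => AA m i j t θ).det| := by
  obtain ⟨l, U, u1, u2, hp, f, n2, l1⟩ := spec_NN m t θ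
  have hl : ∀ i, 1/2 ≤ 1 + l i := fun i => by
    by_contra hh
    push Not at hh
    have h1 : 1 ≤ (2 * l i)^2 := by nlinarith
    have h2 : ((2 * l i)^2)^(z+1) ≤ SS m z t θ := by
      rw [SS_eq u1 hp]; exact Finset.single_le_sum (f := fun i => ((2 * l i)^2)^(z+1)) (fun _ _ => by positivity) (Finset.mem_univ i)
    linarith [one_le_pow₀ h1 (n := z+1)]
  have e : (Matrix.of fun i j => AA m i j t θ) = U * Matrix.diagonal (fun i => 1 + l i) * U.transpose := by
    have h1 := hp 1
    simp only [pow_one] at h1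
    have h2 : Matrix.diagonal (fun i => 1 + l i) = 1 + Matrix.diagonal l := by
      rw [← Matrix.diagonal_one, Matrix.diagonal_add]
    rw [h2, Matrix.mul_add, Matrix.add_mul, Matrix.mul_one, u2, ← h1, NN, add_sub_cancel]
  rw [e, Matrix.det_mul, mul_comm, ← Matrix.det_mul, ← Matrix.mul_assoc, u1, Matrix.one_mul, Matrix.det_diagonal]
  have : (1/2 : ℝ)^n = ∏ i : Fin n, (1/2 : ℝ) := by simp
  rw [this]
  exact (Finset.prod_le_prod (fun _ _ => by norm_num) fun i _ => hl i).trans (le_abs_self _)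
lemma Zgd_le {t : ℝ} (ht : 0 ≤ t) (g : E n) : Zt m t (√t • g) * gd g ≤ ((2 * Real.pi) ^ ((n : ℝ) / 2))⁻¹ := by
  have h1 : Zt m t (√t • g) ≤ exp (‖g‖^2/2) := by
    rw [Zt, In]
    refine (integral_mono (int_m m (by have := wt_cont t (√t • g); fun_prop)) (integrable_const (exp (‖g‖^2/2))) fun x => ?_).trans (by simp)
    simp only [one_mul]
    rw [wt_shift ht]
    gcongr
    have := norm_sub_sq_real g (√t • x)
    nlinarith [sq_nonneg ‖g - √t • x‖]
  calc _ ≤ exp (‖g‖^2/2) * gd g := by gcongr; exact (gd_pos g).le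
    _ = _ := by
      rw [gd, mul_left_comm, ← exp_add]; ring_nf; simp
lemma vol_a (h : Iso m K) (z : ℕ) {t : ℝ} (ht : 0 < t) (hΩ : MeasurableSet {θ : E n | SS m z t θ < 1}) :
    ofReal ((1/2 : ℝ)^n) * volume {θ : E n | SS m z t θ < 1} ≤ volume K := by
  have hd : ∀ θ, HasFDerivAt (fun θ => vec fun k => av m k t θ) (ML (Matrix.of fun i j => AA m i j t θ)) θ := fun θ =>
    fd_vec fun i => ((vv_gen (m := m) (f := fun x => x i) (by fun_prop)).fd ht θ).congr_fderiv (by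
      ext y; simp only [DS_apply]; exact sum_congr rfl fun j _ => by rw [Matrix.of_apply, AA_comm]; rfl)
  have h1 := lintegral_abs_det_fderiv_eq_addHaar_image volume hΩ (fun θ _ => (hd θ).hasFDerivWithinAt) (av_inj h.cov ht).injOn
  calc _ = ∫⁻ _ in {θ : E n | SS m z t θ < 1}, ofReal ((1/2 : ℝ)^n) := by simp
    _ ≤ ∫⁻ θ in {θ : E n | SS m z t θ < 1}, ofReal |(ML (Matrix.of fun i j => AA m i j t θ)).det| :=
        setLIntegral_mono' hΩ fun θ hθ => ofReal_le_ofReal (by rw [ML_det]; exact AA_det z hθ)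
    _ ≤ _ := by rw [h1]; exact measure_mono (by rintro _ ⟨θ, -, rfl⟩; exact h.av_mem t θ)
lemma vol_b {z : ℕ} {t : ℝ} (ht : 0 < t) (hE : EE m (Th m z) t ≤ 1/4) (hΩ' : MeasurableSet {g : E n | SS m z t (√t • g) < 1}) :
    ofReal (1/2) ≤ ofReal (((2 * Real.pi) ^ ((n : ℝ) / 2))⁻¹) * volume {g : E n | SS m z t (√t • g) < 1} := by
  have h3 : 1/2 ≤ EE m (fun t θ => 1 - 2 * Th m z t θ) t := by
    rw [EE_sub m (EB.const 1) ((Th_eb z).cmul 2), EE_const m 1 ht.le, EE_cmul]; linarith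
  rw [EE, integral_gam] at h3
  have hi : Integrable (fun g => (1 - 2 * Th m z t (√t • g)) * Zt m t (√t • g) * gd g) :=
    integrable_gam.1 (EE_int m ((EB.const 1).sub ((Th_eb (m := m) z).cmul 2)) t)
  refine (ofReal_le_ofReal h3).trans (le_trans (b := ∫⁻ g, ofReal ((1 - 2 * Th m z t (√t • g)) * Zt m t (√t • g) * gd g)) ?_ ?_)
  · rw [integral_eq_lintegral_pos_part_sub_lintegral_neg_part hi]
    exact (ofReal_le_ofReal (sub_le_self _ ENNReal.toReal_nonneg)).trans ENNReal.ofReal_toReal_le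
  rw [← lintegral_indicator_const hΩ']
  refine lintegral_mono fun g => ?_
  have hz := mul_pos (Zt_pos m t (√t • g)) (gd_pos g)
  have t0 := Th_nonneg (m := m) z t (√t • g)
  simp only [mul_assoc]
  by_cases hg : SS m z t (√t • g) < 1
  · rw [indicator_of_mem (show g ∈ {g : E n | SS m z t (√t • g) < 1} from hg)]
    refine ofReal_le_ofReal (le_trans ?_ (Zgd_le (m := m) ht.le g))
    nlinarith
  · rw [indicator_of_notMem (show g ∉ {g : E n | SS m z t (√t • g) < 1} from hg), ENNReal.ofReal_of_nonpos]
    have : 1/2 ≤ Th m z t (√t • g) := by rw [Th, le_div_iff₀ (by linarith)]; linarith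
    nlinarith
lemma Iso.vol (h : Iso m K) (hn : 1 ≤ n) {z : ℕ} {t : ℝ} (ht : 0 < t) (hE : EE m (Th m z) t ≤ 1/4) :
    ofReal ((√t/2)^n) ≤ volume K := by
  have hc : Continuous (SS m z t) := by
    obtain ⟨d, hd⟩ := SS_gen (m := m) z
    exact hd.eb.cont t
  have hΩ : MeasurableSet {θ : E n | SS m z t θ < 1} := (isOpen_lt hc continuous_const).measurableSet
  have hst : 0 < √t := sqrt_pos.2 ht
  refine le_trans ?_ (vol_a h z ht hΩ)
  have h4 := vol_b ht hE (hΩ.preimage (f := fun g : E n => √t • g) (by fun_prop))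
  change _ ≤ _ * volume ((fun g : E n => √t • g) ⁻¹' {θ : E n | SS m z t θ < 1}) at h4
  rw [Measure.addHaar_preimage_smul volume hst.ne', finrank_euclideanSpace_fin, abs_of_pos (by positivity)] at h4
  generalize volume {θ : E n | SS m z t θ < 1} = V at *
  obtain ⟨κ, hκd⟩ : ∃ κ : ℝ, κ = ((2 * Real.pi) ^ ((n : ℝ) / 2))⁻¹ := ⟨_, rfl⟩
  rw [← hκd] at h4
  have hκ : 0 < κ := by rw [hκd]; positivity
  have hpi : √t^n ≤ κ⁻¹ * (1/2) * √t^n := by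
    have h5 : (2:ℝ) ≤ κ⁻¹ := by
      rw [hκd, inv_inv]
      have h6 : (4:ℝ)^((1:ℝ)/2) = 2 := by
        rw [← Real.sqrt_eq_rpow, show (4:ℝ) = 2^2 by norm_num, sqrt_sq (by norm_num)]
      refine h6.symm.le.trans ?_
      have hn' : (1:ℝ) ≤ n := by exact_mod_cast hn
      calc (4:ℝ)^((1:ℝ)/2) ≤ 4^((n:ℝ)/2) := Real.rpow_le_rpow_of_exponent_le (by norm_num) (by linarith)
        _ ≤ (2 * Real.pi)^((n:ℝ)/2) := Real.rpow_le_rpow (by norm_num) (by linarith [Real.pi_gt_three]) (by positivity)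
    have := pow_pos hst n
    nlinarith
  calc ofReal ((√t/2)^n) = ofReal ((1/2 : ℝ)^n) * ofReal (√t^n) := by
        rw [← ofReal_mul (by positivity)]; congr 1; rw [← mul_pow]; ring
    _ ≤ ofReal ((1/2 : ℝ)^n) * (ofReal (κ⁻¹ * √t^n) * ofReal (1/2)) := by
        gcongr; rw [← ofReal_mul (by positivity)]; exact ofReal_le_ofReal (by linarith)
    _ ≤ ofReal ((1/2 : ℝ)^n) * (ofReal (κ⁻¹ * √t^n) * (ofReal κ * (ofReal (√t^n)⁻¹ * V))) := by gcongr
    _ = ofReal ((1/2 : ℝ)^n) * (ofReal (κ⁻¹ * √t^n * κ * (√t^n)⁻¹) * V) := by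
        rw [ofReal_mul (p := κ⁻¹ * √t^n * κ) (by positivity), ofReal_mul (p := κ⁻¹ * √t^n) (by positivity)]; ring
    _ = _ := by
        have : κ⁻¹ * √t^n * κ * (√t^n)⁻¹ = 1 := by have := (pow_pos hst n).ne'; field_simp
        rw [this]; simp
end
end SL
end
section
namespace SL
variable {n : ℕ}
set_option linter.unusedSectionVars false
def XB (f : E n → ℝ) : Prop := Continuous f ∧ ∃ C c : ℝ, 0 ≤ C ∧ 0 ≤ c ∧ ∀ x, |f x| ≤ C * exp (c * ‖x‖)
lemma le_exp' (x : ℝ) : x ≤ exp x := by linarith [add_one_le_exp x]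
lemma XB.mulc {f : E n → ℝ} (h : XB f) (k : Fin n) : XB fun x => x k * f x := by
  obtain ⟨hc, C, c, hC, h0, h⟩ := h
  refine ⟨by fun_prop, C, c + 1, hC, by positivity, fun x => ?_⟩
  rw [abs_mul, add_mul, exp_add, ← mul_assoc, one_mul, mul_comm]
  exact mul_le_mul (h x) ((abs_coord_le x k).trans (le_exp' _)) (abs_nonneg _) (by positivity)
def QQ (f : E n → ℝ) (w : E n) : ℝ := ∫ z, f z * exp ⟪z, w⟫ ∂(gam n)
lemma XB.int {f : E n → ℝ} (h : XB f) (w : E n) : Integrable (fun z => f z * exp ⟪z, w⟫) (gam n) := by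
  obtain ⟨hc, C, c, hC, h0, h⟩ := h
  refine integrable_of_exp (C := C) (c := c + ‖w‖) (by fun_prop) fun x => ?_
  rw [abs_mul, abs_exp, add_mul, exp_add, ← mul_assoc]
  exact mul_le_mul (h x) (exp_le_exp.2 ((real_inner_le_norm _ _).trans_eq (mul_comm _ _))) (by positivity) (by positivity)
lemma QQ_fd {f : E n → ℝ} (h : XB f) (w : E n) : HasFDerivAt (QQ f) (DS fun k => QQ (fun z => z k * f z) w) w := by
  obtain ⟨hc, C, c, hC, h0, hb⟩ := id h
  have key := hasFDerivAt_integral_of_dominated_of_fderiv_le (μ := gam n) (𝕜 := ℝ) (F := fun w z => f z * exp ⟪z, w⟫)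
    (F' := fun w z => (f z * exp ⟪z, w⟫) • innerSL ℝ z) (x₀ := w) (s := ball w 1) (bound := fun z => C * exp ((c + (‖w‖ + 2)) * ‖z‖))
    (ball_mem_nhds w one_pos) (Eventually.of_forall fun w => (h.int w).aestronglyMeasurable) (h.int w)
    (by have : Continuous fun z : E n => (f z * exp ⟪z, w⟫) • innerSL ℝ z := by fun_prop
        exact this.aestronglyMeasurable)
    (by
      refine Eventually.of_forall fun z v hv => ?_
      rw [norm_smul, innerSL_apply_norm, norm_mul, norm_eq_abs, norm_eq_abs, abs_exp]
      have e1 : ‖v‖ ≤ ‖w‖ + 1 := by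
        have := norm_sub_norm_le v w
        rw [mem_ball, dist_eq_norm] at hv; linarith
      calc |f z| * exp ⟪z, v⟫ * ‖z‖ ≤ (C * exp (c * ‖z‖)) * exp ((‖w‖ + 1) * ‖z‖) * exp ‖z‖ := by
            gcongr
            · exact hb z
            · refine (real_inner_le_norm _ _).trans ?_
              rw [mul_comm]; gcongr
            · exact le_exp' _
        _ = _ := by rw [mul_assoc, mul_assoc, ← exp_add, ← exp_add]; ring_nf)
    ((integrable_exp_gam _).const_mul C)
    (by
      refine Eventually.of_forall fun z v _ => ?_
      refine (((innerSL ℝ z).hasFDerivAt (x := v)).exp.const_mul (f z)).congr_fderiv ?_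
      rw [smul_smul]; rfl)
  refine key.congr_fderiv ?_
  have hi : Integrable (fun z => (f z * exp ⟪z, w⟫) • innerSL ℝ z) (gam n) := by
    refine Integrable.mono' ((integrable_exp_gam (c + (‖w‖ + 1))).const_mul C) ?_ ?_
    · have : Continuous fun z : E n => (f z * exp ⟪z, w⟫) • innerSL ℝ z := by fun_prop
      exact this.aestronglyMeasurable
    · refine Eventually.of_forall fun z => ?_
      rw [norm_smul, innerSL_apply_norm, norm_mul, norm_eq_abs, norm_eq_abs, abs_exp]
      calc |f z| * exp ⟪z, w⟫ * ‖z‖ ≤ (C * exp (c * ‖z‖)) * exp (‖w‖ * ‖z‖) * exp ‖z‖ := by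
            gcongr
            · exact hb z
            · exact (real_inner_le_norm _ _).trans_eq (mul_comm _ _)
            · exact le_exp' _
        _ = _ := by rw [mul_assoc, mul_assoc, ← exp_add, ← exp_add]; ring_nf
  ext y
  rw [ContinuousLinearMap.integral_apply hi, DS_apply]
  simp only [QQ, ← integral_mul_const]
  rw [← integral_finsetSum _ fun k _ => ((h.mulc k).int w).mul_const _]
  refine integral_congr_ae (Eventually.of_forall fun z => ?_)
  change f z * exp ⟪z, w⟫ * ⟪z, y⟫ = _
  rw [PiLp.inner_apply z y, mul_sum]
  exact sum_congr rfl fun k _ => by simp; ring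
lemma ge_fd {f : E n → ℝ} {a : Fin n → ℝ} {w : E n} (h : HasFDerivAt f (DS a) w) :
    HasFDerivAt (fun w => exp (-(‖w‖^2/2)) * f w) (DS fun k => exp (-(‖w‖^2/2)) * (a k - w k * f w)) w := by
  have h1 : HasFDerivAt (fun w : E n => -(‖w‖^2/2)) (-((1/2:ℝ) • (2 • innerSL ℝ w))) w := by
    refine ((hasStrictFDerivAt_norm_sq w).hasFDerivAt.const_mul (1/2:ℝ)).neg.congr_of_eventuallyEq (Eventually.of_forall fun w => ?_)
    simp; ring
  refine (h1.exp.mul h).congr_fderiv ?_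
  ext y
  have e : ⟪w, y⟫ = ∑ k, w k * y k := by rw [PiLp.inner_apply]; exact sum_congr rfl fun k _ => by simp [mul_comm]
  rw [DS_apply]
  have : ∑ k, exp (-(‖w‖^2/2)) * (a k - w k * f w) * y k = exp (-(‖w‖^2/2)) * (∑ k, a k * y k - f w * ⟪w, y⟫) := by
    rw [e, mul_sum, ← sum_sub_distrib, mul_sum]
    exact sum_congr rfl fun k _ => by ring
  rw [this]
  simp [DS_apply]; ring
def PP (h : E n → ℝ) (w : E n) : ℝ := exp (-(‖w‖^2/2)) * QQ h w
def p1 (h : E n → ℝ) (i : Fin n) (w : E n) : ℝ := exp (-(‖w‖^2/2)) * (QQ (fun z => z i * h z) w - w i * QQ h w)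
def p2 (h : E n → ℝ) (i j : Fin n) (w : E n) : ℝ := exp (-(‖w‖^2/2)) *
  (QQ (fun z => z j * (z i * h z)) w - (w i * QQ (fun z => z j * h z) w + (if i = j then 1 else 0) * QQ h w) -
    w j * (QQ (fun z => z i * h z) w - w i * QQ h w))
section
variable {h : E n → ℝ}
lemma PP_fd (hh : XB h) (w : E n) : HasFDerivAt (PP h) (DS fun k => p1 h k w) w := ge_fd (QQ_fd hh w)
lemma p1_fd (hh : XB h) (i : Fin n) (w : E n) : HasFDerivAt (p1 h i) (DS fun k => p2 h i k w) w := by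
  refine ge_fd ((((QQ_fd (hh.mulc i) w).sub (((EuclideanSpace.proj i : E n →L[ℝ] ℝ).hasFDerivAt (x := w)).mul (QQ_fd hh w)))).congr_fderiv ?_)
  ext y
  simp only [DS_apply, sub_apply, add_apply, smul_apply, smul_eq_mul, sub_mul, add_mul,
    sum_sub_distrib, sum_add_distrib, mul_sum, ite_mul, one_mul, zero_mul, Finset.sum_ite_eq, Finset.mem_univ, if_true, mul_assoc]
  rfl
lemma PP_eq (w : E n) : PP h w = ∫ x, h (x + w) ∂(gam n) := by
  rw [gam_shift, PP, QQ, ← integral_const_mul]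
  congr 1; ext z
  rw [mul_left_comm, ← exp_add]; ring_nf
lemma p2_cont (hh : XB h) (i j : Fin n) : Continuous (p2 h i j) := by
  have c : ∀ {f : E n → ℝ}, XB f → Continuous (QQ f) := fun hf => continuous_iff_continuousAt.2 fun w => (QQ_fd hf w).continuousAt
  have c0 := c hh
  have c1 := c (hh.mulc i)
  have c2 := c (hh.mulc j)
  have c3 := c ((hh.mulc i).mulc j)
  unfold p2; fun_prop
lemma p1_cont (hh : XB h) (i : Fin n) : Continuous (p1 h i) := continuous_iff_continuousAt.2 fun w => (p1_fd hh i w).continuousAt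
lemma PP_cont (hh : XB h) : Continuous (PP h) := continuous_iff_continuousAt.2 fun w => (PP_fd hh w).continuousAt
structure Sub (h : E n → ℝ) (R : ℝ) : Prop where
  R0 : 0 ≤ R
  add : ∀ x y, h (x + y) ≤ h x + h y
  hom : ∀ c : ℝ, 0 ≤ c → ∀ x, h (c • x) = c * h x
  bd : ∀ x, |h x| ≤ R * ‖x‖
variable {R : ℝ}
lemma Sub.lip (s : Sub h R) (x y : E n) : h x ≤ h y + R * ‖x - y‖ := by
  have := s.add y (x - y)
  rw [add_sub_cancel] at this
  linarith [le_abs_self (h (x - y)), s.bd (x - y)]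
lemma Sub.cont (s : Sub h R) : Continuous h := by
  refine (LipschitzWith.of_dist_le_mul (K := R.toNNReal) fun x y => ?_).continuous
  rw [Real.dist_eq, dist_eq_norm, abs_le]
  have := s.lip x y
  have h2 := s.lip y x
  rw [norm_sub_rev] at h2
  rw [Real.coe_toNNReal _ s.R0]
  constructor <;> linarith
lemma Sub.xb (s : Sub h R) : XB h := ⟨s.cont, R, 1, s.R0, zero_le_one, fun x => (s.bd x).trans (by
  rw [one_mul]; exact mul_le_mul_of_nonneg_left (le_exp' _) s.R0)⟩
lemma Sub.zero (s : Sub h R) : h 0 = 0 := by simpa using s.hom 0 le_rfl 0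
lemma Sub.intg (s : Sub h R) (w : E n) : Integrable (fun x => h (x + w)) (gam n) := by
  have c := s.cont
  refine integrable_of_exp (C := R * exp ‖w‖) (c := 1) (by fun_prop) fun x => (s.bd _).trans ?_
  rw [mul_assoc, ← exp_add, one_mul]
  exact mul_le_mul_of_nonneg_left (((norm_add_le x w).trans (le_exp' _)).trans_eq (by rw [add_comm])) s.R0
lemma Sub.conv (s : Sub h R) (w v : E n) : ConvexOn ℝ univ fun r : ℝ => PP h (w + r • v) := by
  refine ⟨convex_univ, fun x _ y _ a b ha hb hab => ?_⟩
  simp only [PP_eq, smul_eq_mul]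
  rw [← integral_const_mul, ← integral_const_mul, ← integral_add ((s.intg _).const_mul _) ((s.intg _).const_mul _)]
  refine integral_mono (s.intg _) (((s.intg _).const_mul _).add ((s.intg _).const_mul _)) fun g => ?_
  have e : g + (w + (a * x + b * y) • v) = a • (g + (w + x • v)) + b • (g + (w + y • v)) := by
    have : g + w = (a + b) • (g + w) := by rw [hab, one_smul]
    rw [← add_assoc, this]; module
  simp only [e]
  exact (s.add _ _).trans_eq (by rw [s.hom a ha, s.hom b hb])
lemma PP_line (hh : XB h) (w v : E n) (r : ℝ) : HasDerivAt (fun r : ℝ => PP h (w + r • v)) (∑ k, p1 h k (w + r • v) * v k) r := by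
  have h1 : HasDerivAt (fun r : ℝ => w + r • v) v r := by simpa using ((hasDerivAt_id r).smul_const v).const_add w
  exact ((PP_fd hh _).comp_hasDerivAt r h1).congr_deriv (DS_apply _ _)
lemma Sub.grad (s : Sub h R) (w v : E n) : ∑ k, p1 h k w * v k ≤ PP h (w + v) - PP h w := by
  have := (s.conv w v).le_slope_of_hasDerivAt (mem_univ 0) (mem_univ 1) one_pos (by simpa using PP_line s.xb w v 0)
  simpa [slope] using this
lemma Sub.hess (s : Sub h R) (w v : E n) : 0 ≤ ∑ i, v i * ∑ j, p2 h i j w * v j := by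
  have hm : Monotone fun r : ℝ => ∑ k, p1 h k (w + r • v) * v k := by
    have := (s.conv w v).monotoneOn_deriv fun x _ => (PP_line s.xb w v x).differentiableAt
    intro x y hxy
    simpa only [(PP_line s.xb w v _).deriv] using this (mem_univ x) (mem_univ y) hxy
  have h1 : HasDerivAt (fun r : ℝ => w + r • v) v 0 := by simpa using ((hasDerivAt_id (0:ℝ)).smul_const v).const_add w
  have hd : HasDerivAt (fun r : ℝ => ∑ k, p1 h k (w + r • v) * v k) (∑ i, v i * ∑ j, p2 h i j w * v j) 0 := by
    have : ∀ i, HasDerivAt (fun r : ℝ => p1 h i (w + r • v) * v i) (v i * ∑ j, p2 h i j w * v j) 0 := fun i => by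
      have h2 := p1_fd s.xb i (w + (0:ℝ) • v)
      refine ((h2.comp_hasDerivAt (0:ℝ) h1).mul_const (v i)).congr_deriv ?_
      rw [DS_apply, zero_smul, add_zero, mul_comm]
    simpa using HasDerivAt.fun_sum fun i (_ : i ∈ Finset.univ) => this i
  rw [← hd.deriv]
  exact hm.deriv_nonneg
lemma Sub.grad_le (s : Sub h R) (w v : E n) : ∑ k, p1 h k w * v k ≤ h v := by
  refine (s.grad w v).trans ?_
  have : PP h (w + v) ≤ ∫ x, (h (x + w) + h v) ∂(gam n) := by
    rw [PP_eq]
    refine integral_mono (s.intg _) ((s.intg w).add (integrable_const _)) fun x => ?_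
    simp only [← add_assoc]; exact s.add _ _
  rw [integral_add (s.intg w) (integrable_const _)] at this
  simp at this
  rw [PP_eq w]; linarith
lemma Sub.le_PP (s : Sub h R) (w : E n) : h w ≤ PP h w := by
  have h1 : PP h w = ∫ x, h (-x + w) ∂(gam n) := by rw [gam_neg fun x => h (x + w), PP_eq]
  have h2 := s.intg w
  have h3 : Integrable (fun x => h (-x + w)) (gam n) := by
    have c := s.cont
    refine integrable_of_exp (C := R * exp ‖w‖) (c := 1) (by fun_prop) fun x => (s.bd _).trans ?_
    rw [mul_assoc, ← exp_add, one_mul]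
    exact mul_le_mul_of_nonneg_left (((norm_add_le (-x) w).trans (le_exp' _)).trans_eq (by rw [add_comm, norm_neg])) s.R0
  have : ∫ _ : E n, 2 * h w ∂(gam n) ≤ ∫ x, (h (x + w) + h (-x + w)) ∂(gam n) := by
    refine integral_mono (integrable_const _) (h2.add h3) fun x => ?_
    have := s.add (x + w) (-x + w)
    rw [show x + w + (-x + w) = (2:ℝ) • w by module, s.hom 2 (by norm_num)] at this
    exact this
  rw [integral_add h2 h3, ← h1, ← PP_eq] at this
  simp at this; linarith
lemma gd8_int (c : ℝ) : Integrable fun z : E n => exp (c * ‖z‖) * exp (-(‖z‖^2/8)) := by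
  have h1 := (integrable_gam.1 (integrable_exp_gam (n := n) (2 * c))).comp_smul (R := (1/2 : ℝ)) (by norm_num)
  refine (h1.const_mul ((2 * Real.pi) ^ ((n : ℝ) / 2))).congr (Eventually.of_forall fun z => ?_)
  have : (2 * Real.pi) ^ ((n : ℝ) / 2) ≠ 0 := by positivity
  simp only [gd, norm_smul]
  rw [mul_left_comm, mul_inv_cancel_left₀ this]
  norm_num
  ring_nf
lemma Sub.euler (s : Sub h R) (w : E n) : ∑ k, QQ (fun z => z k * (z k * h z)) w = ∑ k, w k * QQ (fun z => z k * h z) w + (n + 1) * QQ h w := by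
  obtain ⟨hc, C, c, hC, h0, hb⟩ := s.xb
  set ψ : ℝ → ℝ := fun ρ => ∫ z, h z * exp (ρ * ⟪z, w⟫ - ρ^2 * ‖z‖^2/2)
  have hi1 : ∀ ρ : ℝ, 1/2 ≤ ρ → ρ ≤ 3/2 → ∀ z : E n, exp (ρ * ⟪z, w⟫ - ρ^2 * ‖z‖^2/2) ≤ exp ((2 * ‖w‖) * ‖z‖) * exp (-(‖z‖^2/8)) := fun ρ h1 h2 z => by
    rw [← exp_add]
    have := abs_le.1 (abs_real_inner_le_norm z w)
    refine exp_le_exp.2 ?_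
    have h3 : ρ * ⟪z, w⟫ ≤ ρ * (‖z‖ * ‖w‖) := mul_le_mul_of_nonneg_left this.2 (by linarith)
    have h4 : 0 ≤ ‖z‖ * ‖w‖ := by positivity
    nlinarith [mul_nonneg (sq_nonneg ‖z‖) (by nlinarith : 0 ≤ ρ^2 - 1/4)]
  have hi0 : ∀ ρ : ℝ, 1/2 ≤ ρ → ρ ≤ 3/2 → Integrable fun z => h z * exp (ρ * ⟪z, w⟫ - ρ^2 * ‖z‖^2/2) := fun ρ h1 h2 => by
    refine Integrable.mono' ((gd8_int (n := n) (c + 2 * ‖w‖)).const_mul C) (by fun_prop) (Eventually.of_forall fun z => ?_)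
    rw [norm_mul, norm_eq_abs, norm_eq_abs, abs_exp, add_mul, exp_add, mul_assoc, ← mul_assoc]
    exact mul_le_mul (hb z) (hi1 ρ h1 h2 z) (by positivity) (by positivity)
  have key := (hasDerivAt_integral_of_dominated_loc_of_deriv_le (μ := (volume : Measure (E n))) (F := fun ρ z => h z * exp (ρ * ⟪z, w⟫ - ρ^2 * ‖z‖^2/2))
    (F' := fun ρ z => h z * (exp (ρ * ⟪z, w⟫ - ρ^2 * ‖z‖^2/2) * (⟪z, w⟫ - ρ * ‖z‖^2))) (x₀ := 1) (s := ball 1 (1/2))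
    (bound := fun z => C * (‖w‖ + 2) * (exp ((c + 2 * ‖w‖ + 2) * ‖z‖) * exp (-(‖z‖^2/8))))
    (ball_mem_nhds _ (by norm_num)) (Eventually.of_forall fun ρ => by fun_prop) (hi0 1 (by norm_num) (by norm_num)) (by fun_prop)
    (by
      refine Eventually.of_forall fun z ρ hρ => ?_
      rw [mem_ball, Real.dist_eq, abs_lt] at hρ
      rw [norm_mul, norm_mul, norm_eq_abs, norm_eq_abs, norm_eq_abs, abs_exp]
      have e1 : |⟪z, w⟫ - ρ * ‖z‖^2| ≤ (‖w‖ + 2) * exp (2 * ‖z‖) := by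
        have := abs_le.1 (abs_real_inner_le_norm z w)
        have hz := norm_nonneg z
        have hw := norm_nonneg w
        have e2 : exp (2 * ‖z‖) = exp ‖z‖ ^ 2 := by rw [← Real.exp_nat_mul]; norm_num
        have e3 := add_one_le_exp ‖z‖
        have e4 : ‖z‖ ≤ exp ‖z‖^2 := by nlinarith
        have e5 : ‖z‖^2 ≤ exp ‖z‖^2 := by gcongr; linarith
        have e6 : ‖z‖ * ‖w‖ ≤ ‖w‖ * exp ‖z‖^2 := by rw [mul_comm]; gcongr
        have e7 : 0 ≤ ‖z‖^2 := sq_nonneg _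
        rw [e2, abs_le]; constructor <;> nlinarith
      calc |h z| * (exp (ρ * ⟪z, w⟫ - ρ^2 * ‖z‖^2/2) * |⟪z, w⟫ - ρ * ‖z‖^2|) ≤
          (C * exp (c * ‖z‖)) * ((exp ((2 * ‖w‖) * ‖z‖) * exp (-(‖z‖^2/8))) * ((‖w‖ + 2) * exp (2 * ‖z‖))) := by
            gcongr
            · exact hb z
            · exact hi1 ρ (by linarith) (by linarith) z
        _ = _ := by rw [show (c + 2 * ‖w‖ + 2) * ‖z‖ = c * ‖z‖ + 2 * ‖w‖ * ‖z‖ + 2 * ‖z‖ by ring, exp_add, exp_add]; ring)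
    ((gd8_int _).const_mul _)
    (by
      refine Eventually.of_forall fun z ρ _ => ?_
      have : HasDerivAt (fun ρ : ℝ => ρ * ⟪z, w⟫ - ρ^2 * ‖z‖^2/2) (⟪z, w⟫ - ρ * ‖z‖^2) ρ := by
        refine (((hasDerivAt_id ρ).mul_const ⟪z, w⟫).sub ((((hasDerivAt_id ρ).pow 2).mul_const (‖z‖^2)).div_const 2)).congr_deriv ?_
        simp; ring
      exact this.exp.const_mul _)).2
  have hconst : ∀ᶠ ρ in nhds (1:ℝ), ρ^(n+1) * ψ ρ = ψ 1 := by
    filter_upwards [lt_mem_nhds one_pos] with ρ hρ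
    have := Measure.integral_comp_smul (volume : Measure (E n)) (fun z => h z * exp (1 * ⟪z, w⟫ - 1^2 * ‖z‖^2/2)) ρ
    rw [finrank_euclideanSpace_fin, abs_of_pos (by positivity), smul_eq_mul] at this
    have e : ∫ z, h (ρ • z) * exp (1 * ⟪ρ • z, w⟫ - 1^2 * ‖ρ • z‖^2/2) = ρ * ψ ρ := by
      rw [← integral_const_mul]; congr 1; ext z
      rw [s.hom ρ hρ.le, real_inner_smul_left, norm_smul, norm_of_nonneg hρ.le]; ring_nf
    rw [e] at this
    rw [pow_succ, mul_assoc, this, mul_inv_cancel_left₀ (by positivity)]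
  have hd := (((hasDerivAt_id (1:ℝ)).pow (n+1)).mul key).unique ((hasDerivAt_const (1:ℝ) (ψ 1)).congr_of_eventuallyEq hconst)
  have hk : (2 * Real.pi) ^ ((n : ℝ) / 2) ≠ 0 := by positivity
  have cv : ∀ f : E n → ℝ, (2 * Real.pi) ^ ((n : ℝ) / 2) * QQ f w = ∫ z, f z * exp (1 * ⟪z, w⟫ - 1^2 * ‖z‖^2/2) := fun f => by
    rw [QQ, integral_gam, ← integral_const_mul]; congr 1; ext z
    rw [gd, sub_eq_add_neg, exp_add]
    field_simp
  have i1 := fun k => ((s.xb.mulc k).int w)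
  have i2 := fun k => (((s.xb.mulc k).mulc k).int w)
  have e1 : ∑ k, w k * QQ (fun z => z k * h z) w - ∑ k, QQ (fun z => z k * (z k * h z)) w = QQ (fun z => h z * (⟪z, w⟫ - 1 * ‖z‖^2)) w := by
    simp only [QQ, ← integral_const_mul]
    rw [← integral_finsetSum _ fun k _ => (i1 k).const_mul _, ← integral_finsetSum _ fun k _ => i2 k,
      ← integral_sub (integrable_finsetSum _ fun k _ => (i1 k).const_mul _) (integrable_finsetSum _ fun k _ => i2 k)]
    congr 1; ext z
    rw [PiLp.inner_apply, EuclideanSpace.real_norm_sq_eq, one_mul, ← sum_sub_distrib, ← sum_sub_distrib, mul_sum, sum_mul]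
    exact sum_congr rfl fun k _ => by simp; ring
  have e2 : ∫ z, h z * (exp (1 * ⟪z, w⟫ - 1^2 * ‖z‖^2/2) * (⟪z, w⟫ - 1 * ‖z‖^2)) = (2 * Real.pi) ^ ((n : ℝ) / 2) * QQ (fun z => h z * (⟪z, w⟫ - 1 * ‖z‖^2)) w := by
    rw [cv]; congr 1; ext z; ring
  rw [e2, ← e1, ← cv h] at hd
  simp only [id, one_pow, mul_one, one_mul, Nat.cast_add, Nat.cast_one] at hd
  have := mul_left_cancel₀ hk (show (2 * Real.pi) ^ ((n : ℝ) / 2) * ((n + 1) * QQ h w + (∑ k, w k * QQ (fun z => z k * h z) w - ∑ k, QQ (fun z => z k * (z k * h z)) w)) = (2 * Real.pi) ^ ((n : ℝ) / 2) * 0 by rw [mul_zero, ← hd]; simp; ring)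
  linarith
lemma Sub.lap (s : Sub h R) (w : E n) : ∑ i, p2 h i i w = PP h w - ∑ i, p1 h i w * w i := by
  have e1 : ∑ i, p2 h i i w = exp (-(‖w‖^2/2)) * (∑ k, QQ (fun z => z k * (z k * h z)) w - 2 * ∑ k, w k * QQ (fun z => z k * h z) w - n * QQ h w + (∑ k, w k^2) * QQ h w) := by
    have : (n : ℝ) * QQ h w = ∑ _k : Fin n, QQ h w := by simp
    rw [this, mul_sum, sum_mul, ← sum_sub_distrib, ← sum_sub_distrib, ← sum_add_distrib, mul_sum]
    exact sum_congr rfl fun k _ => by simp [p2]; ring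
  have e2 : ∑ i, p1 h i w * w i = exp (-(‖w‖^2/2)) * (∑ k, w k * QQ (fun z => z k * h z) w - (∑ k, w k^2) * QQ h w) := by
    rw [sum_mul, ← sum_sub_distrib, mul_sum]
    exact sum_congr rfl fun k _ => by simp [p1]; ring
  rw [e1, e2, s.euler, PP]; ring
lemma Sub.lap_le (s : Sub h R) (w : E n) : ∑ i, p2 h i i w ≤ PP h 0 := by
  have := s.grad w (-w)
  rw [add_neg_cancel] at this
  simp only [PiLp.neg_apply, mul_neg, Finset.sum_neg_distrib] at this
  rw [s.lap]; linarith
end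
end SL
end
section
namespace SL
variable {n : ℕ}
set_option linter.unusedSectionVars false
section
variable {m : Measure (E n)} [CSupp m] {h : E n → ℝ}
lemma comp_DL {f : E n → ℝ} {a : Fin n → ℝ} {w : Fin n → ℝ → E n → ℝ} {wt : Fin n → ℝ} {d : Fin n → Fin n → ℝ} {t : ℝ} {θ : E n}
    (hf : HasFDerivAt f (DS a) (vec fun i => w i t θ)) (hw : ∀ i, HasFDerivAt (fun p : ℝ × E n => w i p.1 p.2) (DL (wt i) (d i)) (t, θ)) :
    HasFDerivAt (fun p : ℝ × E n => f (vec fun i => w i p.1 p.2)) (DL (∑ i, a i * wt i) (fun k => ∑ i, a i * d i k)) (t, θ) := by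
  have h1 : HasFDerivAt (fun (p : ℝ × E n) i => w i p.1 p.2) (ContinuousLinearMap.pi fun i => DL (wt i) (d i)) (t, θ) := hasFDerivAt_pi.2 hw
  have h2 := (PiLp.hasFDerivAt_toLp (𝕜 := ℝ) 2 (fun i => w i t θ)).comp (t, θ) h1
  refine (hf.comp (t, θ) h2).congr_fderiv (ContinuousLinearMap.ext fun ⟨s, y⟩ => ?_)
  refine (DS_apply _ _).trans ?_
  rw [DL_apply]
  have : ∀ k, a k * DL (wt k) (d k) (s, y) = a k * wt k * s + ∑ j, a k * d k j * y j := fun k => by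
    rw [DL_apply, mul_add, mul_sum, ← mul_assoc]; simp only [mul_assoc]
  refine (sum_congr rfl fun k _ => this k).trans ?_
  rw [sum_add_distrib, sum_mul, sum_comm]
  simp only [sum_mul]
lemma Gen.compV {w l : Fin n → ℝ → E n → ℝ} {d : Fin n → Fin n → ℝ → E n → ℝ} (hw : ∀ i, Gen m (w i) (l i) (d i)) (hh : XB h)
    (e0 : EB fun t θ => PP h (vec fun i => w i t θ)) (e1 : ∀ i, EB fun t θ => p1 h i (vec fun i => w i t θ))
    (e2 : ∀ i j, EB fun t θ => p2 h i j (vec fun i => w i t θ)) :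
    Gen m (fun t θ => PP h (vec fun i => w i t θ))
      (fun t θ => ∑ i, p1 h i (vec fun i => w i t θ) * l i t θ + 1/2 * ∑ i, ∑ j, p2 h i j (vec fun i => w i t θ) * ∑ k, d i k t θ * d j k t θ)
      (fun k t θ => ∑ i, p1 h i (vec fun i => w i t θ) * d i k t θ) := by
  choose Ft D2 hr hl using hw
  refine ⟨fun t θ => ∑ i, p1 h i (vec fun i => w i t θ) * Ft i t θ,
    fun k t θ => ∑ i, ((∑ j, p2 h i j (vec fun i => w i t θ) * d j k t θ) * d i k t θ + p1 h i (vec fun i => w i t θ) * D2 i k t θ),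
    ⟨e0, EB.sum _ fun i => (e1 i).mul (hr i).eHt, fun k => EB.sum _ fun i => (e1 i).mul ((hr i).ed k),
      fun k => EB.sum _ fun i => ((EB.sum _ fun j => (e2 i j).mul ((hr j).ed k)).mul ((hr i).ed k)).add ((e1 i).mul ((hr i).eD2 k)), ?_, ?_⟩, ?_⟩
  · exact fun t ht θ => comp_DL (PP_fd hh _) fun i => (hr i).hF t ht θ
  · intro k t ht θ
    have : ∀ i, HasLineDerivAt ℝ (fun θ => p1 h i (vec fun i => w i t θ) * d i k t θ)
        ((∑ j, p2 h i j (vec fun i => w i t θ) * d j k t θ) * d i k t θ + p1 h i (vec fun i => w i t θ) * D2 i k t θ) θ (SL.eb k) := fun i =>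
      hasLine_mul (line_of (F := fun t θ => p1 h i (vec fun i => w i t θ)) (comp_DL (p1_fd hh i _) fun i => (hr i).hF t ht θ) k) ((hr i).h2 k t ht θ)
    exact HasDerivAt.fun_sum fun i _ => this i
  · intro t θ
    simp only [hl]
    generalize (vec fun i => w i t θ) = W
    have a1 : ∑ k, ∑ i, ((∑ j, p2 h i j W * d j k t θ) * d i k t θ + p1 h i W * D2 i k t θ) =
        ∑ i, ∑ j, p2 h i j W * ∑ k, d i k t θ * d j k t θ + ∑ i, p1 h i W * ∑ k, D2 i k t θ := by
      rw [sum_comm, ← sum_add_distrib]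
      refine sum_congr rfl fun i _ => ?_
      rw [sum_add_distrib, mul_sum]
      congr 1
      simp only [sum_mul, mul_sum]
      rw [sum_comm]
      exact sum_congr rfl fun j _ => sum_congr rfl fun k _ => by ring
    have a2 : ∑ k, av m k t θ * ∑ i, p1 h i W * d i k t θ = ∑ i, p1 h i W * ∑ k, av m k t θ * d i k t θ := by
      simp only [mul_sum]
      rw [sum_comm]
      exact sum_congr rfl fun j _ => sum_congr rfl fun k _ => by ring
    have a3 : ∑ i, p1 h i W * (Ft i t θ + 1/2 * ∑ k, D2 i k t θ + ∑ k, av m k t θ * d i k t θ) =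
        ∑ i, p1 h i W * Ft i t θ + 1/2 * ∑ i, p1 h i W * ∑ k, D2 i k t θ + ∑ i, p1 h i W * ∑ k, av m k t θ * d i k t θ := by
      rw [mul_sum, ← sum_add_distrib, ← sum_add_distrib]
      exact sum_congr rfl fun i _ => by ring
    rw [a1, a2, a3]; ring
lemma EB.comp {φ : E n → ℝ} (hφ : Continuous φ) {w : Fin n → ℝ → E n → ℝ} (hw : ∀ i, Continuous (Function.uncurry (w i)))
    (hb : ∀ T : ℝ, ∃ C, ∀ t θ, |t| ≤ T → ∑ i, w i t θ^2 ≤ C) : EB fun t θ => φ (vec fun i => w i t θ) := by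
  refine ⟨hφ.comp (g := φ) (f := fun p : ℝ × E n => vec fun i => w i p.1 p.2) ?_, fun T => ?_⟩
  · unfold vec
    have : Continuous fun p : ℝ × E n => fun i => w i p.1 p.2 := continuous_pi fun i => hw i
    fun_prop
  · obtain ⟨C, hC⟩ := hb T
    obtain ⟨D, hD⟩ := (isCompact_closedBall (0 : E n) (C+1)).exists_bound_of_continuousOn hφ.continuousOn
    refine ⟨max D 0, le_max_right _ _, fun t θ ht => ?_⟩
    have h1 : ‖vec fun i => w i t θ‖ ≤ C + 1 := by
      have := hC t θ ht
      rw [← vec_sq] at this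
      nlinarith [sq_nonneg (‖vec fun i => w i t θ‖ - 1)]
    refine ((hD _ (mem_closedBall_zero_iff.2 h1)).trans (le_max_left D 0)).trans ?_
    have : 1 ≤ exp (max D 0 * ‖θ‖) := one_le_exp (by positivity)
    nlinarith [le_max_right D 0]
lemma EB.time {f : ℝ → ℝ} (hf : Continuous f) : EB fun t (_ : E n) => f t := by
  refine ⟨hf.comp continuous_fst, fun T => ?_⟩
  obtain ⟨D, hD⟩ := (isCompact_closedBall (0 : ℝ) T).exists_bound_of_continuousOn hf.continuousOn
  refine ⟨max D 0, le_max_right _ _, fun t θ ht => ?_⟩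
  refine ((hD t (by rwa [mem_closedBall_zero_iff])).trans (le_max_left D 0)).trans ?_
  have : 1 ≤ exp (max D 0 * ‖θ‖) := one_le_exp (by positivity)
  nlinarith [le_max_right D 0]
lemma Gen.time {f f' : ℝ → ℝ} (hf : Continuous f) (hf' : Continuous f') (hd : ∀ t, 0 < t → HasDerivAt f (f' t) t) :
    Gen m (fun t _ => f t) (fun t _ => f' t) (fun _ _ _ => 0) := by
  refine ⟨fun t _ => f' t, fun _ _ _ => 0, ⟨EB.time hf, EB.time hf', fun _ => EB.const 0, fun _ => EB.const 0, fun t ht θ => ?_, fun k t ht θ => hasDerivAt_const _ _⟩, by simp⟩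
  refine ((hd t ht).comp_hasFDerivAt (t, θ) (hasFDerivAt_fst (𝕜 := ℝ) (E := ℝ) (F := E n))).congr_fderiv (ContinuousLinearMap.ext fun ⟨s, y⟩ => ?_)
  rw [DL_apply]; simp
lemma AA_spec (m : Measure (E n)) [CSupp m] (t : ℝ) (θ : E n) : ∃ (l : Fin n → ℝ) (U : Mx n), U.transpose * U = 1 ∧ U * U.transpose = 1 ∧
    (Matrix.of fun i j => AA m i j t θ) = U * Matrix.diagonal (fun i => 1 + l i) * U.transpose ∧ (∀ i, 0 ≤ 1 + l i) ∧
    (∀ z i, SS m z t θ < 1 → 1 + l i ≤ 3/2) ∧ ∀ i, LC m 0 → 0 < t → 1 + l i ≤ 1/t := by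
  obtain ⟨l, U, u1, u2, hp, f, n2, l1⟩ := spec_NN m t θ
  refine ⟨l, U, u1, u2, ?_, fun i => by linarith [l1 i], fun z i h => ?_, fun i h ht => ?_⟩
  · have h1 := hp 1
    simp only [pow_one] at h1
    have h2 : Matrix.diagonal (fun i => 1 + l i) = 1 + Matrix.diagonal l := by
      rw [← Matrix.diagonal_one, Matrix.diagonal_add]
    rw [h2, Matrix.mul_add, Matrix.add_mul, Matrix.mul_one, u2, ← h1, NN, add_sub_cancel]
  · by_contra hh
    push Not at hh
    have h1 : 1 ≤ (2 * l i)^2 := by nlinarith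
    have h2 : ((2 * l i)^2)^(z+1) ≤ SS m z t θ := by
      rw [SS_eq u1 hp]; exact Finset.single_le_sum (f := fun i => ((2 * l i)^2)^(z+1)) (fun _ _ => by positivity) (Finset.mem_univ i)
    linarith [one_le_pow₀ h1 (n := z+1)]
  · have h1 := f (U.mulVec (Pi.single i 1))
    have h2 := cv_le h (s := t) (by linarith) θ (U.mulVec (Pi.single i 1))
    rw [← n2, h1, Matrix.mulVec_mulVec, u1, Matrix.one_mulVec, Finset.sum_eq_single i (fun j _ hj => by simp [hj]) (by simp), Finset.sum_eq_single i (fun j _ hj => by simp [hj]) (by simp)] at h2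
    simpa using h2
lemma tr_le {H U : Mx n} {μ : Fin n → ℝ} {c : ℝ} (u2 : U * U.transpose = 1) (u1 : U.transpose * U = 1) (hH : ∀ v : E n, 0 ≤ ∑ i, v i * ∑ j, H i j * v j) (hμ : ∀ i, μ i^2 ≤ c)
    {A : Mx n} (hA : A = U * Matrix.diagonal μ * U.transpose) : ∑ i, ∑ j, H i j * ∑ k, A i k * A j k ≤ c * ∑ i, H i i := by
  have hs : A.transpose = A := by rw [hA]; simp [Matrix.transpose_mul, Matrix.mul_assoc]
  have e1 : ∑ i, ∑ j, H i j * ∑ k, A i k * A j k = (H * (A * A.transpose)).trace := by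
    simp only [Matrix.trace, Matrix.diag, Matrix.mul_apply, Matrix.transpose_apply]
    exact sum_congr rfl fun i _ => sum_congr rfl fun j _ => by
      congr 1; exact sum_congr rfl fun k _ => mul_comm _ _
  have e2 : (H * (A * A.transpose)).trace = ∑ i, μ i^2 * (U.transpose * H * U) i i := by
    have : A * A = U * Matrix.diagonal (fun i => μ i^2) * U.transpose := by
      rw [hA]
      calc _ = U * Matrix.diagonal μ * (U.transpose * U) * Matrix.diagonal μ * U.transpose := by simp only [Matrix.mul_assoc]
        _ = _ := by rw [u1, Matrix.mul_one, Matrix.mul_assoc U, Matrix.diagonal_mul_diagonal]; simp only [sq]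
    rw [hs, this, ← Matrix.mul_assoc, Matrix.trace_mul_comm, ← Matrix.mul_assoc, ← Matrix.mul_assoc, Matrix.trace_mul_comm]
    simp [Matrix.trace, Matrix.diagonal_mul]
  have e3 : ∑ i, H i i = ∑ i, (U.transpose * H * U) i i := by
    change H.trace = (U.transpose * H * U).trace
    rw [Matrix.trace_mul_comm, ← Matrix.mul_assoc, u2, Matrix.one_mul]
  rw [e1, e2, e3, mul_sum]
  refine sum_le_sum fun i _ => mul_le_mul_of_nonneg_right (hμ i) ?_
  refine (hH (vec fun r => U r i)).trans_eq ?_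
  rw [Matrix.mul_assoc, Matrix.mul_apply]
  exact sum_congr rfl fun r _ => by simp only [Matrix.transpose_apply, Matrix.mul_apply]; rfl
def sg (t0 t : ℝ) : ℝ := √(max t 0 + t0) / 2
lemma sg_pos {t0 : ℝ} (h0 : 0 < t0) (t : ℝ) : 0 < sg t0 t := by
  have : 0 < max t 0 + t0 := by linarith [le_max_right t 0]
  unfold sg; positivity
lemma sg_sq {t0 : ℝ} (h0 : 0 < t0) (t : ℝ) : sg t0 t^2 = (max t 0 + t0)/4 := by
  rw [sg, div_pow, sq_sqrt (by linarith [le_max_right t 0])]; norm_num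
lemma sg_cont (t0 : ℝ) : Continuous (sg t0) := by unfold sg; fun_prop
lemma sg_deriv {t0 : ℝ} (h0 : 0 < t0) {t : ℝ} (ht : 0 < t) : HasDerivAt (sg t0) (1/(8 * sg t0 t)) t := by
  have h1 : HasDerivAt (fun t : ℝ => √(t + t0) / 2) (1 / (2 * √(t + t0)) / 2) t :=
    (((hasDerivAt_id t).add_const t0).sqrt (by simp; linarith)).div_const 2
  refine (h1.congr_of_eventuallyEq ?_).congr_deriv ?_
  · filter_upwards [lt_mem_nhds ht] with s hs
    rw [sg, max_eq_left hs.le]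
  · rw [sg, max_eq_left ht.le]; have : √(t + t0) ≠ 0 := by positivity
    field_simp; norm_num
variable (m h) in
def wv (t0 t : ℝ) (θ : E n) : E n := vec fun i => sg t0 t * av m i t θ
variable (m h) in
def FF (t0 t : ℝ) (θ : E n) : ℝ := (sg t0 t)⁻¹ * PP h (wv m t0 t θ)
variable (m h) in
def LL (t0 t : ℝ) (θ : E n) : ℝ := sg t0 t / 2 * (∑ i, ∑ j, p2 h i j (wv m t0 t θ) * ∑ k, AA m i k t θ * AA m j k t θ - 4/(max t 0 + t0)^2 * ∑ i, p2 h i i (wv m t0 t θ))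
lemma FF_gen {R t0 : ℝ} (s : Sub h R) (h0 : 0 < t0) : ∃ d, Gen m (FF m h t0) (LL m h t0) d := by
  have hs := sg_pos h0
  have hw : ∀ i, Gen m (fun t θ => sg t0 t * av m i t θ) (fun t θ => 1/(8 * sg t0 t) * av m i t θ) (fun k t θ => sg t0 t * AA m i k t θ) := fun i => by
    refine ((Gen.time (m := m) (sg_cont t0) (f' := fun t => 1/(8 * sg t0 t)) (continuous_const.div (continuous_const.mul (sg_cont t0)) fun t => (mul_pos (by norm_num) (hs t)).ne') fun t ht => sg_deriv h0 ht).mul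
      (vv_gen (m := m) (f := fun x => x i) (by fun_prop))).congr (fun _ _ => rfl) (fun _ _ => by simp; left; rfl) fun k t θ => ?_
    rw [zero_mul, zero_add, AA_comm]; rfl
  have hc := fun i => (hw i).eb.1
  have hb : ∀ T : ℝ, ∃ C, ∀ t θ, |t| ≤ T → ∑ i, (sg t0 t * av m i t θ)^2 ≤ C := fun T => by
    obtain ⟨B, hB, hx⟩ := CSupp.bdd (m := m)
    refine ⟨∑ _i : Fin n, (T + t0) / 4 * B^2, fun t θ ht => sum_le_sum fun i _ => ?_⟩
    rw [mul_pow, sg_sq h0]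
    have h1 : |av m i t θ| ≤ B := Mn_le m (by fun_prop) (hx.mono fun x hx => (abs_coord_le x i).trans hx) t θ
    have h2 : max t 0 ≤ T := max_le ((le_abs_self t).trans ht) ((abs_nonneg t).trans ht)
    have h3 : av m i t θ^2 ≤ B^2 := sq_le_sq.2 (by rwa [abs_of_nonneg hB])
    have h4 := le_max_right t 0
    gcongr
    linarith
  have hg := Gen.compV hw s.xb (EB.comp (PP_cont s.xb) hc hb) (fun i => EB.comp (p1_cont s.xb i) hc hb) (fun i j => EB.comp (p2_cont s.xb i j) hc hb)
  have hi := (Gen.time (m := m) (f := fun t => (sg t0 t)⁻¹) (f' := fun t => -(1/(8 * sg t0 t))/sg t0 t^2) ((sg_cont t0).inv₀ fun t => (hs t).ne')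
    ((continuous_const.div (continuous_const.mul (sg_cont t0)) fun t => (mul_pos (by norm_num) (hs t)).ne').neg.div ((sg_cont t0).pow 2) fun t => (pow_pos (hs t) 2).ne')
    fun t ht => (sg_deriv h0 ht).inv (hs t).ne')
  refine ⟨_, (hi.mul hg).congr (fun _ _ => rfl) (fun t θ => ?_) fun _ _ _ => rfl⟩
  simp only [zero_mul, Finset.sum_const_zero, add_zero]
  rw [LL, s.lap (wv m t0 t θ)]
  change _ * PP h (wv m t0 t θ) + _ * (∑ i, p1 h i (wv m t0 t θ) * _ + 1/2 * ∑ i, ∑ j, p2 h i j (wv m t0 t θ) * _) = _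
  have e0 : max t 0 + t0 = 4 * sg t0 t^2 := by rw [sg_sq h0]; ring
  have hst := hs t
  have e1 : ∑ i, p1 h i (wv m t0 t θ) * (wv m t0 t θ) i = 8 * sg t0 t^2 * ∑ i, p1 h i (wv m t0 t θ) * (1/(8 * sg t0 t) * av m i t θ) := by
    rw [mul_sum]
    refine sum_congr rfl fun i _ => ?_
    change _ * (sg t0 t * av m i t θ) = _
    field_simp
  have e2 : ∑ i, ∑ j, p2 h i j (wv m t0 t θ) * ∑ k, sg t0 t * AA m i k t θ * (sg t0 t * AA m j k t θ) = sg t0 t^2 * ∑ i, ∑ j, p2 h i j (wv m t0 t θ) * ∑ k, AA m i k t θ * AA m j k t θ := by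
    rw [mul_sum]
    refine sum_congr rfl fun i _ => ?_
    rw [mul_sum]
    refine sum_congr rfl fun j _ => ?_
    have : ∑ k, sg t0 t * AA m i k t θ * (sg t0 t * AA m j k t θ) = sg t0 t^2 * ∑ k, AA m i k t θ * AA m j k t θ := by
      rw [mul_sum]
      exact sum_congr rfl fun k _ => by ring
    rw [this]; ring
  rw [e0, e1, e2]
  field_simp
  ring
lemma LL_le {R t0 t c : ℝ} (s : Sub h R) (h0 : 0 < t0) {θ : E n} {l : Fin n → ℝ} {U : Mx n} (u1 : U.transpose * U = 1) (u2 : U * U.transpose = 1)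
    (hA : (Matrix.of fun i j => AA m i j t θ) = U * Matrix.diagonal (fun i => 1 + l i) * U.transpose) (hl : ∀ i, (1 + l i)^2 ≤ c) :
    LL m h t0 t θ ≤ sg t0 t / 2 * ((c - 4/(max t 0 + t0)^2) * ∑ i, p2 h i i (wv m t0 t θ)) := by
  have := tr_le (H := fun i j => p2 h i j (wv m t0 t θ)) u2 u1 (s.hess _) hl hA
  have hs := sg_pos h0 t
  rw [LL, sub_mul]
  gcongr
  exact this
lemma lap_nonneg {R : ℝ} (s : Sub h R) (w : E n) : 0 ≤ ∑ i, p2 h i i w := by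
  refine sum_nonneg fun i _ => ?_
  have := s.hess w (eb i)
  simpa [eb] using this
lemma LL_big {R t0 t : ℝ} (s : Sub h R) (hm : LC m 0) (h0 : 0 < t0) (ht : t0 ≤ t) (θ : E n) : LL m h t0 t θ ≤ 0 := by
  obtain ⟨l, U, u1, u2, hA, l0, -, l2⟩ := AA_spec m t θ
  have ht0 : 0 < t := h0.trans_le ht
  refine (LL_le s h0 u1 u2 hA (c := (1/t)^2) fun i => pow_le_pow_left₀ (l0 i) (l2 i hm ht0) 2).trans ?_
  have h1 : (1/t)^2 ≤ 4/(max t 0 + t0)^2 := by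
    rw [max_eq_left ht0.le, div_pow, one_pow, div_le_div_iff₀ (by positivity) (by positivity)]
    nlinarith
  exact mul_nonpos_of_nonneg_of_nonpos (by have := sg_pos h0 t; positivity) (mul_nonpos_of_nonpos_of_nonneg (by linarith) (lap_nonneg s _))
lemma LL_small {R t0 t : ℝ} (z : ℕ) (s : Sub h R) (hm : LC m 0) (h0 : 0 < t0) (h1 : t0 ≤ 2/3) (ht0 : 0 < t) (ht : t ≤ t0) (θ : E n) :
    LL m h t0 t θ ≤ √t0 * PP h 0 / t^2 * Th m z t θ := by
  obtain ⟨l, U, u1, u2, hA, l0, l1, l2⟩ := AA_spec m t θ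
  have hs := sg_pos h0 t
  have hl := lap_nonneg s (wv m t0 t θ)
  have hl2 := s.lap_le (wv m t0 t θ)
  have hst : sg t0 t ≤ √t0 := by
    rw [sg, max_eq_left ht0.le, div_le_iff₀ (by norm_num), ← sqrt_sq (show (0:ℝ) ≤ 2 by norm_num), ← Real.sqrt_mul h0.le]
    exact Real.sqrt_le_sqrt (by linarith)
  have hT := Th_nonneg (m := m) z t θ
  have hP := hl.trans hl2
  by_cases hS : SS m z t θ < 1
  · refine (LL_le s h0 u1 u2 hA (c := (3/2)^2) fun i => pow_le_pow_left₀ (l0 i) (l1 z i hS) 2).trans (le_trans ?_ (show (0:ℝ) ≤ _ by positivity))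
    have h2 : (3/2:ℝ)^2 ≤ 4/(max t 0 + t0)^2 := by
      rw [max_eq_left ht0.le, le_div_iff₀ (by positivity)]
      nlinarith
    exact mul_nonpos_of_nonneg_of_nonpos (by positivity) (mul_nonpos_of_nonpos_of_nonneg (by linarith) hl)
  · refine (LL_le s h0 u1 u2 hA (c := (1/t)^2) fun i => pow_le_pow_left₀ (l0 i) (l2 i hm ht0) 2).trans ?_
    have hT2 : 1/2 ≤ Th m z t θ := by
      push Not at hS
      rw [Th, le_div_iff₀ (by linarith)]; linarith
    have h4 : 0 ≤ 4/(max t 0 + t0)^2 := by positivity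
    calc _ ≤ √t0 / 2 * ((1/t)^2 * PP h 0) := by
          refine (mul_le_mul_of_nonneg_left ((mul_le_mul_of_nonneg_right (sub_le_self _ h4) hl).trans (mul_le_mul_of_nonneg_left hl2 (by positivity))) (by positivity)).trans ?_
          exact mul_le_mul_of_nonneg_right (by linarith) (by positivity)
      _ = √t0 * PP h 0 / t^2 * (1/2) := by ring
      _ ≤ _ := by gcongr
lemma G_q {R t0 T : ℝ} {z : ℕ} (s : Sub h R) (hm : LC m 0) (hN : NN m 0 0 = 0) (hz : 3 ≤ z) (hc : ∀ k, ∫ x, x k ∂m = 0) (h0 : 0 < t0) (h1 : t0 ≤ 2/3) (hn : n * (10^4 * (z+1) * √t0)^(z+1) ≤ 1)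
    (hT : t0 ≤ T) : EE m (FF m h t0) T ≤ 3 * PP h 0 / √t0 := by
  obtain ⟨d, hg⟩ := FF_gen (m := m) s h0
  have hP : 0 ≤ PP h 0 := (lap_nonneg s 0).trans (s.lap_le 0)
  have hst : 0 < √t0 := sqrt_pos.2 h0
  have hss : √t0^2 = t0 := sq_sqrt h0.le
  have q0 : EE m (FF m h t0) 0 = 2 * PP h 0 / √t0 := by
    have : wv m t0 0 0 = 0 := by
      ext k; change sg t0 0 * av m k 0 0 = 0
      rw [av, Mn_zero, hc, mul_zero]
    rw [EE_zero, FF, this, sg, max_self, zero_add]; field_simp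
  have q1 : EE m (FF m h t0) t0 ≤ 3 * PP h 0 / √t0 := by
    set B := √t0 * PP h 0 / t0^2
    have := anti_of (f := fun t => EE m (FF m h t0) t - B * t) (f' := fun t => EE m (LL m h t0) t - B) h0.le
      ((EE_cont m hg.eb).sub (by fun_prop)).continuousOn (fun t ht => (hg.deriv ht.1).sub (by simpa using (hasDerivAt_id t).const_mul B)) fun t ht => by
        have a1 : EE m (LL m h t0) t ≤ √t0 * PP h 0 / t^2 * EE m (Th m z) t := by
          rw [← EE_cmul]
          exact EE_mono m hg.el ((Th_eb z).cmul _) fun θ => LL_small z s hm h0 h1 ht.1 ht.2.le θ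
        have a2 := Th_EE hm hN (by omega : 1 ≤ z) ht.1 (by linarith [ht.2])
        have hs' : 0 < √t := sqrt_pos.2 ht.1
        have a3 : (n:ℝ) * (10^4 * (z+1) * √t)^(z+1) / t^2 ≤ 1/t0^2 := by
          have b1 : ∀ r : ℝ, 0 < r → (n:ℝ) * (10^4 * (z+1) * √r)^(z+1) / r^2 = n * (10^4 * (z+1))^4 * (10^4 * (z+1) * √r)^(z-3) := fun r hr => by
            have e : z + 1 = 4 + (z - 3) := by omega
            have e2 : √r^4 = r^2 := by rw [show 4 = 2 * 2 by norm_num, pow_mul, sq_sqrt hr.le]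
            rw [e, pow_add, mul_pow _ (√r) 4, e2]; field_simp
          calc _ ≤ (n:ℝ) * (10^4 * (z+1) * √t0)^(z+1) / t0^2 := by
                rw [b1 t ht.1, b1 t0 h0]; gcongr; exact ht.2.le
            _ ≤ _ := by gcongr
        have a4 : √t0 * PP h 0 / t^2 * EE m (Th m z) t ≤ B := by
          calc _ ≤ √t0 * PP h 0 / t^2 * (n * (10^4 * (z+1) * √t)^(z+1)) := by gcongr
            _ = √t0 * PP h 0 * (n * (10^4 * (z+1) * √t)^(z+1) / t^2) := by ring
            _ ≤ √t0 * PP h 0 * (1/t0^2) := by gcongr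
            _ = B := by ring
        show EE m (LL m h t0) t - B ≤ 0
        linarith
    simp only [mul_zero, sub_zero, q0] at this
    have e : B * t0 = PP h 0 / √t0 := by
      have : B * t0 = √t0 * PP h 0 / t0 := by simp only [B]; field_simp
      rw [this]; nth_rewrite 2 [← hss]; field_simp
    rw [e] at this
    have e3 : 3 * PP h 0 / √t0 = 2 * PP h 0 / √t0 + PP h 0 / √t0 := by ring
    linarith
  refine le_trans ?_ q1
  exact anti_of hT (EE_cont m hg.eb).continuousOn (fun t ht => hg.deriv (h0.trans ht.1)) fun t ht => by
    have := EE_mono m hg.el (EB.const 0) fun θ => LL_big s hm h0 ht.1.le θ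
    rwa [EE_const m 0 (h0.trans ht.1).le] at this
lemma Mn_sub {R t δ : ℝ} (s : Sub h R) (hm : LC m 0) (ht : 0 < t) (hδ : 0 < δ) (θ : E n) :
    Mn m h t θ ≤ h (vec fun k => av m k t θ) + (δ + R^2 / δ * (n / t)) := by
  have hc := s.cont
  set a : E n := vec fun k => av m k t θ
  rw [← tilt_int]
  have h1 : ∀ x, h x ≤ (h a + δ) + R^2/δ * ∑ k, (x k - av m k t θ)^2 := fun x => by
    have e : ∑ k, (x k - av m k t θ)^2 = ‖x - a‖^2 := by rw [EuclideanSpace.real_norm_sq_eq]; rfl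
    have h2 := s.lip x a
    rw [e]
    have h3 : R * ‖x - a‖ ≤ δ + R^2/δ * ‖x - a‖^2 := by
      rw [div_mul_eq_mul_div, ← sub_le_iff_le_add', le_div_iff₀ hδ]
      nlinarith [sq_nonneg (δ - R * ‖x - a‖), s.R0, mul_nonneg s.R0 (norm_nonneg (x - a))]
    linarith
  refine (integral_mono (int_m _ hc) (int_m _ (by fun_prop)) h1).trans ?_
  have h4 : ∀ k, ∫ x, (x k - av m k t θ)^2 ∂(tilt m t θ) ≤ 1/t := fun k => by
    rw [var_c (tilt m t θ) (f := fun x => x k) (by fun_prop)]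
    have := cv_le hm (s := t) (by linarith) θ (Pi.single k 1)
    have e : ∀ x : E n, ∑ j, (Pi.single k 1 : Fin n → ℝ) j * x j = x k := fun x => by simp [Pi.single_apply]
    simp only [e] at this
    rw [cv_self, ← tilt_int, ← tilt_int] at this
    have e2 : ∑ j, (Pi.single k 1 : Fin n → ℝ) j^2 = 1 := by simp [Pi.single_apply]
    rw [e2, zero_add, mul_one] at this
    rw [av, ← tilt_int]; linarith
  rw [integral_add (integrable_const _) (int_m _ (by fun_prop)), integral_const_mul, integral_finsetSum _ fun k _ => int_m _ (by fun_prop)]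
  have h5 := sum_le_sum fun k (_ : k ∈ Finset.univ) => h4 k
  simp only [Finset.sum_const, Finset.card_univ, Fintype.card_fin, nsmul_eq_mul] at h5
  have h6 : R^2/δ * ∑ k, ∫ x, (x k - av m k t θ)^2 ∂(tilt m t θ) ≤ R^2/δ * (n/t) := by
    gcongr; exact h5.trans_eq (by ring)
  simp; linarith
lemma G_main {R t0 : ℝ} {z : ℕ} (s : Sub h R) (hm : LC m 0) (hN : NN m 0 0 = 0) (hz : 3 ≤ z) (hc : ∀ k, ∫ x, x k ∂m = 0) (h0 : 0 < t0) (h1 : t0 ≤ 2/3) (hn : n * (10^4 * (z+1) * √t0)^(z+1) ≤ 1) :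
    ∫ x, h x ∂m ≤ 3 * PP h 0 / √t0 := by
  refine le_of_forall_pos_le_add fun ε hε => ?_
  set δ := ε/2
  have hδ : 0 < δ := by positivity
  obtain ⟨T, hT, hT2⟩ : ∃ T, t0 ≤ T ∧ R^2/δ * n ≤ δ * T := ⟨max t0 (R^2/δ * n / δ), le_max_left _ _, by
    rw [mul_comm δ, ← div_le_iff₀ hδ]; exact le_max_right _ _⟩
  have hT0 : 0 < T := h0.trans_le hT
  obtain ⟨d, hg⟩ := FF_gen (m := m) s h0
  rw [← EE_Mn m s.cont hT0.le]
  have : EE m (Mn m h) T ≤ EE m (fun t θ => FF m h t0 t θ + ε) T := by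
    refine EE_mono m (EB.Mn m s.cont) (hg.eb.add (EB.const ε)) fun θ => ?_
    refine (Mn_sub s hm hT0 hδ θ).trans ?_
    have hs := sg_pos h0 T
    have a1 : h (vec fun k => av m k T θ) ≤ FF m h t0 T θ := by
      have e : wv m t0 T θ = sg t0 T • (vec fun k => av m k T θ) := rfl
      have := s.le_PP (wv m t0 T θ)
      rw [e, s.hom _ hs.le] at this
      rw [FF, e, le_inv_mul_iff₀ hs]; exact this
    have a2 : R^2/δ * (n/T) ≤ δ := by rw [← mul_div_assoc, div_le_iff₀ hT0]; exact hT2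
    have : δ + δ = ε := by simp [δ]
    linarith
  rw [EE_add m hg.eb (EB.const ε), EE_const m ε hT0.le] at this
  linarith [G_q s hm hN hz hc h0 h1 hn hT]
end
end SL
end
section
namespace SL
variable {n : ℕ}
set_option linter.unusedSectionVars false
section
lemma p2_symm {h : E n → ℝ} (i j : Fin n) (w : E n) : p2 h i j w = p2 h j i w := by
  have : (fun z : E n => z j * (z i * h z)) = fun z => z i * (z j * h z) := by ext z; ring
  unfold p2
  rw [this]
  simp only [eq_comm (a := i) (b := j)]
  ring
lemma prod_ge (s : Finset (Fin n)) {f : Fin n → ℝ} (hf : ∀ i, 0 ≤ f i) : 1 + ∑ i ∈ s, f i ≤ ∏ i ∈ s, (1 + f i) := by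
  induction s using Finset.induction_on with
  | empty => simp
  | insert a s ha ih =>
    rw [Finset.sum_insert ha, Finset.prod_insert ha]
    nlinarith [hf a, sum_nonneg fun i (_ : i ∈ s) => hf i]
lemma det_ge {H : Mx n} (hs : H.transpose = H) (hH : ∀ v : E n, 0 ≤ ∑ i, v i * ∑ j, H i j * v j) {a b : ℝ} (ha : 0 ≤ a) (ha1 : a ≤ 1) (hb : 0 ≤ b) :
    a^n * (1 + b * ∑ i, H i i) ≤ (a • (1 : Mx n) + b • H).det := by
  obtain ⟨l, U, u1, u2, hp⟩ := spec hs
  have h1 := hp 1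
  simp only [pow_one] at h1
  have e : a • (1 : Mx n) + b • H = U * Matrix.diagonal (fun i => a + b * l i) * U.transpose := by
    have h2 : Matrix.diagonal (fun i => a + b * l i) = a • (1 : Mx n) + b • Matrix.diagonal l := by
      rw [← Matrix.diagonal_one, ← Matrix.diagonal_smul, ← Matrix.diagonal_smul, Matrix.diagonal_add]; simp
    rw [h2, Matrix.mul_add, Matrix.add_mul, Matrix.mul_smul, Matrix.smul_mul, Matrix.mul_smul, Matrix.smul_mul, ← h1, Matrix.mul_one, u2]
  have hl : ∀ i, l i = (U.transpose * H * U) i i := fun i => by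
    rw [h1]
    have : U.transpose * (U * Matrix.diagonal l * U.transpose) * U = (U.transpose * U) * Matrix.diagonal l * (U.transpose * U) := by
      simp only [Matrix.mul_assoc]
    rw [this, u1]; simp
  have hl0 : ∀ i, 0 ≤ l i := fun i => by
    rw [hl]
    refine (hH (vec fun r => U r i)).trans_eq ?_
    rw [Matrix.mul_assoc, Matrix.mul_apply]
    exact sum_congr rfl fun r _ => by simp only [Matrix.transpose_apply, Matrix.mul_apply]; rfl
  have e3 : ∑ i, H i i = ∑ i, l i := by
    simp only [hl]
    change H.trace = (U.transpose * H * U).trace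
    rw [Matrix.trace_mul_comm, ← Matrix.mul_assoc, u2, Matrix.one_mul]
  rw [e, Matrix.det_mul, mul_comm _ U.transpose.det, ← Matrix.det_mul, ← Matrix.mul_assoc, u1, Matrix.one_mul, Matrix.det_diagonal, e3, mul_sum]
  calc _ ≤ a^n * ∏ i, (1 + b * l i) := mul_le_mul_of_nonneg_left (prod_ge _ fun i => mul_nonneg hb (hl0 i)) (by positivity)
    _ = ∏ i, (a * (1 + b * l i)) := by rw [Finset.prod_mul_distrib]; simp
    _ ≤ _ := Finset.prod_le_prod (fun i _ => mul_nonneg ha (by have := mul_nonneg hb (hl0 i); linarith)) fun i _ => by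
        nlinarith [mul_nonneg hb (hl0 i)]
variable {m : Measure (E n)} [CSupp m] {K : Set (E n)} {h : E n → ℝ} {R : ℝ}
lemma flux (I : Iso m K) (s : Sub h R) (hn : 1 ≤ n) (hK : ∀ g, (∀ v, ⟪g, v⟫ ≤ h v) → g ∈ K) {c : ℝ} (hc : 0 < c) :
    c * ∫ x, (∑ i, p2 h i i (c • x)) ∂m ≤ 2 * n := by
  set a : ℝ := 1 - 1/(2*n)
  set b : ℝ := 1/(2*n)
  have hn' : (1:ℝ) ≤ n := by exact_mod_cast hn
  have hb : 0 < b := by positivity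
  have hb1 : b ≤ 1/2 := by simp only [b]; rw [div_le_div_iff₀ (by positivity) (by norm_num)]; linarith
  have hab : a + b = 1 := by simp [a, b]
  have ha : 0 < a := by linarith
  let f : E n → E n := fun x => vec fun i => a * x i + b * p1 h i (c • x)
  let M : E n → Mx n := fun x => a • (1 : Mx n) + (b * c) • Matrix.of fun i j => p2 h i j (c • x)
  have hfd : ∀ x, HasFDerivAt f (ML (M x)) x := fun x => fd_vec fun i => by
    have h1 : HasFDerivAt (fun x : E n => c • x) (c • ContinuousLinearMap.id ℝ (E n)) x := (hasFDerivAt_id x).const_smul c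
    have h2 := ((p1_fd s.xb i (c • x)).comp x h1).const_mul b
    have h3 := ((EuclideanSpace.proj i : E n →L[ℝ] ℝ).hasFDerivAt (x := x)).const_mul a
    refine (h3.add h2).congr_fderiv (ContinuousLinearMap.ext fun y => ?_)
    simp only [add_apply, smul_apply, ContinuousLinearMap.comp_apply, DS_apply, M, ContinuousLinearMap.id_apply]
    simp [Matrix.one_apply, add_mul, sum_add_distrib, mul_sum]
    exact sum_congr rfl fun j _ => by ring
  have hmem : ∀ x ∈ K, f x ∈ K := fun x hx => by
    have h1 : (vec fun i => p1 h i (c • x)) ∈ K := hK _ fun v => by rw [vec_inner]; exact s.grad_le _ _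
    have := I.conv hx h1 ha.le hb.le hab
    exact this
  have hinj : InjOn f K := fun x _ y _ hxy => by
    have h1 := s.grad (c • x) (c • y - c • x)
    have h2 := s.grad (c • y) (c • x - c • y)
    rw [add_sub_cancel] at h1 h2
    have h3 : ∑ k, (p1 h k (c • x) - p1 h k (c • y)) * (y k - x k) ≤ 0 := by
      have e : ∑ k, p1 h k (c • x) * (c • y - c • x) k + ∑ k, p1 h k (c • y) * (c • x - c • y) k = c * ∑ k, (p1 h k (c • x) - p1 h k (c • y)) * (y k - x k) := by
        rw [← sum_add_distrib, mul_sum]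
        exact sum_congr rfl fun k _ => by simp; ring
      have : c * ∑ k, (p1 h k (c • x) - p1 h k (c • y)) * (y k - x k) ≤ 0 := by linarith
      exact nonpos_of_mul_nonpos_right this hc
    have h4 : ∀ k, a * (x k - y k) = - b * (p1 h k (c • x) - p1 h k (c • y)) := fun k => by
      have := congrArg (fun z : E n => z k) hxy
      change a * x k + b * p1 h k (c • x) = a * y k + b * p1 h k (c • y) at this
      linarith
    have h5 : a * ‖x - y‖^2 ≤ 0 := by
      rw [EuclideanSpace.real_norm_sq_eq, mul_sum]
      calc _ = b * ∑ k, (p1 h k (c • x) - p1 h k (c • y)) * (y k - x k) := by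
            rw [mul_sum]
            refine sum_congr rfl fun k _ => ?_
            change a * (x k - y k)^2 = _
            linear_combination (x k - y k) * h4 k
        _ ≤ 0 := mul_nonpos_of_nonneg_of_nonpos hb.le h3
    have h6 : ‖x - y‖^2 = 0 := le_antisymm (nonpos_of_mul_nonpos_right h5 ha) (sq_nonneg _)
    exact sub_eq_zero.1 (norm_eq_zero.1 (pow_eq_zero_iff two_ne_zero |>.1 h6))
  have hdet : ∀ x, a^n * (1 + b * c * ∑ i, p2 h i i (c • x)) ≤ (ML (M x)).det := fun x => by
    rw [ML_det]
    exact det_ge (H := Matrix.of fun i j => p2 h i j (c • x)) (by ext i j; exact p2_symm _ _ _) (s.hess _) ha.le (by linarith) (by positivity)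
  have hchg := lintegral_abs_det_fderiv_eq_addHaar_image volume I.comp.measurableSet (fun x _ => (hfd x).hasFDerivWithinAt) hinj
  have hcont : Continuous fun x : E n => ∑ i, p2 h i i (c • x) := by
    refine continuous_finsetSum _ fun i _ => (p2_cont s.xb i i).comp (by fun_prop)
  have hL : ∫ x, a^n * (1 + b * c * ∑ i, p2 h i i (c • x)) ∂m ≤ 1 := by
    rw [← ENNReal.ofReal_le_one, ofReal_integral_eq_lintegral_ofReal (int_m m (by fun_prop)) (Eventually.of_forall fun x => by
      have := lap_nonneg s (c • x)
      simp only [Pi.zero_apply]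
      positivity)]
    have hv : ∫⁻ x in K, ofReal (a^n * (1 + b * c * ∑ i, p2 h i i (c • x))) ≤ volume K := by
      calc _ ≤ ∫⁻ x in K, ofReal |(ML (M x)).det| := lintegral_mono fun x => ofReal_le_ofReal ((hdet x).trans (le_abs_self _))
        _ ≤ _ := by rw [hchg]; exact measure_mono (by rintro _ ⟨x, hx, rfl⟩; exact hmem x hx)
    rw [I.hm, lintegral_smul_measure]
    refine (mul_le_mul_right hv _).trans_eq ?_
    exact ENNReal.inv_mul_cancel I.vol0 I.volt
  rw [integral_const_mul, integral_add (integrable_const _) (int_m m (by fun_prop)), integral_const_mul] at hL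
  simp only [integral_const, probReal_univ, smul_eq_mul, mul_one] at hL
  have hp : 1/2 ≤ a^n := by
    have := one_add_mul_le_pow (a := -b) (by linarith) n
    have e : (n:ℝ) * b = 1/2 := by simp only [b]; field_simp
    have e2 : 1 + -b = a := by linarith
    rw [e2] at this
    linarith
  set J := ∫ x, (∑ i, p2 h i i (c • x)) ∂m
  have hJ : 0 ≤ J := integral_nonneg fun x => lap_nonneg s _
  have h7 : b * c * J ≤ 1 := by nlinarith [mul_nonneg (mul_nonneg hb.le hc.le) hJ]
  have h8 : c * J ≤ 1 / b := by rw [le_div_iff₀ hb]; linarith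
  simpa [b] using h8
lemma W_le (I : Iso m K) (s : Sub h R) (hn : 1 ≤ n) (hK : ∀ g, (∀ v, ⟪g, v⟫ ≤ h v) → g ∈ K) {t0 : ℝ} {z : ℕ} (hz : 3 ≤ z) (h0 : 0 < t0) (h1 : t0 ≤ 2/3) (hz2 : n * (10^4 * (z+1) * √t0)^(z+1) ≤ 1) :
    PP h 0 ≤ 24 * n / √t0 := by
  have hG := G_main s I.lc I.cov hz I.mean h0 h1 hz2
  have hst : 0 < √t0 := sqrt_pos.2 h0
  set c : ℝ := √t0/6
  have hc : 0 < c := by positivity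
  have hF := flux I s hn hK hc
  have hcont : Continuous fun x : E n => ∑ i, p2 h i i (c • x) := by
    refine continuous_finsetSum _ fun i _ => (p2_cont s.xb i i).comp (by fun_prop)
  have hsc := s.cont
  have hJ : PP h 0 ≤ ∫ x, (∑ i, p2 h i i (c • x) + c * h x) ∂m := by
    have e : PP h 0 = ∫ x, (PP h 0 + ∑ k, p1 h k 0 * c * x k) ∂m := by
      rw [integral_add (integrable_const _) (int_m m (by fun_prop)), integral_finsetSum _ fun k _ => int_m m (by fun_prop)]
      simp [integral_const_mul, I.mean]
    rw [e]
    refine integral_mono (int_m m (by fun_prop)) (int_m m (by fun_prop)) fun x => ?_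
    have a1 := s.grad 0 (c • x)
    have a2 := s.lap (c • x)
    have a3 := s.grad_le (c • x) (c • x)
    rw [s.hom c hc.le] at a3
    rw [zero_add] at a1
    have a4 : ∑ k, p1 h k 0 * c * x k = ∑ k, p1 h k 0 * (c • x) k := sum_congr rfl fun k _ => by simp; ring
    simp only [a4]
    linarith
  rw [integral_add (int_m m hcont) (int_m m (by fun_prop)), integral_const_mul] at hJ
  set J := ∫ x, (∑ i, p2 h i i (c • x)) ∂m
  have h3 : c * ∫ x, h x ∂m ≤ PP h 0 / 2 := by
    calc _ ≤ c * (3 * PP h 0 / √t0) := by gcongr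
      _ = _ := by simp only [c]; field_simp; ring
  have h4 : J ≤ 2 * n / c := by rw [le_div_iff₀ hc]; linarith
  have h5 : 2 * n / c = 12 * n / √t0 := by simp only [c]; field_simp; norm_num
  have h6 : 24 * n / √t0 = 2 * (12 * n / √t0) := by ring
  linarith
end
end SL
end
section
namespace SL
variable {n : ℕ}
set_option linter.unusedSectionVars false
section
variable {h : E n → ℝ} {R V : ℝ}
def qq (h : E n → ℝ) (x : E n) : ℝ := h x + h (-x)
lemma qq_neg (x : E n) : qq h (-x) = qq h x := by rw [qq, qq, neg_neg, add_comm]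
lemma qq_comm (x y : E n) : qq h (x - y) = qq h (y - x) := by rw [← qq_neg, neg_sub]
lemma Sub.qq_add (s : Sub h R) (x y : E n) : qq h (x + y) ≤ qq h x + qq h y := by
  have h1 := s.add x y
  have h2 := s.add (-x) (-y)
  unfold qq; rw [neg_add]; linarith
lemma Sub.qq_hom (s : Sub h R) {c : ℝ} (hc : 0 ≤ c) (x : E n) : qq h (c • x) = c * qq h x := by
  unfold qq; rw [← smul_neg, s.hom c hc, s.hom c hc]; ring
lemma Sub.qq_cont (s : Sub h R) : Continuous (qq h) := by have := s.cont; unfold qq; fun_prop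
lemma gamA (s : Sub h R) (h0 : ∀ x, 0 ≤ h x) (hV : 0 < V) (hP : PP h 0 ≤ V) : 1/2 ≤ (gam n).real {x | qq h x < 4 * V} := by
  have hi : Integrable h (gam n) := by simpa using s.intg 0
  have hi' : Integrable (fun x => h (-x)) (gam n) := by
    have c := s.cont
    obtain ⟨-, C, d, hC, hd, hb⟩ := s.xb
    exact integrable_of_exp (C := C) (c := d) (by fun_prop) fun x => by simpa using hb (-x)
  have hq : ∫ x, qq h x ∂(gam n) ≤ 2 * V := by
    unfold qq
    rw [integral_add hi hi', gam_neg]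
    rw [PP_eq] at hP
    simp only [add_zero] at hP
    linarith
  have h1 := mul_meas_ge_le_integral_of_nonneg (μ := gam n) (f := qq h) (Eventually.of_forall fun x => add_nonneg (h0 _) (h0 _)) (hi.add hi') (4 * V)
  have h2 := probReal_compl_eq_one_sub (μ := gam n) (s := {x | qq h x < 4 * V}) (isOpen_lt s.qq_cont continuous_const).measurableSet
  have e : {x | qq h x < 4 * V}ᶜ = {x | 4 * V ≤ qq h x} := by ext x; simp
  rw [e] at h2
  have h3 : (gam n).real {x | 4 * V ≤ qq h x} ≤ 1/2 := by
    by_contra hh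
    push Not at hh
    nlinarith
  linarith
lemma gam_tr {A : Set (E n)} (hA : MeasurableSet A) (hs : ∀ x, x ∈ A → -x ∈ A) (u : E n) :
    exp (-‖u‖^2/2) * (gam n).real A ≤ ∫ x, A.indicator 1 (x - u) ∂(gam n) := by
  set f : E n → ℝ := A.indicator 1
  have hf : ∀ x, f (-x) = f x := fun x => by
    by_cases hx : x ∈ A
    · simp only [f, indicator_of_mem hx, indicator_of_mem (hs x hx), Pi.one_apply]
    · have : -x ∉ A := fun h => hx (by simpa using hs _ h)
      simp only [f, indicator_of_notMem hx, indicator_of_notMem this]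
  have hi : ∀ v : E n, Integrable (fun x => f x * exp ⟪x, v⟫) (gam n) := fun v => by
    have h1 : Integrable (fun x : E n => exp ⟪x, v⟫) (gam n) := by
      refine integrable_of_exp (C := 1) (c := ‖v‖) (by fun_prop) fun x => ?_
      rw [abs_of_pos (exp_pos _), one_mul, mul_comm]
      exact exp_le_exp.2 (real_inner_le_norm _ _)
    refine (h1.indicator hA).congr (Eventually.of_forall fun x => ?_)
    by_cases hx : x ∈ A <;> simp [f, hx]
  have e1 : ∫ x, f (x - u) ∂(gam n) = exp (-‖u‖^2/2) * ∫ x, f x * exp ⟪x, -u⟫ ∂(gam n) := by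
    have := gam_shift f (-u)
    simp only [← sub_eq_add_neg] at this
    rw [this, ← integral_const_mul]
    congr 1; ext x
    rw [norm_neg, sub_eq_add_neg, exp_add, ← neg_div]; ring
  have e2 : ∫ x, f x * exp ⟪x, u⟫ ∂(gam n) = ∫ x, f x * exp ⟪x, -u⟫ ∂(gam n) := by
    rw [← gam_neg]
    simp only [hf, inner_neg_left, inner_neg_right]
  have e3 : (gam n).real A = ∫ x, f x ∂(gam n) := by
    rw [integral_indicator_one hA]
  rw [e1]
  refine mul_le_mul_of_nonneg_left ?_ (exp_pos _).le
  have e4 : ∫ x, 2 * f x ∂(gam n) ≤ ∫ x, (f x * exp ⟪x, u⟫ + f x * exp ⟪x, -u⟫) ∂(gam n) := by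
    refine integral_mono (by simpa using (hi 0).const_mul 2) ((hi u).add (hi (-u))) fun x => ?_
    have h0 : 0 ≤ f x := indicator_nonneg (fun _ _ => zero_le_one) x
    have h1 := add_one_le_exp ⟪x, u⟫
    have h2 := add_one_le_exp ⟪x, -u⟫
    rw [inner_neg_right] at h2 ⊢
    nlinarith
  rw [integral_const_mul, integral_add (hi u) (hi (-u)), e2] at e4
  rw [e3]; linarith
lemma pack (s : Sub h R) (h0 : ∀ x, 0 ≤ h x) (hV : 0 < V) (hP : PP h 0 ≤ V) (F : Finset (E n))
    (hF : ∀ u ∈ F, ∀ v ∈ F, u ≠ v → 8 * V ≤ qq h (u - v)) : ∑ u ∈ F, exp (-‖u‖^2/2) ≤ 2 := by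
  set A := {x | qq h x < 4 * V}
  have hA : MeasurableSet A := (isOpen_lt s.qq_cont continuous_const).measurableSet
  have h1 := gamA s h0 hV hP
  have h2 := fun u => gam_tr hA (fun x (hx : qq h x < 4 * V) => show qq h (-x) < 4 * V by rwa [qq_neg]) u
  have hm : ∀ u : E n, Integrable (fun x => A.indicator (1 : E n → ℝ) (x - u)) (gam n) := fun u => by
    refine Integrable.of_bound (C := 1) ((measurable_one.indicator hA).comp (measurable_id.sub_const u)).aestronglyMeasurable (Eventually.of_forall fun x => ?_)
    refine (norm_indicator_le_norm_self _ _).trans ?_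
    simp
  have h3 : ∑ u ∈ F, ∫ x, A.indicator (1 : E n → ℝ) (x - u) ∂(gam n) ≤ 1 := by
    rw [← integral_finsetSum _ fun u _ => hm u]
    refine (integral_mono (g := fun _ => (1:ℝ)) (integrable_finsetSum _ fun u _ => hm u) (integrable_const _) fun x => ?_).trans (by simp)
    by_cases hx : ∃ u ∈ F, x - u ∈ A
    · obtain ⟨u, hu, hxu⟩ := hx
      change ∑ u ∈ F, A.indicator (1 : E n → ℝ) (x - u) ≤ 1
      rw [Finset.sum_eq_single u]
      · simp [hxu]
      · intro v hv hvu
        refine indicator_of_notMem (fun hxv => ?_) _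
        have a1 := hF u hu v hv hvu.symm
        have a2 := s.qq_add (x - v) (-(x - u))
        rw [qq_neg, show x - v + -(x - u) = u - v by abel] at a2
        have a3 : qq h (x - u) < 4 * V := hxu
        have a4 : qq h (x - v) < 4 * V := hxv
        linarith
      · exact fun hh => absurd hu hh
    · push Not at hx
      change ∑ u ∈ F, A.indicator (1 : E n → ℝ) (x - u) ≤ 1
      rw [Finset.sum_eq_zero fun u hu => indicator_of_notMem (hx u hu) _]
      exact zero_le_one
  have h4 : ∑ u ∈ F, exp (-‖u‖^2/2) * (1/2) ≤ 1 := by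
    refine (sum_le_sum fun u _ => ?_).trans h3
    exact (mul_le_mul_of_nonneg_left h1 (exp_pos _).le).trans (h2 u)
  rw [← sum_mul] at h4
  linarith
lemma pack2 (s : Sub h R) (h0 : ∀ x, 0 ≤ h x) (hV : 0 < V) (hP : PP h 0 ≤ V) {δ ρ : ℝ} (hδ : 0 < δ) (hρ : 0 ≤ ρ) {c : E n} (F : Finset (E n))
    (hc : ∀ x ∈ F, ‖x - c‖ ≤ ρ) (hF : ∀ x ∈ F, ∀ y ∈ F, x ≠ y → δ < qq h (x - y)) : (F.card : ℝ) ≤ exp (160 * V^2 * ρ^2 / δ^2) := by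
  set k : ℝ := 8 * V / δ
  have hk : 0 < k := by positivity
  have hkd : k * δ = 8 * V := by simp only [k]; field_simp
  have hq : ∀ v, δ < qq h v → 8 * V ≤ qq h (k • v) := fun v hv => by
    rw [s.qq_hom hk.le, ← hkd]; gcongr
  rcases Nat.lt_or_ge F.card 2 with h2 | h2
  · refine le_trans ?_ (one_le_exp (by positivity))
    exact_mod_cast (by omega : F.card ≤ 1)
  obtain ⟨a, ha, b, hb, hab⟩ := Finset.one_lt_card.1 h2
  have p1 : 2 ≤ exp (128 * V^2 * ρ^2 / δ^2) := by
    set w := k • (a - b)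
    have hw : 8 * V ≤ qq h w := hq _ (hF a ha b hb hab)
    have hw0 : w ≠ 0 := smul_ne_zero hk.ne' (sub_ne_zero.2 hab)
    have hww : w ≠ -w := fun e => hw0 (by
      have : (2:ℝ) • w = 0 := by rw [two_smul]; nth_rewrite 2 [e]; simp
      exact (smul_eq_zero.1 this).resolve_left two_ne_zero)
    have hw2 : 8 * V ≤ qq h (w - -w) := by
      rw [sub_neg_eq_add, ← two_smul ℝ w, s.qq_hom zero_le_two]; linarith
    have := pack s h0 hV hP {0, w, -w} (by
      intro u hu v hv huv
      simp only [Finset.mem_insert, Finset.mem_singleton] at hu hv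
      rcases hu with rfl | rfl | rfl <;> rcases hv with rfl | rfl | rfl <;> first | exact absurd rfl huv | skip
      · rwa [zero_sub, qq_neg]
      · rwa [zero_sub, neg_neg]
      · rwa [sub_zero]
      · exact hw2
      · rwa [sub_zero, qq_neg]
      · rwa [qq_comm])
    rw [Finset.sum_insert (by simp [hw0, hw0.symm]), Finset.sum_insert (by simpa using hww), Finset.sum_singleton, norm_neg, norm_zero] at this
    have hn : ‖w‖ ≤ k * (2 * ρ) := by
      rw [norm_smul, norm_of_nonneg hk.le]
      gcongr
      have := norm_sub_le (a - c) (b - c)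
      rw [sub_sub_sub_cancel_right] at this
      linarith [hc a ha, hc b hb]
    have e : 128 * V^2 * ρ^2 / δ^2 = (k * (2 * ρ))^2/2 := by simp only [k]; field_simp; ring
    have h5 : ‖w‖^2/2 ≤ 128 * V^2 * ρ^2 / δ^2 := by rw [e]; gcongr
    have h6 : exp (-‖w‖^2/2) ≤ 1/2 := by
      norm_num at this
      linarith
    have h7 : exp (-‖w‖^2/2) * exp (‖w‖^2/2) = 1 := by rw [← exp_add]; ring_nf; simp
    have h8 := exp_le_exp.2 h5
    have h9 := exp_pos (‖w‖^2/2)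
    nlinarith
  have hinj : Function.Injective fun x : E n => k • (x - c) := fun x y hxy => by
    have := smul_right_injective (E n) hk.ne' hxy
    exact sub_left_injective this
  have := pack s h0 hV hP (F.image fun x => k • (x - c)) (by
    intro u hu v hv huv
    obtain ⟨x, hx, rfl⟩ := Finset.mem_image.1 hu
    obtain ⟨y, hy, rfl⟩ := Finset.mem_image.1 hv
    rw [← smul_sub, sub_sub_sub_cancel_right]
    exact hq _ (hF x hx y hy fun e => huv (by rw [e])))
  rw [Finset.sum_image hinj.injOn] at this
  have h3 : ∀ x ∈ F, exp (-(32 * V^2 * ρ^2 / δ^2)) ≤ exp (-‖k • (x - c)‖^2/2) := fun x hx => by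
    refine exp_le_exp.2 ?_
    rw [neg_div, neg_le_neg_iff, norm_smul, norm_of_nonneg hk.le]
    have e : 32 * V^2 * ρ^2 / δ^2 = (k * ρ)^2/2 := by simp only [k]; field_simp; ring
    rw [e]; gcongr; exact hc x hx
  have h4 := (sum_le_sum h3).trans this
  rw [Finset.sum_const, nsmul_eq_mul] at h4
  have e : exp (160 * V^2 * ρ^2 / δ^2) = exp (128 * V^2 * ρ^2 / δ^2) * exp (32 * V^2 * ρ^2 / δ^2) := by
    rw [← exp_add]; ring_nf
  rw [exp_neg, ← div_eq_mul_inv, div_le_iff₀ (exp_pos _)] at h4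
  rw [e]
  exact h4.trans (mul_le_mul_of_nonneg_right p1 (exp_pos _).le)
lemma net (s : Sub h R) (h0 : ∀ x, 0 ≤ h x) (hV : 0 < V) (hP : PP h 0 ≤ V) {δ ρ : ℝ} (hδ : 0 < δ) (hρ : 0 ≤ ρ) (c : E n) {T : Set (E n)}
    (hT : ∀ x ∈ T, ‖x - c‖ ≤ ρ) : ∃ F : Finset (E n), ↑F ⊆ T ∧ (∀ x ∈ T, ∃ y ∈ F, qq h (x - y) ≤ δ) ∧ (F.card : ℝ) ≤ exp (160 * V^2 * ρ^2 / δ^2) := by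
  set S : Set ℕ := {k | ∃ F : Finset (E n), ↑F ⊆ T ∧ (∀ x ∈ F, ∀ y ∈ F, x ≠ y → δ < qq h (x - y)) ∧ F.card = k}
  have hb : BddAbove S := ⟨⌊exp (160 * V^2 * ρ^2 / δ^2)⌋₊, by
    rintro k ⟨F, h1, h2, rfl⟩
    exact Nat.le_floor (pack2 s h0 hV hP hδ hρ F (fun x hx => hT x (h1 hx)) h2)⟩
  have hne : S.Nonempty := ⟨0, ∅, by simp, by simp, rfl⟩
  obtain ⟨F, h1, h2, h3⟩ := Nat.sSup_mem hne hb
  refine ⟨F, h1, fun x hx => ?_, pack2 s h0 hV hP hδ hρ F (fun x hx => hT x (h1 hx)) h2⟩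
  by_contra hh
  push Not at hh
  have hq0 : qq h 0 = 0 := by simp [qq, s.zero]
  have hxF : x ∉ F := fun hxF => by
    have := hh x hxF
    rw [sub_self, hq0] at this; linarith
  have : (insert x F).card ∈ S := by
    refine ⟨insert x F, ?_, ?_, rfl⟩
    · rw [Finset.coe_insert]; exact insert_subset hx h1
    · intro a ha b hb hab
      rcases Finset.mem_insert.1 ha with rfl | ha' <;> rcases Finset.mem_insert.1 hb with rfl | hb'
      · exact absurd rfl hab
      · exact hh b hb'
      · rw [qq_comm]; exact hh a ha'
      · exact h2 a ha' b hb' hab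
  have h4 := le_csSup hb this
  rw [Finset.card_insert_of_notMem hxF, ← h3] at h4
  omega
lemma netK (s : Sub h R) (h0 : ∀ x, 0 ≤ h x) (hV : 0 < V) (hP : PP h 0 ≤ V) {K : Set (E n)} (hK : ∀ x ∈ K, ∀ y, ⟪x, y⟫ ≤ h y) {B : ℝ} (hB : ∀ x ∈ K, ‖x‖ ≤ B) (J : ℕ) :
    ∀ r : ℝ, 0 < r → B ≤ 2^J * r → ∃ F : Finset (E n), (∀ x ∈ K, ∃ y ∈ F, ‖x - y‖ ≤ r) ∧ (F.card : ℝ) ≤ exp (860 * V^2 / r^2) := by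
  classical
  induction J with
  | zero =>
    intro r hr hBr
    refine ⟨{0}, fun x hx => ⟨0, by simp, ?_⟩, ?_⟩
    · have := hB x hx; simp at hBr ⊢; linarith
    · simp; positivity
  | succ J ih =>
    intro r hr hBr
    obtain ⟨F, hF, hc⟩ := ih (2 * r) (by positivity) (by rw [pow_succ] at hBr; linarith)
    have key := fun c : E n => net s h0 hV hP (δ := r^2) (ρ := 2 * r) (by positivity) (by positivity) c (T := {x ∈ K | ‖x - c‖ ≤ 2 * r}) (fun x hx => hx.2)
    choose G g1 g2 g3 using key
    refine ⟨F.biUnion G, fun x hx => ?_, ?_⟩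
    · obtain ⟨c, hcF, hxc⟩ := hF x hx
      obtain ⟨y, hy, hxy⟩ := g2 c x ⟨hx, hxc⟩
      refine ⟨y, Finset.mem_biUnion.2 ⟨c, hcF, hy⟩, ?_⟩
      have hyK : y ∈ K := (g1 c hy).1
      have a1 := hK x hx (x - y)
      have a2 := hK y hyK (-(x - y))
      have a3 : ‖x - y‖^2 ≤ r^2 := by
        rw [← real_inner_self_eq_norm_sq]
        nth_rewrite 1 [sub_eq_add_neg]
        rw [inner_add_left, inner_neg_left]
        rw [inner_neg_right] at a2
        unfold qq at hxy
        linarith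
      exact (pow_le_pow_iff_left₀ (norm_nonneg _) hr.le two_ne_zero).1 a3
    · have b1 : ((F.biUnion G).card : ℝ) ≤ F.card * exp (640 * V^2 / r^2) := by
        have : ((F.biUnion G).card : ℝ) ≤ ∑ c ∈ F, ((G c).card : ℝ) := by exact_mod_cast Finset.card_biUnion_le
        refine this.trans ((sum_le_sum fun c _ => g3 c).trans_eq ?_)
        rw [Finset.sum_const, nsmul_eq_mul]
        congr 2
        field_simp; norm_num
      refine b1.trans ((mul_le_mul_of_nonneg_right hc (exp_pos _).le).trans ?_)
      rw [← exp_add]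
      refine exp_le_exp.2 ?_
      have e : 860 * V^2 / (2 * r)^2 = 215 * V^2 / r^2 := by field_simp; norm_num
      rw [e, ← add_div]
      gcongr
      linarith [sq_nonneg V]
end
end SL
end
section
namespace SL
variable {n : ℕ}
set_option linter.unusedSectionVars false
section
variable {K : Set (E n)}
def hs (K : Set (E n)) (y : E n) : ℝ := sSup ((fun x => ⟪x, y⟫) '' K)
lemma hs_bdd (hc : IsCompact K) (y : E n) : BddAbove ((fun x => ⟪x, y⟫) '' K) := (hc.image (by fun_prop)).bddAbove
lemma le_hs (hc : IsCompact K) {x : E n} (hx : x ∈ K) (y : E n) : ⟪x, y⟫ ≤ hs K y := le_csSup (hs_bdd hc y) ⟨x, hx, rfl⟩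
lemma hs_le (hne : K.Nonempty) {y : E n} {a : ℝ} (h : ∀ x ∈ K, ⟪x, y⟫ ≤ a) : hs K y ≤ a :=
  csSup_le (hne.image _) (by rintro _ ⟨x, hx, rfl⟩; exact h x hx)
lemma hs_sub (hc : IsCompact K) (hne : K.Nonempty) : ∃ B, Sub (hs K) B ∧ ∀ x ∈ K, ‖x‖ ≤ B := by
  obtain ⟨B, hB⟩ := hc.isBounded.exists_norm_le
  have hB0 : 0 ≤ B := by obtain ⟨x, hx⟩ := hne; exact (norm_nonneg x).trans (hB x hx)
  refine ⟨B, ⟨hB0, fun x y => hs_le hne fun z hz => ?_, fun c hc' x => ?_, fun x => ?_⟩, hB⟩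
  · rw [inner_add_right]; exact add_le_add (le_hs hc hz x) (le_hs hc hz y)
  · refine le_antisymm (hs_le hne fun z hz => ?_) ?_
    · rw [inner_smul_right]; exact mul_le_mul_of_nonneg_left (le_hs hc hz x) hc'
    · rcases hc'.eq_or_lt with rfl | h0
      · obtain ⟨z, hz⟩ := hne
        have := le_hs hc hz ((0:ℝ) • x)
        simpa using this
      · rw [mul_comm, ← le_div_iff₀ h0]
        refine hs_le hne fun z hz => ?_
        rw [le_div_iff₀ h0, mul_comm, ← inner_smul_right]; exact le_hs hc hz _
  · have a : ∀ z ∈ K, |⟪z, x⟫| ≤ B * ‖x‖ := fun z hz => (abs_real_inner_le_norm _ _).trans (by gcongr; exact hB z hz)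
    obtain ⟨z, hz⟩ := id hne
    exact abs_le.2 ⟨(neg_le_of_abs_le (a z hz)).trans (le_hs hc hz x), hs_le hne fun z hz => le_of_abs_le (a z hz)⟩
lemma mem_of_hs (hc : IsCompact K) (hv : Convex ℝ K) (hne : K.Nonempty) {g : E n} (hg : ∀ v, ⟪g, v⟫ ≤ hs K v) : g ∈ K := by
  by_contra h
  obtain ⟨f, u, h1, h2⟩ := geometric_hahn_banach_closed_point hv hc.isClosed h
  set v := (InnerProductSpace.toDual ℝ (E n)).symm f
  have e : ∀ x, ⟪x, v⟫ = f x := fun x => by rw [real_inner_comm]; exact InnerProductSpace.toDual_symm_apply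
  have h3 := hg v
  have h4 : hs K v ≤ u := hs_le hne fun x hx => by rw [e]; exact (h1 x hx).le
  rw [e] at h3; linarith
lemma on_int (hc : IsCompact K) {F : Type*} [NormedAddCommGroup F] {f : E n → F} (hf : Continuous f) : IntegrableOn f K := hf.continuousOn.integrableOn_compact hc
lemma mean_inner (hc : IsCompact K) (hm : (∫ x in K, x) = (0 : E n)) (v : E n) : ∫ x in K, ⟪x, v⟫ = 0 := by
  have := (innerSL ℝ v).integral_comp_comm (on_int hc continuous_id)
  simp only [id, innerSL_apply_apply, hm, inner_zero_right] at this
  simpa [real_inner_comm] using this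
lemma hs_nonneg (hc : IsCompact K) (hv : volume K = 1) (hm : (∫ x in K, x) = (0 : E n)) (v : E n) : 0 ≤ hs K v := by
  rw [← mean_inner hc hm v]
  refine (setIntegral_mono_on (on_int hc (by fun_prop)) (on_int hc continuous_const) hc.measurableSet fun x hx => le_hs hc hx v).trans ?_
  simp [measureReal_def, hv]
def mk (L : ℝ) (K : Set (E n)) : Measure (E n) := (volume (L⁻¹ • K))⁻¹ • volume.restrict (L⁻¹ • K)
lemma vol_smul {L : ℝ} (hL : 0 < L) (hv : volume K = 1) : volume (L⁻¹ • K) = ofReal ((L⁻¹)^n) := by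
  rw [Measure.addHaar_smul, hv, mul_one, finrank_euclideanSpace_fin, abs_of_pos (by positivity)]
lemma mk_int {L : ℝ} (hL : 0 < L) (hv : volume K = 1) (f : E n → ℝ) : ∫ x, f x ∂(mk L K) = ∫ x in K, f (L⁻¹ • x) := by
  rw [Measure.setIntegral_comp_smul_of_pos volume f K (inv_pos.2 hL), mk, integral_smul_measure, vol_smul hL hv, finrank_euclideanSpace_fin,
    ENNReal.toReal_inv, toReal_ofReal (by positivity)]
lemma mk_cs {L : ℝ} (hL : 0 < L) (hc : IsCompact K) (hv : volume K = 1) : CSupp (mk L K) := by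
  have h1 := vol_smul hL hv
  obtain ⟨R, hR⟩ := (hc.smul L⁻¹).isBounded.exists_norm_le
  refine ⟨⟨?_⟩, max R 0, le_max_right _ _, ?_⟩
  · rw [mk, Measure.smul_apply, Measure.restrict_apply_univ, smul_eq_mul]
    refine ENNReal.inv_mul_cancel ?_ (hc.smul L⁻¹).measure_lt_top.ne
    rw [h1]; simp; positivity
  · exact Measure.ae_smul_measure ((ae_restrict_mem (hc.smul L⁻¹).measurableSet).mono fun x hx => (hR x hx).trans (le_max_left _ _)) _
lemma mk_iso {L : ℝ} (hL : 0 < L) (hc : IsCompact K) (hx : Convex ℝ K) (hv : volume K = 1) (hm : (∫ x in K, x) = (0 : E n))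
    (hq : ∀ ξ : E n, ‖ξ‖ = 1 → (∫ x in K, (⟪x, ξ⟫)^2) = L^2) [CSupp (mk L K)] : Iso (mk L K) (L⁻¹ • K) := by
  have hmean : ∀ k, ∫ x, x k ∂(mk L K) = 0 := fun k => by
    rw [mk_int hL hv]
    have := mean_inner hc hm (eb k)
    simp only [inner_eb] at this
    simp [integral_const_mul, this]
  have hd : ∀ i, ∫ x in K, x i * x i = L^2 := fun i => by
    have := hq (eb i) (norm_eb i)
    simp only [inner_eb, sq] at this ⊢; exact this
  refine ⟨hc.smul _, hx.smul _, rfl, ?_, hmean⟩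
  ext i j
  change AA (mk L K) i j 0 0 - (1 : Mx n) i j = 0
  rw [AA, cv, Mn_zero, Mn_zero, Mn_zero, hmean, hmean, mk_int hL hv, mul_zero, sub_zero, sub_eq_zero]
  have e : ∀ x : E n, (L⁻¹ • x) i * (L⁻¹ • x) j = (L^2)⁻¹ * (x i * x j) := fun x => by simp; ring
  simp only [e, integral_const_mul]
  by_cases hij : i = j
  · subst hij
    rw [hd, Matrix.one_apply_eq]; field_simp
  · rw [Matrix.one_apply_ne hij]
    have hn2 : ‖(eb i + eb j : E n)‖^2 = 2 := by
      rw [norm_add_sq_real, norm_eb, norm_eb, inner_eb]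
      simp [eb, Ne.symm hij]; norm_num
    have h1 := hq ((√2)⁻¹ • (eb i + eb j)) (by
      rw [norm_smul, ← sqrt_sq (norm_nonneg (eb i + eb j)), hn2, norm_inv, norm_of_nonneg (sqrt_nonneg 2)]; exact inv_mul_cancel₀ (by positivity))
    have e2 : ∀ x : E n, ⟪x, (√2)⁻¹ • (eb i + eb j)⟫^2 = 1/2 * (x i * x i) + 1/2 * (x j * x j) + x i * x j := fun x => by
      rw [inner_smul_right, inner_add_right, inner_eb, inner_eb, mul_pow, inv_pow, sq_sqrt zero_le_two]; ring
    simp only [e2] at h1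
    have c1 : ∀ i j, Integrable (fun x : E n => x i * x j) (volume.restrict K) := fun i j => on_int hc (by fun_prop)
    rw [integral_add (on_int hc (by fun_prop)) (c1 i j), integral_add ((c1 i i).const_mul _) ((c1 j j).const_mul _), integral_const_mul, integral_const_mul, hd, hd] at h1
    have : ∫ x in K, x i * x j = 0 := by linarith
    rw [this, mul_zero]
lemma W_main {L : ℝ} (hn : 2 ≤ n) (hL : 0 < L) (hc : IsCompact K) (hx : Convex ℝ K) (hne : K.Nonempty) (hv : volume K = 1) (hm : (∫ x in K, x) = (0 : E n))
    (hq : ∀ ξ : E n, ‖ξ‖ = 1 → (∫ x in K, (⟪x, ξ⟫)^2) = L^2) : PP (hs K) 0 ≤ 48 * 270000^2 * n * log n^2 := by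
  haveI := mk_cs hL hc hv
  have I := mk_iso hL hc hx hv hm hq
  have hn' : (2:ℝ) ≤ n := by exact_mod_cast hn
  have hlog : 0.69 ≤ log n := by
    have := Real.log_le_log (by norm_num) hn'
    linarith [Real.log_two_gt_d9]
  obtain ⟨z, hz⟩ : ∃ z, z = ⌈log n⌉₊ + 3 := ⟨_, rfl⟩
  have hz3 : 3 ≤ z := by omega
  have hp1 : log n + 4 ≤ (z:ℝ) + 1 := by rw [hz]; push_cast; linarith [Nat.le_ceil (log n)]
  have hp2 : (z:ℝ) + 1 ≤ 9 * log n := by rw [hz]; push_cast; linarith [Nat.ceil_lt_add_one (a := log n) (by linarith)]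
  obtain ⟨r, hr⟩ : ∃ r : ℝ, r = 1 / (10^4 * (z+1) * exp 1) := ⟨_, rfl⟩
  have hr0 : 0 < r := by rw [hr]; positivity
  have hri : 1/r ≤ 270000 * log n := by
    rw [hr, one_div_one_div]
    calc _ ≤ (10:ℝ)^4 * (9 * log n) * 3 := by gcongr; exact Real.exp_one_lt_three.le
      _ = _ := by ring
  have hr1 : r ≤ 1/2 := by
    rw [hr]; apply one_div_le_one_div_of_le (by norm_num)
    have := add_one_le_exp 1
    nlinarith
  have hst : √(r^2) = r := sqrt_sq hr0.le
  have hs4 : (n:ℝ) * (10^4 * (z+1) * √(r^2))^(z+1) ≤ 1/4 := by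
    have e : (10:ℝ)^4 * (z+1) * r = exp (-1) := by
      rw [hr, exp_neg]; field_simp
    rw [hst, e, ← Real.exp_nat_mul]
    nth_rewrite 1 [← Real.exp_log (show (0:ℝ) < n by linarith)]
    rw [← exp_add]
    calc _ ≤ exp (-4) := exp_le_exp.2 (by push_cast; linarith)
      _ ≤ _ := by
        rw [exp_neg, ← one_div]; apply one_div_le_one_div_of_le (by norm_num)
        linarith [add_one_le_exp 4]
  have ht1 : r^2 ≤ 2/3 := by nlinarith
  have hV := I.vol (by omega) (z := z) (t := r^2) (by positivity) ((Th_EE I.lc I.cov (by omega) (by positivity) (by linarith)).trans hs4)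
  rw [vol_smul hL hv, hst, ENNReal.ofReal_le_ofReal_iff (by positivity)] at hV
  have hL2 : r/2 ≤ L⁻¹ := (pow_le_pow_iff_left₀ (by positivity) (by positivity) (by omega)).1 hV
  have hL3 : L ≤ 2 * (1/r) := by
    have := (le_inv_comm₀ (by positivity) hL).1 hL2
    rwa [inv_div, ← mul_one_div] at this
  obtain ⟨B, s, hB⟩ := hs_sub hc hne
  have s' : Sub (fun y => L⁻¹ * hs K y) (L⁻¹ * B) := ⟨by have := s.R0; positivity, fun x y => by rw [← mul_add]; exact mul_le_mul_of_nonneg_left (s.add x y) (by positivity),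
    fun c h0 x => by simp only [s.hom c h0]; ring, fun x => by rw [abs_mul, abs_of_pos (inv_pos.2 hL), mul_assoc]; exact mul_le_mul_of_nonneg_left (s.bd x) (by positivity)⟩
  have hW := W_le I s' (by omega) (fun g hg => by
    rw [mem_inv_smul_set_iff₀ hL.ne']
    refine mem_of_hs hc hx hne fun v => ?_
    rw [real_inner_smul_left]
    have := hg v
    rwa [← div_eq_inv_mul, le_div_iff₀ hL, mul_comm] at this) hz3 (t0 := r^2) (by positivity) ht1 (hs4.trans (by norm_num))
  rw [PP_eq, integral_const_mul, ← PP_eq, hst, ← div_eq_inv_mul, div_le_iff₀ hL] at hW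
  refine hW.trans ?_
  calc 24 * n / r * L ≤ 24 * n / r * (2 * (1/r)) := by gcongr
    _ = 48 * n * (1/r)^2 := by ring
    _ ≤ 48 * n * (270000 * log n)^2 := by gcongr
    _ = _ := by ring
lemma rn_aux (hn : 1 ≤ n) : 0 < (volume (closedBall (0 : E n) 1)).toReal ^ (-(1:ℝ) / n) ∧
    (n:ℝ)/18 ≤ ((volume (closedBall (0 : E n) 1)).toReal ^ (-(1:ℝ) / n))^2 := by
  have hn' : (1:ℝ) ≤ n := by exact_mod_cast hn
  set v := volume (closedBall (0 : E n) 1)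
  have hvt : v ≠ ⊤ := measure_closedBall_lt_top.ne
  have hv0 : v ≠ 0 := (measure_closedBall_pos volume _ one_pos).ne'
  have hv : 0 < v.toReal := ENNReal.toReal_pos hv0 hvt
  refine ⟨by positivity, ?_⟩
  have h1 : ofReal (((2 * Real.pi)^((n:ℝ)/2))⁻¹ * exp (-n/2)) * volume (closedBall (0 : E n) √n) ≤ 1 := by
    calc _ = ∫⁻ _ in closedBall (0 : E n) √n, ofReal (((2 * Real.pi)^((n:ℝ)/2))⁻¹ * exp (-n/2)) := by simp
      _ ≤ ∫⁻ x in closedBall (0 : E n) √n, ofReal (gd x) := setLIntegral_mono' measurableSet_closedBall fun x hx => ofReal_le_ofReal (by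
          unfold gd
          have h2 : ‖x‖ ≤ √n := mem_closedBall_zero_iff.1 hx
          have h3 : ‖x‖^2 ≤ n := by
            have := pow_le_pow_left₀ (norm_nonneg x) h2 2
            rwa [sq_sqrt (by positivity)] at this
          gcongr)
      _ = gam n (closedBall (0 : E n) √n) := (withDensity_apply _ measurableSet_closedBall).symm
      _ ≤ 1 := prob_le_one
  have h2 : volume (closedBall (0 : E n) √n) = ofReal (√n^n) * v := by
    rw [Measure.addHaar_closedBall' volume _ (sqrt_nonneg _), finrank_euclideanSpace_fin]
  have h3 : ((2 * Real.pi)^((n:ℝ)/2))⁻¹ * exp (-n/2) * (√n^n * v.toReal) ≤ 1 := by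
    rw [h2] at h1
    have := ENNReal.toReal_mono ENNReal.one_ne_top h1
    rwa [ENNReal.toReal_mul, ENNReal.toReal_mul, toReal_ofReal (by positivity), toReal_ofReal (by positivity), ENNReal.toReal_one] at this
  have e1 : √n^n = (n:ℝ)^((n:ℝ)/2) := by
    rw [Real.sqrt_eq_rpow, ← Real.rpow_natCast, ← Real.rpow_mul (by positivity)]; ring_nf
  have e2 : exp (-n/2) = ((exp 1)^((n:ℝ)/2))⁻¹ := by
    rw [Real.exp_one_rpow, ← exp_neg]; ring_nf
  have h4 : v.toReal ≤ (18/n)^((n:ℝ)/2) := by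
    rw [Real.div_rpow (by norm_num) (by positivity), le_div_iff₀ (by positivity)]
    have h5 : (2 * Real.pi)^((n:ℝ)/2) * (exp 1)^((n:ℝ)/2) ≤ (18:ℝ)^((n:ℝ)/2) := by
      rw [← Real.mul_rpow (by positivity) (by positivity)]
      refine Real.rpow_le_rpow (by positivity) ?_ (by positivity)
      nlinarith [Real.pi_lt_d2, Real.exp_one_lt_d9, Real.pi_pos, exp_pos 1]
    refine le_trans ?_ h5
    rw [e1, e2, ← mul_inv, inv_mul_le_iff₀ (by positivity), mul_one] at h3
    linarith
  have h5 := Real.rpow_le_rpow_of_nonpos hv h4 (z := -(1:ℝ)/n) (div_nonpos_of_nonpos_of_nonneg (by norm_num) (by positivity))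
  rw [← Real.rpow_mul (by positivity), show (n:ℝ)/2 * (-1/n) = -(1/2) by field_simp, Real.rpow_neg (by positivity), ← Real.sqrt_eq_rpow] at h5
  have h6 := pow_le_pow_left₀ (by positivity) h5 2
  rwa [inv_pow, sq_sqrt (by positivity), inv_div] at h6
end
end SL
end
end

lemma covN_le {n : ℕ} {A B : Set (EuclideanSpace ℝ (Fin n))} {c : ℝ} (F : Finset (EuclideanSpace ℝ (Fin n)))
    (h : ∀ x ∈ A, ∃ y ∈ F, x - y ∈ B) (hc : (F.card : ℝ) ≤ c) : (covN A B : ℝ≥0∞) ≤ ENNReal.ofReal c := by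
  have h1 : covN A B ≤ (F.card : ℕ∞) := sInf_le ⟨F, fun x hx => by
    obtain ⟨y, hy, hxy⟩ := h x hx
    exact mem_iUnion₂.2 ⟨y, hy, x - y, hxy, by simp⟩, rfl⟩
  have h2 : (covN A B : ℝ≥0∞) ≤ ((F.card : ℕ∞) : ℝ≥0∞) := by exact_mod_cast h1
  refine h2.trans ?_
  rw [ENat.toENNReal_coe, ← ENNReal.ofReal_natCast]
  exact ENNReal.ofReal_le_ofReal hc

/-- Theorem (regular covering estimates, outer part): for an isotropic convex body `K`,
`max{N(K, t·r_n·B₂ⁿ), N(B₂ⁿ, t·r_n·K°)} ≤ exp(c₁²·(log n)⁴·n / t²)` for every `t > 0`. -/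
theorem stmt8 :
    ∃ c₁ : ℝ, 0 < c₁ ∧ ∀ (n : ℕ), 2 ≤ n →
      ∀ K : Set (EuclideanSpace ℝ (Fin n)),
        IsCompact K → Convex ℝ K → (interior K).Nonempty → IsIsotropic K →
        ∀ t : ℝ, 0 < t →
          max ((covN K ((t * rn n) • closedBall (0 : EuclideanSpace ℝ (Fin n)) 1) : ℝ≥0∞))
              ((covN (closedBall (0 : EuclideanSpace ℝ (Fin n)) 1)
                  ((t * rn n) • polarBody K) : ℝ≥0∞)) ≤
            ENNReal.ofReal (Real.exp (c₁ ^ 2 * (Real.log n) ^ 4 * n / t ^ 2)) := by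
  refine ⟨200 * (48 * 270000^2), by norm_num, fun n hn K hc hx hi ⟨hv, hm, L, hL, hq⟩ t ht => ?_⟩
  have hne : K.Nonempty := hi.mono interior_subset
  obtain ⟨r0, r1⟩ := SL.rn_aux (n := n) (by omega)
  change 0 < rn n at r0
  change (n:ℝ)/18 ≤ rn n^2 at r1
  have hW := SL.W_main hn hL hc hx hne hv hm hq
  obtain ⟨B, s, hB⟩ := SL.hs_sub hc hne
  have h0 := SL.hs_nonneg hc hv hm
  have hn' : (2:ℝ) ≤ n := by exact_mod_cast hn
  have hlog : 0 < Real.log n := Real.log_pos (by linarith)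
  set V : ℝ := 48 * 270000^2 * n * Real.log n^2 with hVd
  have hV : 0 < V := by positivity
  set σ := t * rn n with hσ
  have hσ0 : 0 < σ := by positivity
  have key : 860 * V^2 / σ^2 ≤ (200 * (48 * 270000^2))^2 * Real.log n^4 * n / t^2 := by
    rw [div_le_div_iff₀ (by positivity) (by positivity), hσ]
    have e1 : 860 * V^2 * t^2 = 860 * (48 * 270000^2)^2 * Real.log n^4 * n * t^2 * n := by rw [hVd]; ring
    rw [e1]
    calc _ ≤ 860 * (48 * 270000^2)^2 * Real.log n^4 * n * t^2 * (18 * rn n^2) := by gcongr; linarith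
      _ = 15480 * ((48 * 270000^2)^2 * Real.log n^4 * n * t^2 * rn n^2) := by ring
      _ ≤ 40000 * ((48 * 270000^2)^2 * Real.log n^4 * n * t^2 * rn n^2) := by gcongr; norm_num
      _ = _ := by ring
  refine max_le ?_ ?_
  · obtain ⟨J, hJ⟩ := pow_unbounded_of_one_lt (B / σ) (one_lt_two (α := ℝ))
    obtain ⟨F, f1, f2⟩ := SL.netK s h0 hV hW (fun x hx y => SL.le_hs hc hx y) hB J σ hσ0 ((div_le_iff₀ hσ0).1 hJ.le)
    refine covN_le F (fun x hx => ?_) (f2.trans (Real.exp_le_exp.2 key))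
    obtain ⟨y, hy, hxy⟩ := f1 x hx
    refine ⟨y, hy, ?_⟩
    rw [_root_.smul_closedBall _ _ zero_le_one, smul_zero, mul_one, Real.norm_of_nonneg hσ0.le, mem_closedBall_zero_iff]
    exact hxy
  · obtain ⟨F, -, f1, f2⟩ := SL.net s h0 hV hW hσ0 zero_le_one 0 (T := closedBall 0 1) (fun x hx => by simpa using hx)
    refine covN_le F (fun x hx => ?_) (f2.trans (Real.exp_le_exp.2 (le_trans ?_ key)))
    · obtain ⟨y, hy, hxy⟩ := f1 x hx
      refine ⟨y, hy, ?_⟩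
      rw [mem_smul_set_iff_inv_smul_mem₀ hσ0.ne']
      intro w hw
      rw [real_inner_smul_left, inv_mul_le_iff₀ hσ0, mul_one, real_inner_comm]
      have h1 := SL.le_hs hc hw (x - y)
      have h2 := h0 (-(x - y))
      unfold SL.qq at hxy
      linarith
    · exact div_le_div_of_nonneg_right (by nlinarith [sq_nonneg V]) (sq_nonneg σ)
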